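/- Let E be an m-dimensional primitive extremal subset of an Alexandrov space M, and let p ∈ E. Then p is a regular point of E (i.e., the tangent cone T_pE with the extrinsic metric is isometric to ℝ^m) if and only if p is an (m,δ)-strained point of M for every δ > 0. -/

import Mathlib

open Real Metric Set
open scoped ENNReal NNReal

noncomputable section

/-- The comparison angle in the `κ`-plane at the vertex between sides of
lengths `s` and `t`, opposite side of length `d`. -/
def cangleK (κ s t d : ℝ) : ℝ :=
  if 0 < κ then
    Real.arccos ((Real.cos (Real.sqrt κ * d) - Real.cos (Real.sqrt κ * s) * Real.cos (Real.sqrt κ * t)) /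
      (Real.sin (Real.sqrt κ * s) * Real.sin (Real.sqrt κ * t)))
  else if κ < 0 then
    Real.arccos ((Real.cosh (Real.sqrt (-κ) * s) * Real.cosh (Real.sqrt (-κ) * t) -
      Real.cosh (Real.sqrt (-κ) * d)) /
      (Real.sinh (Real.sqrt (-κ) * s) * Real.sinh (Real.sqrt (-κ) * t)))
  else Real.arccos ((s ^ 2 + t ^ 2 - d ^ 2) / (2 * s * t))

/-- The comparison angle `∠̃ q p r` at `p` in the `κ`-plane. -/
def cangle {X : Type*} [MetricSpace X] (κ : ℝ) (q p r : X) : ℝ :=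
  cangleK κ (dist p q) (dist p r) (dist q r)

/-- A `(k,δ)`-strainer at `p` (comparison angles taken in the `κ`-plane). -/
def IsStrainer {X : Type*} [MetricSpace X] (κ : ℝ) {k : ℕ} (a b : Fin k → X) (p : X)
    (δ : ℝ) : Prop :=
  (∀ i, π - δ < cangle κ (a i) p (b i)) ∧
  ∀ i j, i ≠ j →
    π / 2 - δ < cangle κ (a i) p (a j) ∧
    π / 2 - δ < cangle κ (a i) p (b j) ∧
    π / 2 - δ < cangle κ (b i) p (b j)

/-- A `(k,δ)`-strained point. -/
def IsStrainedPt {X : Type*} [MetricSpace X] (κ : ℝ) (k : ℕ) (δ : ℝ) (p : X) : Prop :=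
  ∃ a b : Fin k → X, IsStrainer κ a b p δ

/-- An Alexandrov space of curvature `≥ κ`: complete, geodesic (via midpoints), and the
sum of the three `κ`-comparison angles of any quadruple is at most `2π`. -/
def IsAlexandrov (X : Type*) [MetricSpace X] (κ : ℝ) : Prop :=
  CompleteSpace X ∧
  (∀ x y : X, ∃ z : X, dist x z = dist x y / 2 ∧ dist z y = dist x y / 2) ∧
  ∀ p q r s : X, q ≠ p → r ≠ p → s ≠ p →
    cangle κ q p r + cangle κ r p s + cangle κ s p q ≤ 2 * π

/-- `p` is a critical point of `dist q`. -/
def IsCriticalPt {X : Type*} [MetricSpace X] (κ : ℝ) (q p : X) : Prop :=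
  ∀ x : X, x ≠ p → cangle κ q p x ≤ π / 2

/-- An extremal subset: closed, and every local minimum point `p ∈ E` of `dist q|_E`
with `q ∉ E` is a critical point of `dist q`. -/
def IsExtremal {X : Type*} [MetricSpace X] (κ : ℝ) (E : Set X) : Prop :=
  IsClosed E ∧
  ∀ q ∉ E, ∀ p ∈ E, IsLocalMinOn (fun x => dist q x) E p → IsCriticalPt κ q p

/-- A primitive extremal subset: an extremal subset containing no proper extremal
subset with nonempty relative interior. -/
def IsPrimitiveExtremal {X : Type*} [MetricSpace X] (κ : ℝ) (E : Set X) : Prop :=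
  IsExtremal κ E ∧
  ∀ F : Set X, IsExtremal κ F → F ⊆ E → F ≠ E →
    ∀ x ∈ F, ¬ ∃ r > (0:ℝ), Metric.ball x r ∩ E ⊆ F

/-- `p` is a regular point of `E` of dimension `m`: the tangent cone of `E` at `p`
(with the extrinsic metric) is isometric to `ℝ^m`, expressed through blow-ups:
balls of `E` around `p` at scale `r` are `εr`-approximated by `r`-balls of `ℝ^m`. -/
def IsRegularPt {X : Type*} [MetricSpace X] (E : Set X) (m : ℕ) (p : X) : Prop :=
  ∀ ε > (0:ℝ), ∃ r₀ > (0:ℝ), ∀ r, 0 < r → r < r₀ →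
    ∃ f : X → EuclideanSpace ℝ (Fin m),
      f p = 0 ∧
      (∀ x ∈ E ∩ Metric.closedBall p r, ∀ y ∈ E ∩ Metric.closedBall p r,
        |dist (f x) (f y) - dist x y| ≤ ε * r) ∧
      (∀ v ∈ Metric.closedBall (0 : EuclideanSpace ℝ (Fin m)) r,
        ∃ x ∈ E ∩ Metric.closedBall p r, dist (f x) v ≤ ε * r)

/-- The intrinsic (induced length) extended distance on a subset `E`. -/
def intrinsicEDist {X : Type*} [MetricSpace X] (E : Set X) (x y : X) : ℝ≥0∞ :=
  ⨅ (γ : ℝ → X) (_ : ContinuousOn γ (Set.Icc 0 1)) (_ : γ 0 = x) (_ : γ 1 = y)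
    (_ : ∀ t ∈ Set.Icc (0:ℝ) 1, γ t ∈ E), eVariationOn γ (Set.Icc 0 1)

/-- Diameter of a set with respect to an abstract extended distance. -/
def ediamOn {X : Type*} (ρ : X → X → ℝ≥0∞) (s : Set X) : ℝ≥0∞ :=
  ⨆ x ∈ s, ⨆ y ∈ s, ρ x y

/-- The `m`-dimensional Hausdorff measure of `S` with respect to an abstract
extended distance `ρ`. -/
def hMeas {X : Type*} (ρ : X → X → ℝ≥0∞) (m : ℝ) (S : Set X) : ℝ≥0∞ :=
  ⨆ (ε : ℝ≥0∞) (_ : 0 < ε),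
    ⨅ (t : ℕ → Set X) (_ : S ⊆ ⋃ n, t n) (_ : ∀ n, ediamOn ρ (t n) ≤ ε),
      ∑' n, ediamOn ρ (t n) ^ m

end

/-! ### The cosine of the comparison angle -/

/-- The quotient whose `arccos` is `cangleK`. -/
noncomputable def crK (κ s t d : ℝ) : ℝ :=
  if 0 < κ then
    (Real.cos (Real.sqrt κ * d) - Real.cos (Real.sqrt κ * s) * Real.cos (Real.sqrt κ * t)) /
      (Real.sin (Real.sqrt κ * s) * Real.sin (Real.sqrt κ * t))
  else if κ < 0 then
    (Real.cosh (Real.sqrt (-κ) * s) * Real.cosh (Real.sqrt (-κ) * t) -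
      Real.cosh (Real.sqrt (-κ) * d)) /
      (Real.sinh (Real.sqrt (-κ) * s) * Real.sinh (Real.sqrt (-κ) * t))
  else (s ^ 2 + t ^ 2 - d ^ 2) / (2 * s * t)

lemma cangleK_eq (κ s t d : ℝ) : cangleK κ s t d = arccos (crK κ s t d) := by
  unfold cangleK crK
  split_ifs <;> rfl

/-- The generalized sine of the `κ`-plane, up to a constant factor. -/
noncomputable def snK (κ x : ℝ) : ℝ :=
  if 0 < κ then Real.sin (Real.sqrt κ * x)
  else if κ < 0 then Real.sinh (Real.sqrt (-κ) * x) else x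

lemma snK_pos {κ x : ℝ} (hx : 0 < x) (h : 0 < κ → √κ * x < π) : 0 < snK κ x := by
  unfold snK
  split_ifs with h1 h2
  · exact Real.sin_pos_of_pos_of_lt_pi (mul_pos (Real.sqrt_pos.2 h1) hx) (h h1)
  · exact Real.sinh_pos_iff.2 (mul_pos (Real.sqrt_pos.2 (by linarith)) hx)
  · exact hx

lemma snK_nonneg {κ x : ℝ} (hx : 0 ≤ x) (h : 0 < κ → √κ * x ≤ π) : 0 ≤ snK κ x := by
  unfold snK
  split_ifs with h1 h2
  · exact Real.sin_nonneg_of_nonneg_of_le_pi (mul_nonneg (Real.sqrt_nonneg _) hx) (h h1)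
  · exact Real.sinh_nonneg_iff.2 (mul_nonneg (Real.sqrt_nonneg _) hx)
  · exact hx

lemma snK_zero (κ : ℝ) : snK κ 0 = 0 := by
  unfold snK; split_ifs <;> simp

lemma one_add_crK {κ s t : ℝ} (d : ℝ) (hs : snK κ s ≠ 0) (ht : snK κ t ≠ 0) :
    1 + crK κ s t d =
      2 * snK κ ((s + t + d) / 2) * snK κ ((s + t - d) / 2) / (snK κ s * snK κ t) := by
  unfold snK at *
  unfold crK
  split_ifs at * with h1 h2
  · rw [eq_div_iff (mul_ne_zero hs ht), add_mul, div_mul_cancel₀ _ (mul_ne_zero hs ht)]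
    have e := Real.cos_sub_cos (√κ * d) (√κ * (s + t))
    have e1 : (√κ * d + √κ * (s + t)) / 2 = √κ * ((s + t + d) / 2) := by ring
    have e2 : (√κ * d - √κ * (s + t)) / 2 = -(√κ * ((s + t - d) / 2)) := by ring
    rw [e1, e2, Real.sin_neg, mul_add, Real.cos_add] at e
    linarith
  · rw [eq_div_iff (mul_ne_zero hs ht), add_mul, div_mul_cancel₀ _ (mul_ne_zero hs ht)]
    have e := Real.cosh_add (√(-κ) * ((s + t + d) / 2)) (√(-κ) * ((s + t - d) / 2))
    have e' := Real.cosh_sub (√(-κ) * ((s + t + d) / 2)) (√(-κ) * ((s + t - d) / 2))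
    have e1 : √(-κ) * ((s + t + d) / 2) + √(-κ) * ((s + t - d) / 2) = √(-κ) * s + √(-κ) * t := by
      ring
    have e2 : √(-κ) * ((s + t + d) / 2) - √(-κ) * ((s + t - d) / 2) = √(-κ) * d := by ring
    rw [e1, Real.cosh_add] at e
    rw [e2] at e'
    linarith
  · field_simp
    ring

lemma one_sub_crK {κ s t : ℝ} (d : ℝ) (hs : snK κ s ≠ 0) (ht : snK κ t ≠ 0) :
    1 - crK κ s t d =
      2 * snK κ ((d + s - t) / 2) * snK κ ((d - s + t) / 2) / (snK κ s * snK κ t) := by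
  unfold snK at *
  unfold crK
  split_ifs at * with h1 h2
  · rw [eq_div_iff (mul_ne_zero hs ht), sub_mul, div_mul_cancel₀ _ (mul_ne_zero hs ht)]
    have e := Real.cos_sub_cos (√κ * (s - t)) (√κ * d)
    have e1 : (√κ * (s - t) + √κ * d) / 2 = √κ * ((d + s - t) / 2) := by ring
    have e2 : (√κ * (s - t) - √κ * d) / 2 = -(√κ * ((d - s + t) / 2)) := by ring
    rw [e1, e2, Real.sin_neg, mul_sub, Real.cos_sub] at e
    linarith
  · rw [eq_div_iff (mul_ne_zero hs ht), sub_mul, div_mul_cancel₀ _ (mul_ne_zero hs ht)]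
    have e := Real.cosh_add (√(-κ) * ((d + s - t) / 2)) (√(-κ) * ((d - s + t) / 2))
    have e' := Real.cosh_sub (√(-κ) * ((d + s - t) / 2)) (√(-κ) * ((d - s + t) / 2))
    have e1 : √(-κ) * ((d + s - t) / 2) + √(-κ) * ((d - s + t) / 2) = √(-κ) * d := by ring
    have e2 : √(-κ) * ((d + s - t) / 2) - √(-κ) * ((d - s + t) / 2) = √(-κ) * s - √(-κ) * t := by
      ring
    rw [e1] at e
    rw [e2, Real.cosh_sub] at e'
    linarith
  · field_simp
    ring

lemma crK_symm (κ s t d : ℝ) : crK κ s t d = crK κ t s d := by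
  unfold crK
  split_ifs
  · rw [mul_comm (Real.cos (√κ * s)), mul_comm (Real.sin (√κ * s))]
  · rw [mul_comm (Real.cosh (√(-κ) * s)), mul_comm (Real.sinh (√(-κ) * s))]
  · rw [add_comm (s ^ 2), mul_assoc, mul_assoc, mul_comm s]

lemma crK_add {κ s t : ℝ} (hs : snK κ s ≠ 0) (ht : snK κ t ≠ 0) : crK κ s t (s + t) = -1 := by
  have := one_add_crK (s + t) hs ht
  rw [sub_self, zero_div, snK_zero, mul_zero, zero_div] at this
  linarith

lemma crK_sub {κ s t : ℝ} (hs : snK κ s ≠ 0) (ht : snK κ t ≠ 0) : crK κ s t (s - t) = 1 := by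
  have := one_sub_crK (s - t) hs ht
  rw [show (s - t - s + t) / 2 = 0 by ring, snK_zero, mul_zero, zero_div] at this
  linarith

lemma neg_one_le_crK {κ s t d : ℝ} (hs : 0 < s) (ht : 0 < t) (hd : 0 ≤ d) (hd2 : d ≤ s + t)
    (h : 0 < κ → √κ * s < π ∧ √κ * t < π ∧ √κ * (s + t + d) ≤ 2 * π) : -1 ≤ crK κ s t d := by
  have s1 := snK_pos hs fun hk => (h hk).1
  have s2 := snK_pos ht fun hk => (h hk).2.1
  have e := one_add_crK d s1.ne' s2.ne'
  have : 0 ≤ 2 * snK κ ((s + t + d) / 2) * snK κ ((s + t - d) / 2) / (snK κ s * snK κ t) := by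
    refine div_nonneg (mul_nonneg (mul_nonneg zero_le_two (snK_nonneg (by linarith) fun hk => ?_))
      (snK_nonneg (by linarith) fun hk => ?_)) (mul_pos s1 s2).le
    · linarith [(h hk).2.2]
    · nlinarith [(h hk).2.2, Real.sqrt_nonneg κ, mul_nonneg (Real.sqrt_nonneg κ) hd]
  linarith

lemma crK_le_one {κ s t d : ℝ} (hs : 0 < s) (ht : 0 < t) (hd : |s - t| ≤ d) (hd2 : d ≤ s + t)
    (h : 0 < κ → √κ * s < π ∧ √κ * t < π) : crK κ s t d ≤ 1 := by
  have s1 := snK_pos hs fun hk => (h hk).1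
  have s2 := snK_pos ht fun hk => (h hk).2
  have e := one_sub_crK d s1.ne' s2.ne'
  obtain ⟨h1, h2⟩ := abs_le.1 hd
  have : 0 ≤ 2 * snK κ ((d + s - t) / 2) * snK κ ((d - s + t) / 2) / (snK κ s * snK κ t) := by
    refine div_nonneg (mul_nonneg (mul_nonneg zero_le_two (snK_nonneg (by linarith) fun hk => ?_))
      (snK_nonneg (by linarith) fun hk => ?_)) (mul_pos s1 s2).le
    · exact (mul_le_mul_of_nonneg_left (show (d + s - t) / 2 ≤ s by linarith)
        (Real.sqrt_nonneg κ)).trans (h hk).1.le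
    · exact (mul_le_mul_of_nonneg_left (show (d - s + t) / 2 ≤ t by linarith)
        (Real.sqrt_nonneg κ)).trans (h hk).2.le
  linarith

/-- Lipschitz form of the angle sum inequality. -/
lemma neg_le_add_of_arccos_add_le {u v δ : ℝ} (hδ : 0 ≤ δ) (hu : -1 ≤ u ∧ u ≤ 1)
    (hv : -1 ≤ v ∧ v ≤ 1) (h : arccos u + arccos v ≤ π + δ) : -δ ≤ u + v := by
  rcases le_total (arccos u) (π - arccos v) with h1 | h1
  · have := Real.cos_le_cos_of_nonneg_of_le_pi (arccos_nonneg u)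
      (by linarith [arccos_nonneg v]) h1
    rw [Real.cos_pi_sub, Real.cos_arccos hu.1 hu.2, Real.cos_arccos hv.1 hv.2] at this
    linarith
  · have := Real.abs_cos_sub_cos_le (arccos u) (π - arccos v)
    rw [Real.cos_pi_sub, Real.cos_arccos hu.1 hu.2, Real.cos_arccos hv.1 hv.2,
      abs_of_nonneg (by linarith : 0 ≤ arccos u - (π - arccos v))] at this
    linarith [neg_abs_le (u - -v)]

lemma le_of_pi_div_two_sub_lt_arccos {u δ : ℝ} (hδ : 0 ≤ δ) (hu : u ≤ 1)
    (h : π / 2 - δ < arccos u) : u ≤ δ := by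
  rcases le_or_gt u 0 with h0 | h0
  · linarith
  · have h2 : u = Real.sin (π / 2 - arccos u) := by
      rw [Real.sin_pi_div_two_sub, Real.cos_arccos (by linarith) hu]
    have h3 : 0 ≤ π / 2 - arccos u := by
      have := Real.arccos_le_pi_div_two.2 h0.le
      linarith
    have := Real.sin_le h3
    linarith

lemma crK_le_of_extend_side {κ s' s'' x t d : ℝ} (hs' : 0 < s') (hs'' : 0 < s'')
    (hx : 0 < x) (ht : 0 < t) (h : 0 < κ → √κ * (s' + s'') < π ∧ √κ * x < π ∧ √κ * t < π)
    (hAB : 0 ≤ crK κ s' x t + crK κ x s'' d) :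
    crK κ s' t x ≤ crK κ (s' + s'') t d := by
  have p1 := snK_pos hs' fun hk => lt_of_le_of_lt (mul_le_mul_of_nonneg_left
    (by linarith : s' ≤ s' + s'') (Real.sqrt_nonneg κ)) (h hk).1
  have p2 := snK_pos hs'' fun hk => lt_of_le_of_lt (mul_le_mul_of_nonneg_left
    (by linarith : s'' ≤ s' + s'') (Real.sqrt_nonneg κ)) (h hk).1
  have p3 := snK_pos hx fun hk => (h hk).2.1
  have p4 := snK_pos ht fun hk => (h hk).2.2
  have p5 := snK_pos (add_pos hs' hs'') fun hk => (h hk).1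
  unfold snK at *
  unfold crK at *
  split_ifs at * with h1 h2
  · rw [mul_add] at *
    set k := √κ
    rw [div_add_div _ _ (by positivity) (by positivity), le_div_iff₀ (by positivity), zero_mul]
      at hAB
    rw [div_le_div_iff₀ (by positivity) (by positivity)]
    have e := Real.sin_add (k * s') (k * s'')
    have e' := Real.cos_add (k * s') (k * s'')
    have key : 0 ≤ Real.sin (k * s'') * Real.cos (k * t) + Real.sin (k * s') * Real.cos (k * d)
        - Real.sin (k * s' + k * s'') * Real.cos (k * x) := by
      rw [e]
      have : 0 ≤ Real.sin (k * x) * (Real.sin (k * s'') * Real.cos (k * t) +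
        Real.sin (k * s') * Real.cos (k * d) - (Real.sin (k * s') * Real.cos (k * s'') +
          Real.cos (k * s') * Real.sin (k * s'')) * Real.cos (k * x)) := by
        linarith
      exact nonneg_of_mul_nonneg_right this p3
    have e3 : Real.sin (k * s'') = Real.sin (k * s' + k * s'') * Real.cos (k * s') -
        Real.cos (k * s' + k * s'') * Real.sin (k * s') := by
      rw [← Real.sin_sub]; congr 1; ring
    rw [e3] at key
    have := mul_nonneg p4.le key
    linarith
  · rw [mul_add] at *
    set k := √(-κ)
    rw [div_add_div _ _ (by positivity) (by positivity), le_div_iff₀ (by positivity), zero_mul]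
      at hAB
    rw [div_le_div_iff₀ (by positivity) (by positivity)]
    have e := Real.sinh_add (k * s') (k * s'')
    have key : 0 ≤ Real.sinh (k * s' + k * s'') * Real.cosh (k * x)
        - Real.sinh (k * s'') * Real.cosh (k * t) - Real.sinh (k * s') * Real.cosh (k * d) := by
      rw [e]
      have : 0 ≤ Real.sinh (k * x) * ((Real.sinh (k * s') * Real.cosh (k * s'') +
          Real.cosh (k * s') * Real.sinh (k * s'')) * Real.cosh (k * x) -
        Real.sinh (k * s'') * Real.cosh (k * t) - Real.sinh (k * s') * Real.cosh (k * d)) := by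
        linarith
      exact nonneg_of_mul_nonneg_right this p3
    have e3 : Real.sinh (k * s'') = Real.sinh (k * s' + k * s'') * Real.cosh (k * s') -
        Real.cosh (k * s' + k * s'') * Real.sinh (k * s') := by
      rw [← Real.sinh_sub]; congr 1; ring
    rw [e3] at key
    have := mul_nonneg p4.le key
    linarith
  · rw [div_add_div _ _ (by positivity) (by positivity), le_div_iff₀ (by positivity), zero_mul]
      at hAB
    rw [div_le_div_iff₀ (by positivity) (by positivity)]
    have key : 0 ≤ s'' * (s' ^ 2 + x ^ 2 - t ^ 2) + s' * (x ^ 2 + s'' ^ 2 - d ^ 2) := by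
      have : 0 ≤ (2 * x) * (s'' * (s' ^ 2 + x ^ 2 - t ^ 2) + s' * (x ^ 2 + s'' ^ 2 - d ^ 2)) := by
        linarith
      exact nonneg_of_mul_nonneg_right this (by positivity)
    have := mul_nonneg ht.le key
    linarith

lemma exists_hasDerivAt_snK (κ : ℝ) : ∃ c > 0, HasDerivAt (snK κ) c 0 := by
  rcases lt_trichotomy κ 0 with h | h | h
  · refine ⟨√(-κ), Real.sqrt_pos.2 (by linarith), ?_⟩
    have e : snK κ = fun x => Real.sinh (√(-κ) * x) := by
      funext x; simp [snK, h, h.le.not_gt]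
    rw [e]
    have := ((hasDerivAt_id (0 : ℝ)).const_mul (√(-κ))).sinh
    simpa using this
  · refine ⟨1, one_pos, ?_⟩
    have e : snK κ = fun x => x := by
      funext x; simp [snK, h]
    rw [e]
    exact hasDerivAt_id 0
  · refine ⟨√κ, Real.sqrt_pos.2 h, ?_⟩
    have e : snK κ = fun x => Real.sin (√κ * x) := by
      funext x; simp [snK, h]
    rw [e]
    have := ((hasDerivAt_id (0 : ℝ)).const_mul (√κ)).sin
    simpa using this

lemma exists_snK_bounds (κ : ℝ) : ∃ c > 0, ∀ η > 0, ∃ R > 0, ∀ x, 0 ≤ x → x ≤ R →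
    (1 - η) * (c * x) ≤ snK κ x ∧ snK κ x ≤ (1 + η) * (c * x) := by
  obtain ⟨c, hc, h⟩ := exists_hasDerivAt_snK κ
  refine ⟨c, hc, fun η hη => ?_⟩
  have h1 := (hasDerivAt_iff_isLittleO.1 h).def (mul_pos hη hc)
  obtain ⟨r, hr, h2⟩ := Metric.eventually_nhds_iff.1 h1
  refine ⟨r / 2, half_pos hr, fun x hx hxr => ?_⟩
  have h3 := @h2 x (by rw [Real.dist_eq, sub_zero, abs_of_nonneg hx]; linarith)
  rw [snK_zero, sub_zero, sub_zero, smul_eq_mul, Real.norm_eq_abs, Real.norm_eq_abs,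
    abs_of_nonneg hx] at h3
  obtain ⟨h4, h5⟩ := abs_le.1 h3
  constructor <;> nlinarith

/-- Scales `≤ R` at which the `κ`-plane is Euclidean up to the multiplicative error `η`. -/
structure GoodScale (κ η R : ℝ) : Prop where
  pos : 0 < R
  lt_pi : 0 < κ → √κ * (4 * R) < π
  one_add : ∀ s t d, 0 < s → s ≤ R → 0 < t → t ≤ R → |s - t| ≤ d → d ≤ s + t →
    |(1 + crK κ s t d) - (1 + crK 0 s t d)| ≤ η * (1 + crK 0 s t d)
  one_sub : ∀ s t d, 0 < s → s ≤ R → 0 < t → t ≤ R → |s - t| ≤ d → d ≤ s + t →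
    |(1 - crK κ s t d) - (1 - crK 0 s t d)| ≤ η * (1 - crK 0 s t d)

lemma crK_zero (s t d : ℝ) : crK 0 s t d = (s ^ 2 + t ^ 2 - d ^ 2) / (2 * s * t) := by
  simp [crK]

lemma abs_quotient_sub_le {c η X Y S T x y s t : ℝ} (hc : 0 < c) (hη : 0 < η) (hη1 : η ≤ 1 / 16)
    (hs : 0 < s) (ht : 0 < t) (hx : 0 ≤ x) (hy : 0 ≤ y)
    (hX : (1 - η) * (c * x) ≤ X ∧ X ≤ (1 + η) * (c * x))
    (hY : (1 - η) * (c * y) ≤ Y ∧ Y ≤ (1 + η) * (c * y))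
    (hS : (1 - η) * (c * s) ≤ S ∧ S ≤ (1 + η) * (c * s))
    (hT : (1 - η) * (c * t) ≤ T ∧ T ≤ (1 + η) * (c * t)) :
    |2 * X * Y / (S * T) - 2 * x * y / (s * t)| ≤ 16 * η * (2 * x * y / (s * t)) := by
  have q : 0 < 1 - η := by linarith
  have hS0 : 0 < S := lt_of_lt_of_le (by positivity) hS.1
  have hT0 : 0 < T := lt_of_lt_of_le (by positivity) hT.1
  have hX0 : 0 ≤ X := le_trans (by positivity) hX.1
  have hY0 : 0 ≤ Y := le_trans (by positivity) hY.1
  have a1 : X * Y ≤ ((1 + η) * (c * x)) * ((1 + η) * (c * y)) :=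
    mul_le_mul hX.2 hY.2 hY0 (by positivity)
  have a2 : ((1 - η) * (c * x)) * ((1 - η) * (c * y)) ≤ X * Y :=
    mul_le_mul hX.1 hY.1 (by positivity) hX0
  have b1 : S * T ≤ ((1 + η) * (c * s)) * ((1 + η) * (c * t)) :=
    mul_le_mul hS.2 hT.2 hT0.le (by positivity)
  have b2 : ((1 - η) * (c * s)) * ((1 - η) * (c * t)) ≤ S * T :=
    mul_le_mul hS.1 hT.1 (by positivity) hS0.le
  have hxy : 0 ≤ c ^ 2 * (x * y) := by positivity
  have hst : 0 < c ^ 2 * (s * t) := by positivity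
  have u1 : (1 + η) ^ 2 ≤ (1 + 16 * η) * (1 - η) ^ 2 := by
    nlinarith [mul_le_mul_of_nonneg_left hη1 hη.le, pow_pos hη 3]
  have u2 : (1 - 16 * η) * (1 + η) ^ 2 ≤ (1 - η) ^ 2 := by nlinarith
  have z : 0 ≤ 1 - 16 * η := by linarith
  rw [abs_le]
  constructor
  · have : (1 - 16 * η) * (2 * x * y / (s * t)) ≤ 2 * X * Y / (S * T) := by
      rw [← mul_div_assoc, div_le_div_iff₀ (by positivity) (by positivity)]
      have k1 : (1 - 16 * η) * (x * y) * (S * T) ≤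
          (1 - 16 * η) * (x * y) * (((1 + η) * (c * s)) * ((1 + η) * (c * t))) :=
        mul_le_mul_of_nonneg_left b1 (by positivity)
      have k2 : (((1 - η) * (c * x)) * ((1 - η) * (c * y))) * (s * t) ≤ X * Y * (s * t) :=
        mul_le_mul_of_nonneg_right a2 (by positivity)
      have k3 := mul_le_mul_of_nonneg_right u2 (mul_nonneg hxy (mul_pos hs ht).le)
      linarith
    linarith
  · have : 2 * X * Y / (S * T) ≤ (1 + 16 * η) * (2 * x * y / (s * t)) := by
      rw [← mul_div_assoc, div_le_div_iff₀ (by positivity) (by positivity)]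
      have k1 : (1 + 16 * η) * (x * y) * (((1 - η) * (c * s)) * ((1 - η) * (c * t))) ≤
          (1 + 16 * η) * (x * y) * (S * T) :=
        mul_le_mul_of_nonneg_left b2 (by positivity)
      have k2 : X * Y * (s * t) ≤ (((1 + η) * (c * x)) * ((1 + η) * (c * y))) * (s * t) :=
        mul_le_mul_of_nonneg_right a1 (by positivity)
      have k3 := mul_le_mul_of_nonneg_right u1 (mul_nonneg hxy (mul_pos hs ht).le)
      linarith
    linarith

lemma exists_goodScale (κ : ℝ) {η : ℝ} (hη : 0 < η) : ∃ R, GoodScale κ η R := by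
  obtain ⟨c, hc, h⟩ := exists_snK_bounds κ
  obtain ⟨r, hr, hb⟩ := h (min η 1 / 16) (by positivity)
  have hη1 : min η 1 / 16 ≤ 1 / 16 := by linarith [min_le_right η 1]
  have hη2 : 16 * (min η 1 / 16) ≤ η := by linarith [min_le_left η 1]
  have hη0 : 0 < min η 1 / 16 := by positivity
  set e := min η 1 / 16
  obtain ⟨r', hr', hr'2⟩ : ∃ r' > 0, 0 < κ → √κ * (4 * r') < π := by
    refine ⟨π / (8 * (√κ + 1)), by positivity, fun _ => ?_⟩
    rw [← mul_div_assoc, ← mul_div_assoc, div_lt_iff₀ (by positivity)]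
    nlinarith [Real.pi_pos, Real.sqrt_nonneg κ]
  have H : ∀ x, 0 ≤ x → x ≤ 2 * min (r / 2) r' →
      (1 - e) * (c * x) ≤ snK κ x ∧ snK κ x ≤ (1 + e) * (c * x) := fun x h0 h1 =>
    hb x h0 (by linarith [min_le_left (r / 2) r'])
  have hlt : 0 < κ → √κ * (4 * min (r / 2) r') < π := fun hk => lt_of_le_of_lt
    (mul_le_mul_of_nonneg_left (by linarith [min_le_right (r / 2) r']) (Real.sqrt_nonneg κ))
    (hr'2 hk)
  have hpos : 0 < min (r / 2) r' := by positivity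
  set R := min (r / 2) r'
  have sne : ∀ s, 0 < s → s ≤ R → snK κ s ≠ 0 := fun s h0 h1 => by
    have : 0 < (1 - e) * (c * s) := mul_pos (by linarith) (mul_pos hc h0)
    exact (lt_of_lt_of_le this (H s h0.le (by linarith)).1).ne'
  have z0 : ∀ s : ℝ, snK 0 s = s := fun s => by simp [snK]
  refine ⟨R, hpos, hlt, ?_, ?_⟩
  · intro s t d hs hsR ht htR hd hd2
    have hd0 := (abs_nonneg _).trans hd
    rw [one_add_crK d (sne s hs hsR) (sne t ht htR),
      one_add_crK d (by rw [z0]; exact hs.ne') (by rw [z0]; exact ht.ne')]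
    simp only [z0]
    refine (abs_quotient_sub_le hc hη0 hη1 hs ht (by linarith) (by linarith)
      (H _ (by linarith) (by linarith)) (H _ (by linarith) (by linarith))
      (H _ hs.le (by linarith)) (H _ ht.le (by linarith))).trans
      (mul_le_mul_of_nonneg_right hη2 ?_)
    exact div_nonneg (mul_nonneg (by linarith) (by linarith)) (mul_pos hs ht).le
  · intro s t d hs hsR ht htR hd hd2
    have hd0 := (abs_nonneg _).trans hd
    obtain ⟨h1, h2⟩ := abs_le.1 hd
    rw [one_sub_crK d (sne s hs hsR) (sne t ht htR),
      one_sub_crK d (by rw [z0]; exact hs.ne') (by rw [z0]; exact ht.ne')]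
    simp only [z0]
    refine (abs_quotient_sub_le hc hη0 hη1 hs ht (by linarith) (by linarith)
      (H _ (by linarith) (by linarith)) (H _ (by linarith) (by linarith))
      (H _ hs.le (by linarith)) (H _ ht.le (by linarith))).trans
      (mul_le_mul_of_nonneg_right hη2 ?_)
    exact div_nonneg (mul_nonneg (by linarith) (by linarith)) (mul_pos hs ht).le

lemma crK_zero_mem {s t d : ℝ} (hs : 0 < s) (ht : 0 < t) (hd : |s - t| ≤ d) (hd2 : d ≤ s + t) :
    -1 ≤ crK 0 s t d ∧ crK 0 s t d ≤ 1 :=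
  ⟨neg_one_le_crK hs ht ((abs_nonneg _).trans hd) hd2 fun h => (lt_irrefl _ h).elim,
    crK_le_one hs ht hd hd2 fun h => (lt_irrefl _ h).elim⟩

lemma GoodScale.abs_crK_sub_le {κ η R s t d : ℝ} (h : GoodScale κ η R) (hη : 0 ≤ η)
    (hs : 0 < s) (hsR : s ≤ R) (ht : 0 < t) (htR : t ≤ R) (hd : |s - t| ≤ d) (hd2 : d ≤ s + t) :
    |crK κ s t d - crK 0 s t d| ≤ 2 * η := by
  have h1 := h.one_add s t d hs hsR ht htR hd hd2
  have h2 := (crK_zero_mem hs ht hd hd2).2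
  rw [add_sub_add_left_eq_sub] at h1
  nlinarith

lemma GoodScale.crK_mem {κ η R s t d : ℝ} (h : GoodScale κ η R)
    (hs : 0 < s) (hsR : s ≤ R) (ht : 0 < t) (htR : t ≤ R) (hd : |s - t| ≤ d) (hd2 : d ≤ s + t) :
    -1 ≤ crK κ s t d ∧ crK κ s t d ≤ 1 := by
  have key : ∀ u, 0 ≤ u → u ≤ 2 * R → 0 < κ → √κ * u ≤ π / 2 := fun u _ h1 hk => by
    have := mul_le_mul_of_nonneg_left h1 (Real.sqrt_nonneg κ)
    linarith [h.lt_pi hk]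
  refine ⟨neg_one_le_crK hs ht ((abs_nonneg _).trans hd) hd2 fun hk => ?_,
    crK_le_one hs ht hd hd2 fun hk => ?_⟩
  · have := key s hs.le (by linarith) hk
    have := key t ht.le (by linarith) hk
    have := key d ((abs_nonneg _).trans hd) (by linarith) hk
    exact ⟨by linarith [Real.pi_pos], by linarith [Real.pi_pos], by
      rw [mul_add, mul_add]; linarith [Real.pi_pos]⟩
  · have := key s hs.le (by linarith) hk
    have := key t ht.le (by linarith) hk
    exact ⟨by linarith [Real.pi_pos], by linarith [Real.pi_pos]⟩

lemma abs_crK_zero_sub_le {s t d : ℝ} (hs : 0 < s) (ht : 0 < t) (hd : |t - d| ≤ s) :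
    |crK 0 s t d - (t - d) / s| ≤ s / (2 * t) := by
  have e : crK 0 s t d - (t - d) / s = (s ^ 2 - (t - d) ^ 2) / (2 * s * t) := by
    rw [crK_zero]; field_simp; ring
  have h2 : (t - d) ^ 2 ≤ s ^ 2 := by
    rw [← sq_abs (t - d)]; exact pow_le_pow_left₀ (abs_nonneg _) hd 2
  rw [e, abs_of_nonneg (div_nonneg (by linarith) (by positivity)),
    div_le_div_iff₀ (by positivity) (by positivity)]
  nlinarith [sq_nonneg (t - d), mul_pos ht (mul_pos hs hs), mul_nonneg ht.le (sq_nonneg (t-d))]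

/-! ### Geodesics and monotonicity of comparison angles -/

section Space

variable {X : Type*} [MetricSpace X] {κ : ℝ}

lemma IsAlexandrov.exists_between (hX : IsAlexandrov X κ) (x y : X) {t : ℝ} (h0 : 0 ≤ t)
    (ht : t ≤ dist x y) : ∃ z, dist x z = t ∧ dist z y = dist x y - t := by
  obtain ⟨hc, hm, -⟩ := hX
  have step : ∀ (n : ℕ) (P : X × X),
      (dist P.1 P.2 = dist x y / 2 ^ n ∧ dist x P.1 + dist x y / 2 ^ n + dist P.2 y = dist x y ∧
        dist x P.1 ≤ t ∧ t ≤ dist x P.1 + dist x y / 2 ^ n) →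
      ∃ P' : X × X, (dist P'.1 P'.2 = dist x y / 2 ^ (n + 1) ∧
        dist x P'.1 + dist x y / 2 ^ (n + 1) + dist P'.2 y = dist x y ∧
        dist x P'.1 ≤ t ∧ t ≤ dist x P'.1 + dist x y / 2 ^ (n + 1)) ∧
        dist P.1 P'.1 ≤ dist x y / 2 / 2 ^ n := by
    rintro n ⟨u, v⟩ ⟨h1, h2, h3, h4⟩
    dsimp only at h1 h2 h3 h4 ⊢
    obtain ⟨z, hz1, hz2⟩ := hm u v
    have e : dist x y / 2 ^ (n + 1) = dist x y / 2 ^ n / 2 := by rw [pow_succ, div_div]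
    have e' : dist x y / 2 / 2 ^ n = dist x y / 2 ^ n / 2 := by rw [div_right_comm]
    rw [e, e']
    have t1 := dist_triangle x u z
    have t2 := dist_triangle z v y
    have t3 := dist_triangle x z y
    rcases le_total t (dist x u + dist x y / 2 ^ n / 2) with h | h
    · exact ⟨(u, z), ⟨by dsimp only; linarith, by dsimp only; linarith, h3, h⟩, by
        simp only [dist_self]; linarith [dist_nonneg (x := u) (y := z)]⟩
    · exact ⟨(z, v), ⟨by dsimp only; linarith, by dsimp only; linarith,
        by dsimp only; linarith, by dsimp only; linarith⟩, by dsimp only; linarith⟩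
  choose! g hg hg' using step
  let P : ℕ → X × X := fun n => Nat.rec (x, y) (fun n P => g n P) n
  have hP : ∀ n, dist (P n).1 (P n).2 = dist x y / 2 ^ n ∧
      dist x (P n).1 + dist x y / 2 ^ n + dist (P n).2 y = dist x y ∧
        dist x (P n).1 ≤ t ∧ t ≤ dist x (P n).1 + dist x y / 2 ^ n := by
    intro n
    induction n with
    | zero => simp [P, h0, ht]
    | succ n ih => exact hg n (P n) ih
  have hcau : CauchySeq fun n => (P n).1 :=
    cauchySeq_of_le_geometric_two (C := dist x y) fun n => hg' n (P n) (hP n)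
  obtain ⟨z, hz⟩ := cauchySeq_tendsto_of_complete hcau
  have hd : Filter.Tendsto (fun n : ℕ => dist x y / 2 ^ n) Filter.atTop (nhds 0) := by
    have := (tendsto_pow_atTop_nhds_zero_of_lt_one (r := (1 / 2 : ℝ)) (by norm_num)
      (by norm_num)).const_mul (dist x y)
    simpa [div_eq_mul_inv] using this
  have l1 : Filter.Tendsto (fun n => dist x (P n).1) Filter.atTop (nhds (dist x z)) :=
    tendsto_const_nhds.dist hz
  have e1 : dist x z = t := by
    refine le_antisymm (le_of_tendsto' l1 fun n => (hP n).2.2.1) ?_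
    have := l1.add hd
    rw [add_zero] at this
    exact ge_of_tendsto' this fun n => (hP n).2.2.2
  refine ⟨z, e1, ?_⟩
  have l2 : Filter.Tendsto (fun n => dist (P n).1 y) Filter.atTop (nhds (dist z y)) :=
    hz.dist tendsto_const_nhds
  have : dist z y ≤ dist x y - t := by
    have h : Filter.Tendsto (fun n : ℕ => dist x y - t + dist x y / 2 ^ n) Filter.atTop
      (nhds (dist x y - t + 0)) := tendsto_const_nhds.add hd
    rw [add_zero] at h
    refine le_of_tendsto_of_tendsto' l2 h fun n => ?_
    have := hP n
    have := dist_triangle (P n).1 (P n).2 y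
    linarith
  linarith [dist_triangle x z y]

/-- The cosine of the comparison angle `∠̃ q p r`, before clamping to `[-1, 1]`. -/
noncomputable def cr (κ : ℝ) (q p r : X) : ℝ := crK κ (dist p q) (dist p r) (dist q r)

lemma cangle_eq (κ : ℝ) (q p r : X) : cangle κ q p r = arccos (cr κ q p r) := cangleK_eq _ _ _ _

lemma cr_comm (κ : ℝ) (q p r : X) : cr κ q p r = cr κ r p q := by
  unfold cr; rw [crK_symm, dist_comm q r]

lemma cangle_comm (κ : ℝ) (q p r : X) : cangle κ q p r = cangle κ r p q := by
  rw [cangle_eq, cangle_eq, cr_comm]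

lemma cr_eq_neg_one {q p r : X} (h : dist q p + dist p r = dist q r)
    (hq : snK κ (dist p q) ≠ 0) (hr : snK κ (dist p r) ≠ 0) : cr κ q p r = -1 := by
  unfold cr; rw [← h, dist_comm q p]; exact crK_add hq hr

lemma cr_eq_one {q p r : X} (h : dist p r + dist r q = dist p q)
    (hq : snK κ (dist p q) ≠ 0) (hr : snK κ (dist p r) ≠ 0) : cr κ q p r = 1 := by
  unfold cr
  rw [show dist q r = dist p q - dist p r by rw [dist_comm q r]; linarith]; exact crK_sub hq hr

lemma abs_dist_sub_le' (p q r : X) : |dist p q - dist p r| ≤ dist q r := by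
  rw [dist_comm p q, dist_comm p r]; exact abs_dist_sub_le q r p

lemma snK_dist_ne {p q : X} (h : q ≠ p) (hk : 0 < κ → √κ * dist p q < π) :
    snK κ (dist p q) ≠ 0 := (snK_pos (dist_pos.2 h.symm) hk).ne'

lemma IsAlexandrov.cangle_le_of_between (hX : IsAlexandrov X κ) {p a a' b : X}
    (h : dist p a' + dist a' a = dist p a) (ha' : a' ≠ p) (hb : b ≠ p)
    (hκ : 0 < κ → √κ * dist p a < π ∧ √κ * (dist p a' + dist p b) < π) :
    cangle κ a p b ≤ cangle κ a' p b := by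
  have q := Real.sqrt_nonneg κ
  have lt' : ∀ {u v : ℝ}, u ≤ v → √κ * v < π → √κ * u < π := fun h1 h2 =>
    lt_of_le_of_lt (mul_le_mul_of_nonneg_left h1 q) h2
  have P1 : 0 < dist p a' := dist_pos.2 ha'.symm
  have P2 : 0 < dist p b := dist_pos.2 hb.symm
  have n0 : 0 ≤ dist a' a := dist_nonneg
  have n1 : snK κ (dist p a) ≠ 0 := (snK_pos (by linarith) fun hk => (hκ hk).1).ne'
  have n2 : snK κ (dist p a') ≠ 0 :=
    snK_dist_ne ha' fun hk => lt' (by linarith) (hκ hk).1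
  have n3 : snK κ (dist p b) ≠ 0 := snK_dist_ne hb fun hk => lt' (by linarith) (hκ hk).2
  rcases eq_or_ne a' a with rfl | hne
  · exact le_rfl
  rcases eq_or_ne b a' with rfl | hba
  · rw [cangle_eq, cr_eq_one h n1 n2, arccos_one, cangle_eq]
    exact Real.arccos_nonneg _
  have P3 : 0 < dist a' a := dist_pos.2 hne
  have P4 : 0 < dist a' b := dist_pos.2 hba.symm
  have t1 := dist_triangle a' p b
  have t2 := dist_triangle p a b
  have t3 := dist_triangle a' a b
  have t4 := dist_triangle a a' b
  have t5 := dist_triangle p a' b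
  have t6 := dist_triangle p b a'
  have t7 := dist_triangle a' b a
  have t8 := dist_triangle p b a
  rw [dist_comm a' p] at t1
  rw [dist_comm a a'] at t4
  rw [dist_comm b a'] at t6
  rw [dist_comm b a] at t7 t8
  have hq := hX.2.2 a' p b a ha'.symm hba hne.symm
  rw [cangle_eq κ a a' p, cr_eq_neg_one
    (by rw [dist_comm a a', dist_comm a' p, dist_comm a p]; linarith)
    (snK_dist_ne hne.symm fun hk => lt' (by linarith) (hκ hk).1)
    (by rw [dist_comm]; exact n2), arccos_neg_one, cangle_eq, cangle_eq] at hq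
  have hA1 : -1 ≤ cr κ p a' b := neg_one_le_crK (by rw [dist_comm]; exact P1) P4 P2.le
    (by rw [dist_comm a' p]; linarith) fun hk => by
      have := hκ hk
      rw [dist_comm a' p]
      refine ⟨lt' (by linarith) this.2, lt' (by linarith) this.2, ?_⟩
      have := mul_le_mul_of_nonneg_left (show dist p a' + dist a' b + dist p b ≤
        2 * (dist p a' + dist p b) by linarith) q
      linarith
  have hA2 : cr κ p a' b ≤ 1 := crK_le_one (by rw [dist_comm]; exact P1) P4
    (abs_dist_sub_le' _ _ _) (by rw [dist_comm a' p]; linarith) fun hk => by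
      have := hκ hk
      rw [dist_comm a' p]
      exact ⟨lt' (by linarith) this.2, lt' (by linarith) this.2⟩
  have hB2 : cr κ b a' a ≤ 1 := crK_le_one P4 P3 (abs_dist_sub_le' _ _ _)
      (by rw [dist_comm b a]; linarith) fun hk =>
        ⟨lt' (by linarith) (hκ hk).2, lt' (by linarith) (hκ hk).1⟩
  rw [cangle_eq, cangle_eq]
  rcases le_or_gt (-1) (cr κ b a' a) with hB | hB
  · have hs := neg_le_add_of_arccos_add_le le_rfl ⟨hA1, hA2⟩ ⟨hB, hB2⟩ (by linarith)
    rw [neg_zero] at hs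
    refine Real.arccos_le_arccos ?_
    unfold cr at hs ⊢
    rw [← h, dist_comm a' p, dist_comm b a] at *
    exact crK_le_of_extend_side P1 P3 P4 P2 (fun hk => ⟨(hκ hk).1, lt' (by linarith) (hκ hk).2,
      lt' (by linarith) (hκ hk).2⟩) hs
  · rw [(arccos_eq_pi (x := cr κ b a' a)).2 hB.le] at hq
    have hA3 : 1 ≤ cr κ p a' b := Real.arccos_eq_zero.1
      (le_antisymm (by linarith) (arccos_nonneg _))
    have e := one_sub_crK (κ := κ) (s := dist a' p) (t := dist a' b) (dist p b)
      (by rw [dist_comm]; exact n2)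
      (snK_dist_ne hba fun hk => lt' (by linarith) (hκ hk).2)
    change 1 - cr κ p a' b = _ at e
    rw [le_antisymm hA2 hA3, sub_self, eq_comm, div_eq_zero_iff, mul_eq_zero, mul_eq_zero,
      dist_comm a' p] at e
    rcases e with ((e | e) | e) | e
    · norm_num at e
    · rcases eq_or_lt_of_le (show 0 ≤ (dist p b + dist p a' - dist a' b) / 2 by linarith)
        with h0 | h0
      · have : cr κ a' p b = -1 := cr_eq_neg_one (by rw [dist_comm a' p]; linarith) n2 n3
        rw [this, arccos_neg_one]
        exact Real.arccos_le_pi _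
      · exact absurd e (snK_pos h0 fun hk => lt' (by linarith) (hκ hk).2).ne'
    · rcases eq_or_lt_of_le (show 0 ≤ (dist p b - dist p a' + dist a' b) / 2 by linarith)
        with h0 | h0
      · have : cr κ b a' a = -1 := cr_eq_neg_one
          (by rw [dist_comm b a', dist_comm b a]; linarith)
          (snK_dist_ne hba fun hk => lt' (by linarith) (hκ hk).2)
          (snK_dist_ne hne.symm fun hk => lt' (by linarith) (hκ hk).1)
        linarith
      · exact absurd e (snK_pos h0 fun hk => lt' (by linarith) (hκ hk).2).ne'
    · exact absurd e (mul_ne_zero n2 (snK_dist_ne hba fun hk => lt' (by linarith) (hκ hk).2))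

lemma ne_of_between {p a a' : X} (h : dist p a' + dist a' a = dist p a) (ha' : a' ≠ p) :
    a ≠ p := by
  rintro rfl
  have h1 := dist_pos.2 ha'
  rw [dist_self, dist_comm a a'] at h
  linarith

lemma IsAlexandrov.cangle_le_of_between₂ (hX : IsAlexandrov X κ) {p a a' b b' : X}
    (h : dist p a' + dist a' a = dist p a) (h' : dist p b' + dist b' b = dist p b)
    (ha' : a' ≠ p) (hb' : b' ≠ p)
    (hκ : 0 < κ → √κ * dist p a < π ∧ √κ * dist p b < π ∧ √κ * (dist p a' + dist p b) < π) :
    cangle κ a p b ≤ cangle κ a' p b' := by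
  have q := Real.sqrt_nonneg κ
  have hb : b ≠ p := ne_of_between h' hb'
  refine (hX.cangle_le_of_between h ha' hb fun hk => ⟨(hκ hk).1, (hκ hk).2.2⟩).trans ?_
  rw [cangle_comm κ a', cangle_comm κ a']
  refine hX.cangle_le_of_between h' hb' ha' fun hk => ⟨(hκ hk).2.1, ?_⟩
  refine lt_of_le_of_lt (mul_le_mul_of_nonneg_left ?_ q) (hκ hk).2.2
  have : 0 ≤ dist b' b := dist_nonneg
  linarith

/-! ### Consequences at good scales -/

variable {η R : ℝ}

lemma GoodScale.sqrt_lt (hG : GoodScale κ η R) {u : ℝ} (hu : u ≤ 4 * R) (hk : 0 < κ) :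
    √κ * u < π :=
  lt_of_le_of_lt (mul_le_mul_of_nonneg_left hu (Real.sqrt_nonneg κ)) (hG.lt_pi hk)

lemma GoodScale.cr_mem (hG : GoodScale κ η R) {q p r : X} (hq : q ≠ p) (hr : r ≠ p)
    (hqR : dist p q ≤ R) (hrR : dist p r ≤ R) : -1 ≤ cr κ q p r ∧ cr κ q p r ≤ 1 :=
  hG.crK_mem (dist_pos.2 hq.symm) hqR (dist_pos.2 hr.symm) hrR (abs_dist_sub_le' _ _ _)
    (by rw [dist_comm p q]; exact dist_triangle _ _ _)

lemma GoodScale.abs_cr_sub_le (hG : GoodScale κ η R) (hη : 0 ≤ η) {q p r : X} (hq : q ≠ p)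
    (hr : r ≠ p) (hqR : dist p q ≤ R) (hrR : dist p r ≤ R) : |cr κ q p r - cr 0 q p r| ≤ 2 * η :=
  hG.abs_crK_sub_le hη (dist_pos.2 hq.symm) hqR (dist_pos.2 hr.symm) hrR (abs_dist_sub_le' _ _ _)
    (by rw [dist_comm p q]; exact dist_triangle _ _ _)

lemma dist_sq_eq {q p r : X} (hq : q ≠ p) (hr : r ≠ p) :
    dist q r ^ 2 = dist p q ^ 2 + dist p r ^ 2 - 2 * dist p q * dist p r * cr 0 q p r := by
  have h1 := (dist_pos.2 hq).ne'
  have h2 := (dist_pos.2 hr).ne'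
  rw [dist_comm] at h1 h2
  unfold cr
  rw [crK_zero]
  field_simp
  ring

/-- First variation: the comparison angle at `x` of a short side `xy` and a long side `xa`. -/
lemma GoodScale.abs_cr_sub_div_le (hG : GoodScale κ η R) (hη : 0 ≤ η) {x y a : X} (hy : y ≠ x)
    (ha : a ≠ x) (hyR : dist x y ≤ R) (haR : dist x a ≤ R) (h : dist x y ≤ η * dist x a) :
    |cr κ y x a - (dist x a - dist y a) / dist x y| ≤ 3 * η := by
  have h1 := hG.abs_cr_sub_le hη hy ha hyR haR
  have p1 := dist_pos.2 hy.symm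
  have p2 := dist_pos.2 ha.symm
  have h2 := abs_crK_zero_sub_le (d := dist y a) p1 p2
    (by rw [dist_comm x a, dist_comm y a, dist_comm x y, dist_comm a x,
      dist_comm a y, dist_comm y x]; exact abs_dist_sub_le _ _ _)
  change |cr 0 y x a - _| ≤ _ at h2
  have h3 : dist x y / (2 * dist x a) ≤ η := by
    rw [div_le_iff₀ (by positivity)]; nlinarith
  have := abs_sub_le (cr κ y x a) (cr 0 y x a) ((dist x a - dist y a) / dist x y)
  linarith

/-- The quadruple condition when one angle is almost `π`. -/
lemma IsAlexandrov.neg_le_cr_add_cr (hX : IsAlexandrov X κ) (hG : GoodScale κ η R) {δ : ℝ}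
    (hδ : 0 ≤ δ) {q p r s : X} (h : π - δ ≤ cangle κ q p r) (hq : q ≠ p) (hr : r ≠ p)
    (hs : s ≠ p) (hqR : dist p q ≤ R) (hrR : dist p r ≤ R) (hsR : dist p s ≤ R) :
    -δ ≤ cr κ q p s + cr κ r p s := by
  have h1 := hX.2.2 p q r s hq hr hs
  rw [cangle_comm κ s p q, cangle_eq κ r, cangle_eq κ q p s] at h1
  exact neg_le_add_of_arccos_add_le hδ (hG.cr_mem hq hs hqR hsR) (hG.cr_mem hr hs hrR hsR)
    (by linarith)

lemma GoodScale.cangle_eq_pi (hG : GoodScale κ η R) {q p r : X}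
    (h : dist q p + dist p r = dist q r) (hq : q ≠ p) (hr : r ≠ p)
    (hqR : dist p q ≤ R) (hrR : dist p r ≤ R) : cangle κ q p r = π := by
  have := hG.pos
  rw [cangle_eq, cr_eq_neg_one h (snK_dist_ne hq fun hk => hG.sqrt_lt (by linarith) hk)
    (snK_dist_ne hr fun hk => hG.sqrt_lt (by linarith) hk), arccos_neg_one]

lemma IsAlexandrov.cangle_mono (hX : IsAlexandrov X κ) (hG : GoodScale κ η R) {p a a' b : X}
    (h : dist p a' + dist a' a = dist p a) (ha' : a' ≠ p) (hb : b ≠ p)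
    (haR : dist p a ≤ R) (hbR : dist p b ≤ R) : cangle κ a p b ≤ cangle κ a' p b := by
  have := hG.pos
  have : 0 ≤ dist a' a := dist_nonneg
  exact hX.cangle_le_of_between h ha' hb fun hk =>
    ⟨hG.sqrt_lt (by linarith) hk, hG.sqrt_lt (by linarith) hk⟩

lemma IsAlexandrov.cr_mono (hX : IsAlexandrov X κ) (hG : GoodScale κ η R) {p a a' b : X}
    (h : dist p a' + dist a' a = dist p a) (ha' : a' ≠ p) (hb : b ≠ p)
    (haR : dist p a ≤ R) (hbR : dist p b ≤ R) : cr κ a' p b ≤ cr κ a p b := by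
  have h1 := hX.cangle_mono hG h ha' hb haR hbR
  have : 0 ≤ dist a' a := dist_nonneg
  rw [cangle_eq, cangle_eq] at h1
  exact (Real.strictAntiOn_arccos.le_iff_ge (hG.cr_mem (ne_of_between h ha') hb haR hbR)
    (hG.cr_mem ha' hb (by linarith) hbR)).1 h1

end Space

/-! ### Strained neighbourhoods -/

section Strained

variable {X : Type*} [MetricSpace X] {κ η R : ℝ} {k : ℕ}

lemma IsStrainer.swap {a b : Fin k → X} {p : X} {δ : ℝ} (h : IsStrainer κ a b p δ) :
    IsStrainer κ b a p δ :=
  ⟨fun i => by rw [cangle_comm]; exact h.1 i, fun i j hij =>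
    ⟨(h.2 i j hij).2.2, by rw [cangle_comm]; exact (h.2 j i hij.symm).2.1, (h.2 i j hij).1⟩⟩

/-- A ball of radius `ρ` around `p` on which `(a, b)` is a far away strainer. -/
structure StrainedBall (κ η R : ℝ) (a b : Fin k → X) (p : X) (ρ δ : ℝ) : Prop where
  good : GoodScale κ η R
  hη : 0 < η
  hη1 : η ≤ 1
  hδ : 0 ≤ δ
  far : ∀ x ∈ ball p ρ, ∀ i, 2 * ρ ≤ η * dist x (a i) ∧ 2 * ρ ≤ η * dist x (b i)
  near : ∀ x ∈ ball p ρ, ∀ i, dist x (a i) ≤ R ∧ dist x (b i) ≤ R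
  str : ∀ x ∈ ball p ρ, IsStrainer κ a b x δ

namespace StrainedBall

variable {a b : Fin k → X} {p : X} {ρ δ : ℝ}

lemma swap (h : StrainedBall κ η R a b p ρ δ) : StrainedBall κ η R b a p ρ δ :=
  ⟨h.good, h.hη, h.hη1, h.hδ, fun x hx i => (h.far x hx i).symm, fun x hx i => (h.near x hx i).symm,
    fun x hx => (h.str x hx).swap⟩

lemma dist_pos_a (h : StrainedBall κ η R a b p ρ δ) {x : X} (hx : x ∈ ball p ρ) (i : Fin k) :
    0 < dist x (a i) := by
  have := (h.far x hx i).1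
  have h2 := pos_of_mem_ball hx
  exact pos_of_mul_pos_right (lt_of_lt_of_le (by linarith) this) h.hη.le

lemma ne_a (h : StrainedBall κ η R a b p ρ δ) {x : X} (hx : x ∈ ball p ρ) (i : Fin k) :
    a i ≠ x := (dist_pos.1 (h.dist_pos_a hx i)).symm

lemma dist_lt {x y : X} (hx : x ∈ ball p ρ) (hy : y ∈ ball p ρ) : dist x y < 2 * ρ := by
  have := dist_triangle_right x y p
  rw [mem_ball] at hx hy
  linarith

lemma dist_le (h : StrainedBall κ η R a b p ρ δ) {x y : X} (hx : x ∈ ball p ρ)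
    (hy : y ∈ ball p ρ) (i : Fin k) : dist x y ≤ η * dist x (a i) :=
  (dist_lt hx hy).le.trans (h.far x hx i).1

lemma dist_le_R (h : StrainedBall κ η R a b p ρ δ) {x y : X} (hx : x ∈ ball p ρ)
    (hy : y ∈ ball p ρ) (i : Fin k) : dist x y ≤ R := by
  have h1 := h.dist_le hx hy i
  have h2 := (h.near x hx i).1
  have h3 := mul_le_mul_of_nonneg_right h.hη1 (dist_nonneg (x := x) (y := a i))
  linarith

lemma conv (h : StrainedBall κ η R a b p ρ δ) {x y : X} (hx : x ∈ ball p ρ)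
    (hy : y ∈ ball p ρ) (hne : y ≠ x) (i : Fin k) :
    |cr κ y x (a i) - (dist x (a i) - dist y (a i)) / dist x y| ≤ 3 * η :=
  h.good.abs_cr_sub_div_le h.hη.le hne (h.ne_a hx i) (h.dist_le_R hx hy i) (h.near x hx i).1
    (h.dist_le hx hy i)

lemma conv_mul (h : StrainedBall κ η R a b p ρ δ) {x y : X} (hx : x ∈ ball p ρ)
    (hy : y ∈ ball p ρ) (hne : y ≠ x) (i : Fin k) :
    |cr κ y x (a i) * dist x y - (dist x (a i) - dist y (a i))| ≤ 3 * η * dist x y := by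
  have p1 := dist_pos.2 hne.symm
  have := mul_le_mul_of_nonneg_right (h.conv hx hy hne i) p1.le
  rwa [← abs_of_pos p1, ← abs_mul, abs_of_pos p1, sub_mul, div_mul_cancel₀ _ p1.ne'] at this

lemma sum_aux (hX : IsAlexandrov X κ) (h : StrainedBall κ η R a b p ρ δ) {x y : X}
    (hx : x ∈ ball p ρ) (hy : y ∈ ball p ρ) (i : Fin k) :
    dist y (a i) + dist y (b i) - (dist x (a i) + dist x (b i)) ≤ (δ + 6 * η) * dist x y := by
  rcases eq_or_ne y x with rfl | hne
  · simp
  have p1 := dist_pos.2 hne.symm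
  have h1 := abs_le.1 (h.conv_mul hx hy hne i)
  have h2 := abs_le.1 (h.swap.conv_mul hx hy hne i)
  have h3 := hX.neg_le_cr_add_cr h.good h.hδ ((h.str x hx).1 i).le (h.ne_a hx i)
    (h.swap.ne_a hx i) hne (h.near x hx i).1 (h.near x hx i).2 (h.dist_le_R hx hy i)
  rw [cr_comm κ (a i), cr_comm κ (b i)] at h3
  have h4 := mul_le_mul_of_nonneg_right h3 p1.le
  linarith

/-- The sum of the distances to the two points of a strainer is almost constant. -/
lemma abs_sum_le (hX : IsAlexandrov X κ) (h : StrainedBall κ η R a b p ρ δ) {x y : X}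
    (hx : x ∈ ball p ρ) (hy : y ∈ ball p ρ) (i : Fin k) :
    |dist y (a i) + dist y (b i) - (dist x (a i) + dist x (b i))| ≤ (δ + 6 * η) * dist x y := by
  rw [abs_le]
  have h1 := h.sum_aux hX hx hy i
  have h2 := h.sum_aux hX hy hx i
  rw [dist_comm y x] at h2
  constructor <;> linarith

lemma cross_aux (hX : IsAlexandrov X κ) (h : StrainedBall κ η R a b p ρ δ) {y q : X}
    (hy : y ∈ ball p ρ) (hq : q ∈ ball p ρ) (hne : q ≠ y) {i j : Fin k} (hij : i ≠ j)
    (hb : dist y q + dist q (a i) = dist y (a i)) :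
    dist y (a j) - dist q (a j) ≤ (δ + 3 * η) * dist y q := by
  have p1 := dist_pos.2 hne.symm
  have h1 := abs_le.1 (h.conv_mul hy hq hne j)
  have h2 := hX.cangle_mono h.good hb hne (h.ne_a hy j) (h.near y hy i).1 (h.near y hy j).1
  have h3 := ((h.str y hy).2 i j hij).1
  rw [cangle_eq κ q] at h2
  have h4 := le_of_pi_div_two_sub_lt_arccos h.hδ (h.good.cr_mem hne (h.ne_a hy j)
    (h.dist_le_R hy hq i) (h.near y hy j).1).2 (lt_of_lt_of_le h3 h2)
  have h5 := mul_le_mul_of_nonneg_right h4 p1.le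
  linarith

lemma cross_aux' (hX : IsAlexandrov X κ) (h : StrainedBall κ η R a b p ρ δ) {y q : X}
    (hy : y ∈ ball p ρ) (hq : q ∈ ball p ρ) (hne : q ≠ y) {i j : Fin k} (hij : i ≠ j)
    (hb : dist y q + dist q (a i) = dist y (a i)) :
    dist y (b j) - dist q (b j) ≤ (δ + 3 * η) * dist y q := by
  have p1 := dist_pos.2 hne.symm
  have h1 := abs_le.1 (h.swap.conv_mul hy hq hne j)
  have h2 := hX.cangle_mono h.good hb hne (h.swap.ne_a hy j) (h.near y hy i).1 (h.near y hy j).2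
  have h3 := ((h.str y hy).2 i j hij).2.1
  rw [cangle_eq κ q] at h2
  have h4 := le_of_pi_div_two_sub_lt_arccos h.hδ (h.good.cr_mem hne (h.swap.ne_a hy j)
    (h.dist_le_R hy hq i) (h.near y hy j).2).2 (lt_of_lt_of_le h3 h2)
  have h5 := mul_le_mul_of_nonneg_right h4 p1.le
  linarith

/-- Moving towards `a i` almost does not change the distances to `a j`, `b j` for `j ≠ i`. -/
lemma cross (hX : IsAlexandrov X κ) (h : StrainedBall κ η R a b p ρ δ) {y q : X}
    (hy : y ∈ ball p ρ) (hq : q ∈ ball p ρ) (hne : q ≠ y) {i j : Fin k} (hij : i ≠ j)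
    (hb : dist y q + dist q (a i) = dist y (a i)) :
    |dist q (a j) - dist y (a j)| ≤ (2 * δ + 9 * η) * dist y q := by
  have h1 := h.cross_aux hX hy hq hne hij hb
  have h2 := h.cross_aux' hX hy hq hne hij hb
  have h3 := abs_le.1 (h.abs_sum_le hX hy hq j)
  have := mul_nonneg (add_nonneg h.hδ (mul_nonneg (by norm_num : (0:ℝ) ≤ 6) h.hη.le))
    (dist_nonneg (x := y) (y := q))
  rw [abs_le]
  constructor <;> linarith

/-- Approximate law of cosines when moving towards `a i`. -/
lemma toward (hX : IsAlexandrov X κ) (h : StrainedBall κ η R a b p ρ δ) {y q w : X}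
    (hy : y ∈ ball p ρ) (hq : q ∈ ball p ρ) (hw : w ∈ ball p ρ) (hne : q ≠ y) (i : Fin k)
    (hb : dist y q + dist q (a i) = dist y (a i)) :
    |dist w q ^ 2 - dist w y ^ 2 - dist y q ^ 2 + 2 * dist y q * (dist y (a i) - dist w (a i))| ≤
      (4 * δ + 22 * η) * (dist y q * dist w y) := by
  have hη := h.hη
  have hδ := h.hδ
  rcases eq_or_ne w y with rfl | hwy
  · simp
  have p1 := dist_pos.2 hne.symm
  have p2 := dist_pos.2 hwy.symm
  have h1 := abs_le.1 (h.conv_mul hy hw hwy i)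
  have h2 := hX.cr_mono h.good hb hne hwy (h.near y hy i).1 (h.dist_le_R hy hw i)
  have h3 := hX.cangle_mono h.good hb hne (h.swap.ne_a hy i) (h.near y hy i).1 (h.near y hy i).2
  have h4 := hX.neg_le_cr_add_cr h.good h.hδ (((h.str y hy).1 i).le.trans h3) hne
    (h.swap.ne_a hy i) hwy (h.dist_le_R hy hq i) (h.near y hy i).2 (h.dist_le_R hy hw i)
  have h5 := abs_le.1 (h.swap.conv_mul hy hw hwy i)
  have h6 := abs_le.1 (h.good.abs_cr_sub_le h.hη.le hne hwy (h.dist_le_R hy hq i)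
    (h.dist_le_R hy hw i))
  have h7 := dist_sq_eq (q := q) (p := y) (r := w) hne hwy
  have h8 := abs_le.1 (h.abs_sum_le hX hy hw i)
  rw [cr_comm κ (a i)] at h2
  rw [cr_comm κ (b i)] at h4
  have u1 : cr 0 q y w * dist y w ≤ (dist y (a i) - dist w (a i)) + 5 * η * dist y w := by
    have := mul_le_mul_of_nonneg_right (show cr 0 q y w ≤ cr κ w y (a i) + 2 * η by linarith) p2.le
    linarith
  have u2 : (dist y (a i) - dist w (a i)) - (2 * δ + 11 * η) * dist y w ≤
      cr 0 q y w * dist y w := by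
    have := mul_le_mul_of_nonneg_right
      (show -δ - cr κ w y (b i) - 2 * η ≤ cr 0 q y w by linarith) p2.le
    linarith
  have v1 := mul_le_mul_of_nonneg_left u1 p1.le
  have v2 := mul_le_mul_of_nonneg_left u2 p1.le
  have p3 := mul_pos p1 p2
  have p4 := mul_nonneg hδ p3.le
  have p5 := mul_nonneg hη.le p3.le
  rw [dist_comm w q, h7, dist_comm w y, abs_le]
  constructor <;> linarith

lemma crit_aux (h : StrainedBall κ η R a b p ρ δ) {q z : X}
    (hq : q ∈ ball p ρ) (hz : z ∈ ball p ρ) (hc : IsCriticalPt κ q z) (i : Fin k) :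
    dist q (a i) - dist z (a i) ≤ 3 * η * dist q z := by
  rcases eq_or_ne q z with rfl | hne
  · simp
  have h1 := hc (a i) (h.ne_a hz i)
  rw [cangle_eq, Real.arccos_le_pi_div_two] at h1
  have h2 := abs_le.1 (h.conv_mul hz hq hne i)
  have := mul_nonneg h1 (dist_nonneg (x := z) (y := q))
  rw [dist_comm q z]
  linarith

lemma crit (hX : IsAlexandrov X κ) (h : StrainedBall κ η R a b p ρ δ) {q z : X}
    (hq : q ∈ ball p ρ) (hz : z ∈ ball p ρ) (hc : IsCriticalPt κ q z) (i : Fin k) :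
    |dist z (a i) - dist q (a i)| ≤ (δ + 9 * η) * dist q z := by
  have h1 := h.crit_aux hq hz hc i
  have h2 := h.swap.crit_aux hq hz hc i
  have h3 := abs_le.1 (h.abs_sum_le hX hq hz i)
  have := mul_nonneg (add_nonneg h.hδ (mul_nonneg (by norm_num : (0:ℝ) ≤ 6) h.hη.le))
    (dist_nonneg (x := q) (y := z))
  rw [abs_le]
  constructor <;> linarith

end StrainedBall

lemma GoodScale.hinge (hG : GoodScale κ η R) (hη : 0 ≤ η) {q z u : X} (hc : IsCriticalPt κ q z)
    (hq : dist z q ≤ R) (hu : dist z u ≤ R) :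
    dist q u ^ 2 ≤ dist q z ^ 2 + dist z u ^ 2 + 4 * η * (dist q z * dist z u) := by
  rcases eq_or_ne q z with rfl | hne
  · simp
  rcases eq_or_ne u z with rfl | hne'
  · simp
  have h1 := hc u hne'
  rw [cangle_eq, Real.arccos_le_pi_div_two] at h1
  have h2 := abs_le.1 (hG.abs_cr_sub_le hη hne hne' hq hu)
  rw [dist_sq_eq hne hne', dist_comm q z]
  have p1 : 0 ≤ dist z q * dist z u := by positivity
  nlinarith [mul_le_mul_of_nonneg_left (show -(2 * η) ≤ cr 0 q z u by linarith) p1]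

end Strained

section Charts

variable {X : Type*} [MetricSpace X] {κ η R : ℝ} {k : ℕ}

/-- The defect of the distance coordinates `dist · (a i)` from being an isometry. -/
noncomputable def defect (a : Fin k → X) (x y : X) : ℝ :=
  dist x y ^ 2 - ∑ i, (dist x (a i) - dist y (a i)) ^ 2

lemma defect_comm (a : Fin k → X) (x y : X) : defect a x y = defect a y x := by
  unfold defect
  rw [dist_comm]
  congr 1
  exact Finset.sum_congr rfl fun i _ => by ring

lemma abs_defect_sub_le {a : Fin k → X} {w y q : X} {s c e : ℝ} (i : Fin k) (hc : 0 ≤ c)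
    (hc1 : c ≤ 1) (hF : ∀ j, |dist q (a j) - dist y (a j) - (if j = i then s else 0)| ≤ c * |s|)
    (ht : |dist w q ^ 2 - dist w y ^ 2 - s ^ 2 + 2 * s * (dist w (a i) - dist y (a i))| ≤ e) :
    |defect a w q - defect a w y| ≤ e + 3 * k * c * (|s| * (dist w y + |s|)) := by
  have hd0 := dist_nonneg (x := w) (y := y)
  have hs := abs_nonneg s
  have hcs := mul_nonneg hc hs
  have key : ∀ j, |(dist w (a j) - dist y (a j)) ^ 2 - (dist w (a j) - dist q (a j)) ^ 2 -
      (if j = i then 2 * s * (dist w (a i) - dist y (a i)) - s ^ 2 else 0)| ≤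
      3 * c * (|s| * (dist w y + |s|)) := by
    intro j
    have hD : |dist w (a j) - dist y (a j)| ≤ dist w y := abs_dist_sub_le _ _ _
    have h1 := hF j
    set d := dist q (a j) - dist y (a j) - (if j = i then s else 0) with hd
    set D := dist w (a j) - dist y (a j) with hDdef
    have hDd : |D| * |d| ≤ dist w y * (c * |s|) := mul_le_mul hD h1 (abs_nonneg _) hd0
    have hdd : |d| * |d| ≤ (c * |s|) * (c * |s|) := mul_le_mul h1 h1 (abs_nonneg _) hcs
    have hds : |s| * |d| ≤ |s| * (c * |s|) := mul_le_mul_of_nonneg_left h1 hs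
    have hcc : (c * |s|) * (c * |s|) ≤ c * |s| * |s| := by
      have := mul_le_mul_of_nonneg_right hc1 (mul_nonneg hcs hs)
      nlinarith
    have hz : 0 ≤ c * (|s| * dist w y) := mul_nonneg hc (mul_nonneg hs hd0)
    rw [← abs_mul] at hDd hdd hds
    have g1 := abs_le.1 hDd
    have g2 := abs_le.1 hdd
    have g3 := abs_le.1 hds
    split_ifs at hd ⊢ with hji
    · subst hji
      have e1 : D ^ 2 - (dist w (a j) - dist q (a j)) ^ 2 -
        (2 * s * (dist w (a j) - dist y (a j)) - s ^ 2)
          = 2 * (D * d) - 2 * (s * d) - d * d := by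
        rw [show dist w (a j) - dist q (a j) = D - d - s by rw [hd, hDdef]; ring,
          show dist w (a j) - dist y (a j) = D from rfl]
        ring
      rw [e1, abs_le]
      constructor <;> nlinarith
    · have e1 : D ^ 2 - (dist w (a j) - dist q (a j)) ^ 2 - 0 = 2 * (D * d) - d * d := by
        rw [show dist w (a j) - dist q (a j) = D - d by rw [hd, hDdef]; ring]
        ring
      rw [e1, abs_le]
      constructor <;> nlinarith
  have hsum := (Finset.abs_sum_le_sum_abs (fun j => (dist w (a j) - dist y (a j)) ^ 2 -
    (dist w (a j) - dist q (a j)) ^ 2 - (if j = i then 2 * s * (dist w (a i) - dist y (a i)) - s ^ 2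
      else 0)) Finset.univ).trans (Finset.sum_le_sum fun j _ => key j)
  rw [Finset.sum_sub_distrib, Finset.sum_sub_distrib, Finset.sum_ite_eq' Finset.univ i,
    if_pos (Finset.mem_univ i), Finset.sum_const, Finset.card_univ, Fintype.card_fin,
    nsmul_eq_mul] at hsum
  unfold defect
  have g1 := abs_le.1 hsum
  have g2 := abs_le.1 ht
  rw [abs_le]
  constructor <;> linarith

lemma StrainedBall.move_neg (hX : IsAlexandrov X κ) {a b : Fin k → X} {p : X} {ρ δ : ℝ}
    (h : StrainedBall κ η R a b p (2 * ρ) δ) {y : X} (hy : y ∈ ball p ρ) (i : Fin k) {t : ℝ}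
    (ht : 0 < t) (htρ : t ≤ ρ) : ∃ q ∈ ball p (2 * ρ), dist y q = t ∧ q ≠ y ∧
      dist y q + dist q (a i) = dist y (a i) := by
  have hρ := pos_of_mem_ball hy
  have hy' : y ∈ ball p (2 * ρ) := ball_subset_ball (by linarith) hy
  have h1 := (h.far y hy' i).1
  have h2 := mul_le_mul_of_nonneg_right h.hη1 (dist_nonneg (x := y) (y := a i))
  obtain ⟨q, hq1, hq2⟩ := hX.exists_between y (a i) ht.le (by linarith)
  refine ⟨q, ?_, hq1, ?_, by rw [hq1, hq2]; ring⟩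
  · have := dist_triangle_left q p y
    rw [mem_ball] at *
    linarith
  · rintro rfl
    rw [dist_self] at hq1
    exact ht.ne hq1

lemma StrainedBall.move (hX : IsAlexandrov X κ) {a b : Fin k → X} {p : X} {ρ δ c : ℝ}
    (h : StrainedBall κ η R a b p (2 * ρ) δ) (hc : 4 * δ + 25 * η ≤ c) (hc1 : c ≤ 1)
    {y : X} (hy : y ∈ ball p ρ) (i : Fin k) {s : ℝ} (hs : |s| ≤ ρ) :
    ∃ q, dist y q = |s| ∧
      (∀ j, |dist q (a j) - dist y (a j) - (if j = i then s else 0)| ≤ c * |s|) ∧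
      ∀ w ∈ ball p ρ, |defect a w q - defect a w y| ≤
        (4 + 3 * k) * c * (|s| * (dist w y + |s|)) := by
  have hη := h.hη
  have hδ := h.hδ
  have hρ := pos_of_mem_ball hy
  have hc0 : 0 ≤ c := by linarith
  have sub : ball p ρ ⊆ ball p (2 * ρ) := ball_subset_ball (by linarith)
  have main : ∀ q, dist y q = |s| → (∀ j, |dist q (a j) - dist y (a j) -
      (if j = i then s else 0)| ≤ c * |s|) → (∀ w ∈ ball p ρ,
        |dist w q ^ 2 - dist w y ^ 2 - s ^ 2 + 2 * s * (dist w (a i) - dist y (a i))| ≤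
          4 * c * (|s| * dist w y)) →
      ∃ q, dist y q = |s| ∧
      (∀ j, |dist q (a j) - dist y (a j) - (if j = i then s else 0)| ≤ c * |s|) ∧
      ∀ w ∈ ball p ρ, |defect a w q - defect a w y| ≤
        (4 + 3 * k) * c * (|s| * (dist w y + |s|)) := by
    intro q h1 h2 h3
    refine ⟨q, h1, h2, fun w hw => (abs_defect_sub_le i hc0 hc1 h2 (h3 w hw)).trans ?_⟩
    have := mul_nonneg hc0 (mul_nonneg (abs_nonneg s) (abs_nonneg s))
    linarith
  rcases lt_trichotomy s 0 with h0 | rfl | h0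
  · rw [abs_of_neg h0] at *
    obtain ⟨q, hq, hyq, hne, hb⟩ := h.move_neg hX hy i (neg_pos.2 h0) hs
    refine main q hyq (fun j => ?_) fun w hw => ?_
    · split_ifs with hji
      · subst hji
        rw [show dist q (a j) - dist y (a j) - s = 0 by linarith, abs_zero]
        exact mul_nonneg hc0 (by linarith)
      · have := h.cross hX (sub hy) hq hne (Ne.symm hji) hb
        rw [sub_zero]
        rw [hyq] at this
        exact this.trans (mul_le_mul_of_nonneg_right (by linarith) (by linarith))
    · have := h.toward hX (sub hy) hq (sub hw) hne i hb
      rw [hyq] at this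
      have p := mul_nonneg (by linarith : 0 ≤ -s) (dist_nonneg (x := w) (y := y))
      rw [show dist w q ^ 2 - dist w y ^ 2 - s ^ 2 + 2 * s * (dist w (a i) - dist y (a i)) =
        dist w q ^ 2 - dist w y ^ 2 - (-s) ^ 2 + 2 * -s * (dist y (a i) - dist w (a i)) by ring]
      exact this.trans (mul_le_mul_of_nonneg_right (by linarith) p)
  · refine main y (by simp) (fun j => by simp) fun w hw => by simp
  · rw [abs_of_pos h0] at *
    obtain ⟨q, hq, hyq, hne, hb⟩ := h.swap.move_neg hX hy i h0 hs
    refine main q hyq (fun j => ?_) fun w hw => ?_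
    · have e1 := abs_le.1 (h.abs_sum_le hX (sub hy) hq j)
      rw [hyq] at e1
      have p2 := mul_nonneg hδ h0.le
      have p3 := mul_nonneg hη.le h0.le
      have p4 := mul_le_mul_of_nonneg_right hc h0.le
      split_ifs with hji
      · subst hji
        rw [abs_le]
        constructor <;> linarith
      · have := abs_le.1 (h.swap.cross hX (sub hy) hq hne (Ne.symm hji) hb)
        rw [sub_zero, abs_le]
        rw [hyq] at this
        constructor <;> linarith
    · have e1 := abs_le.1 (h.swap.toward hX (sub hy) hq (sub hw) hne i hb)
      have e2 := abs_le.1 (h.abs_sum_le hX (sub hw) (sub hy) i)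
      rw [hyq] at e1
      have p := mul_nonneg h0.le (dist_nonneg (x := w) (y := y))
      have p2 := mul_nonneg hδ p
      have p3 := mul_nonneg hη.le p
      have p4 := mul_le_mul_of_nonneg_right hc p
      have e3 := mul_le_mul_of_nonneg_left e2.1 h0.le
      have e4 := mul_le_mul_of_nonneg_left e2.2 h0.le
      rw [abs_le]
      constructor <;> linarith

/-- A ball on which the distance coordinates `dist · (a i)` form an almost isometric chart in
the directions in which it is a submersion. -/
structure Chart (κ : ℝ) (a b : Fin k → X) (p : X) (ρ ε : ℝ) : Prop where
  pos : 0 < ρ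
  move : ∀ y ∈ ball p ρ, ∀ i, ∀ s, |s| ≤ ρ → ∃ q, dist y q = |s| ∧
    (∀ j, |dist q (a j) - dist y (a j) - (if j = i then s else 0)| ≤ ε * |s|) ∧
    ∀ w ∈ ball p ρ, |defect a w q - defect a w y| ≤ ε * (|s| * (dist w y + |s|))
  crit : ∀ q ∈ ball p ρ, ∀ z ∈ ball p ρ, IsCriticalPt κ q z → ∀ i,
    |dist z (a i) - dist q (a i)| ≤ ε * dist q z
  hinge : ∀ q ∈ ball p ρ, ∀ z ∈ ball p ρ, ∀ u ∈ ball p ρ, IsCriticalPt κ q z →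
    dist q u ^ 2 ≤ dist q z ^ 2 + dist z u ^ 2 + ε * (dist q z * dist z u)
  str : ∀ x ∈ ball p ρ, IsStrainer κ a b x ε
  ne : ∀ x ∈ ball p ρ, ∀ i, a i ≠ x ∧ b i ≠ x
  conv_a : ∀ x ∈ ball p ρ, ∀ y ∈ ball p ρ, y ≠ x → ∀ i,
    |cr κ y x (a i) - (dist x (a i) - dist y (a i)) / dist x y| ≤ ε
  conv_b : ∀ x ∈ ball p ρ, ∀ y ∈ ball p ρ, y ≠ x → ∀ i,
    |cr κ y x (b i) - (dist x (b i) - dist y (b i)) / dist x y| ≤ ε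
  sum_le : ∀ x ∈ ball p ρ, ∀ y ∈ ball p ρ, ∀ i,
    |dist y (a i) + dist y (b i) - (dist x (a i) + dist x (b i))| ≤ ε * dist x y
  good : ∃ R, GoodScale κ ε R ∧ 4 * ρ ≤ R ∧
    ∀ x ∈ ball p ρ, ∀ i, dist x (a i) ≤ R ∧ dist x (b i) ≤ R

end Charts

section ChartExistence

variable {X : Type*} [MetricSpace X] {κ η R : ℝ} {k : ℕ}

lemma GoodScale.weaken {ε : ℝ} (hG : GoodScale κ η R) (h : η ≤ ε) : GoodScale κ ε R where
  pos := hG.pos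
  lt_pi := hG.lt_pi
  one_add s t d h1 h2 h3 h4 h5 h6 := (hG.one_add s t d h1 h2 h3 h4 h5 h6).trans
    (mul_le_mul_of_nonneg_right h (by linarith [(crK_zero_mem h1 h3 h5 h6).1]))
  one_sub s t d h1 h2 h3 h4 h5 h6 := (hG.one_sub s t d h1 h2 h3 h4 h5 h6).trans
    (mul_le_mul_of_nonneg_right h (by linarith [(crK_zero_mem h1 h3 h5 h6).2]))

lemma StrainedBall.chart (hX : IsAlexandrov X κ) {a b : Fin k → X} {p : X} {ρ δ ε : ℝ}
    (h : StrainedBall κ η R a b p (2 * ρ) δ) (hρ : 0 < ρ) (hρR : 4 * ρ ≤ R)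
    (hε : (4 + 3 * k) * (4 * δ + 25 * η) ≤ ε) (hε1 : ε ≤ 1) : Chart κ a b p ρ ε := by
  have hη := h.hη
  have hδ := h.hδ
  have sub : ball p ρ ⊆ ball p (2 * ρ) := ball_subset_ball (by linarith)
  have hk : (0 : ℝ) ≤ k := Nat.cast_nonneg k
  have hc0 : 0 ≤ 4 * δ + 25 * η := by positivity
  have hc : 4 * δ + 25 * η ≤ ε := by nlinarith [mul_nonneg hk hc0]
  refine ⟨hρ, fun y hy i s hs => ?_, fun q hq z hz hcr i => ?_, fun q hq z hz u hu hcr => ?_,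
    fun x hx => ?_, fun x hx i => ⟨h.ne_a (sub hx) i, h.swap.ne_a (sub hx) i⟩,
    fun x hx y hy hne i => ?_, fun x hx y hy hne i => ?_, fun x hx y hy i => ?_,
    R, h.good.weaken (by linarith), hρR, fun x hx i => h.near x (sub hx) i⟩
  · obtain ⟨q, h1, h2, h3⟩ := h.move hX le_rfl (by linarith) hy i hs
    refine ⟨q, h1, fun j => (h2 j).trans (mul_le_mul_of_nonneg_right hc (abs_nonneg s)),
      fun w hw => (h3 w hw).trans (mul_le_mul_of_nonneg_right hε ?_)⟩
    exact mul_nonneg (abs_nonneg s) (add_nonneg dist_nonneg (abs_nonneg s))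
  · exact (h.crit hX (sub hq) (sub hz) hcr i).trans
      (mul_le_mul_of_nonneg_right (by linarith) dist_nonneg)
  · refine (h.good.hinge hη.le hcr ((StrainedBall.dist_lt hz hq).le.trans (by linarith))
      ((StrainedBall.dist_lt hz hu).le.trans (by linarith))).trans ?_
    have := mul_le_mul_of_nonneg_right (show 4 * η ≤ ε by linarith)
      (mul_nonneg (dist_nonneg (x := q) (y := z)) (dist_nonneg (x := z) (y := u)))
    linarith
  · have := h.str x (sub hx)
    exact ⟨fun i => lt_of_le_of_lt (by linarith) (this.1 i), fun i j hij =>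
      ⟨lt_of_le_of_lt (by linarith) (this.2 i j hij).1,
        lt_of_le_of_lt (by linarith) (this.2 i j hij).2.1,
        lt_of_le_of_lt (by linarith) (this.2 i j hij).2.2⟩⟩
  · exact (h.conv (sub hx) (sub hy) hne i).trans (by linarith)
  · exact (h.swap.conv (sub hx) (sub hy) hne i).trans (by linarith)
  · exact (h.abs_sum_le hX (sub hx) (sub hy) i).trans
      (mul_le_mul_of_nonneg_right (by linarith) dist_nonneg)

/-- `p` admits `(k, δ)`-strainers arbitrarily close to it. -/
def LocStrained (κ : ℝ) (k : ℕ) (δ : ℝ) (p : X) : Prop :=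
  ∀ r > 0, ∃ a b : Fin k → X, (∀ i, dist p (a i) ≤ r ∧ dist p (b i) ≤ r) ∧ IsStrainer κ a b p δ

lemma cangle_self_left (κ : ℝ) (p r : X) : cangle κ p p r = π / 2 := by
  rw [cangle_eq]
  unfold cr crK
  simp only [dist_self, mul_zero, Real.sin_zero, Real.sinh_zero, zero_mul, div_zero]
  split_ifs <;> exact Real.arccos_zero

lemma ne_of_pi_div_two_lt_cangle {q p r : X} (h : π / 2 < cangle κ q p r) : q ≠ p ∧ r ≠ p := by
  constructor
  · rintro rfl
    rw [cangle_self_left] at h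
    exact h.false
  · rintro rfl
    rw [cangle_comm, cangle_self_left] at h
    exact h.false

lemma continuousAt_cangle {q p r : X} (hq : snK κ (dist p q) ≠ 0) (hr : snK κ (dist p r) ≠ 0) :
    ContinuousAt (fun x => cangle κ q x r) p := by
  simp only [cangle_eq]
  refine Real.continuous_arccos.continuousAt.comp ?_
  unfold cr crK
  unfold snK at hq hr
  split_ifs at * with h1 h2
  · refine ContinuousAt.div (Continuous.continuousAt (by fun_prop))
      (Continuous.continuousAt (by fun_prop)) (mul_ne_zero hq hr)
  · refine ContinuousAt.div (Continuous.continuousAt (by fun_prop))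
      (Continuous.continuousAt (by fun_prop)) (mul_ne_zero hq hr)
  · refine ContinuousAt.div (Continuous.continuousAt (by fun_prop))
      (Continuous.continuousAt (by fun_prop)) (mul_ne_zero (mul_ne_zero two_ne_zero hq) hr)

lemma eventually_isStrainer {a b : Fin k → X} {p : X} {δ : ℝ} (h : IsStrainer κ a b p δ)
    (ha : ∀ i, snK κ (dist p (a i)) ≠ 0) (hb : ∀ i, snK κ (dist p (b i)) ≠ 0) :
    ∀ᶠ x in nhds p, IsStrainer κ a b x δ := by
  have h1 : ∀ᶠ x in nhds p, ∀ i, π - δ < cangle κ (a i) x (b i) := Filter.eventually_all.2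
    fun i => (continuousAt_cangle (ha i) (hb i)).eventually_const_lt (h.1 i)
  have h2 : ∀ᶠ x in nhds p, ∀ i j, i ≠ j → π / 2 - δ < cangle κ (a i) x (a j) ∧
    π / 2 - δ < cangle κ (a i) x (b j) ∧ π / 2 - δ < cangle κ (b i) x (b j) := by
    refine Filter.eventually_all.2 fun i => Filter.eventually_all.2 fun j => ?_
    rcases eq_or_ne i j with rfl | hij
    · simp
    filter_upwards [(continuousAt_cangle (ha i) (ha j)).eventually_const_lt (h.2 i j hij).1,
      (continuousAt_cangle (ha i) (hb j)).eventually_const_lt (h.2 i j hij).2.1,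
      (continuousAt_cangle (hb i) (hb j)).eventually_const_lt (h.2 i j hij).2.2] with x x1 x2 x3 _
    exact ⟨x1, x2, x3⟩
  filter_upwards [h1, h2] with x x1 x2 using ⟨x1, x2⟩

lemma exists_chart (hX : IsAlexandrov X κ) (k : ℕ) {ε : ℝ} (hε : 0 < ε) (hε1 : ε ≤ 1) :
    ∃ δ > 0, ∀ p : X, LocStrained κ k δ p → ∀ r > 0, ∃ (a b : Fin k → X) (ρ : ℝ),
      ρ ≤ r ∧ Chart κ a b p ρ ε ∧ ∀ i, dist p (a i) ≤ r ∧ dist p (b i) ≤ r := by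
  have hk : (0 : ℝ) ≤ k := Nat.cast_nonneg k
  obtain ⟨η, hη, hηε⟩ : ∃ η > 0, (4 + 3 * (k : ℝ)) * (29 * η) = ε :=
    ⟨ε / (29 * (4 + 3 * k)), by positivity, by field_simp⟩
  have hη1 : η ≤ 1 / 116 := by nlinarith [mul_nonneg hk hη.le]
  obtain ⟨R, hG⟩ := exists_goodScale κ hη
  have hR := hG.pos
  refine ⟨η, hη, fun p hp r hr => ?_⟩
  obtain ⟨a, b, hab, hs⟩ := hp (min r (R / 2)) (lt_min hr (half_pos hR))
  have hne : ∀ i, a i ≠ p ∧ b i ≠ p := fun i => ne_of_pi_div_two_lt_cangle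
    (lt_of_le_of_lt (by linarith [Real.two_le_pi]) (hs.1 i))
  have hlt : ∀ i, dist p (a i) < R ∧ dist p (b i) < R := fun i =>
    ⟨lt_of_le_of_lt ((hab i).1.trans (min_le_right _ _)) (half_lt_self hR),
      lt_of_le_of_lt ((hab i).2.trans (min_le_right _ _)) (half_lt_self hR)⟩
  have e1 := eventually_isStrainer hs
    (fun i => snK_dist_ne (hne i).1 fun hk => hG.sqrt_lt (by linarith [(hlt i).1]) hk)
    (fun i => snK_dist_ne (hne i).2 fun hk => hG.sqrt_lt (by linarith [(hlt i).2]) hk)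
  have e2 : ∀ᶠ x in nhds p, ∀ i, (dist x (a i) < R ∧ dist x (b i) < R) ∧
      dist p (a i) / 2 < dist x (a i) ∧ dist p (b i) / 2 < dist x (b i) := by
    refine Filter.eventually_all.2 fun i => ?_
    have c1 : ContinuousAt (fun x => dist x (a i)) p := by fun_prop
    have c2 : ContinuousAt (fun x => dist x (b i)) p := by fun_prop
    exact ((c1.eventually_lt_const (hlt i).1).and (c2.eventually_lt_const (hlt i).2)).and
      ((c1.eventually_const_lt (half_lt_self (dist_pos.2 (hne i).1.symm))).and
        (c2.eventually_const_lt (half_lt_self (dist_pos.2 (hne i).2.symm))))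
  obtain ⟨r1, hr1, hball⟩ := Metric.eventually_nhds_iff.1 (e1.and e2)
  have e3 : ∀ᶠ t : ℝ in nhds 0, ∀ i, 2 * (2 * t) < η * (dist p (a i) / 2) ∧
      2 * (2 * t) < η * (dist p (b i) / 2) := by
    refine Filter.eventually_all.2 fun i => ?_
    have c : ContinuousAt (fun t : ℝ => 2 * (2 * t)) 0 := by fun_prop
    have pa := dist_pos.2 (hne i).1.symm
    have pb := dist_pos.2 (hne i).2.symm
    exact (c.eventually_lt_const (by simp only [mul_zero]; positivity)).and
      (c.eventually_lt_const (by simp only [mul_zero]; positivity))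
  obtain ⟨r2, hr2, ht⟩ := Metric.eventually_nhds_iff.1 e3
  obtain ⟨ρ, hρ, h1, h2, h3, h4⟩ : ∃ ρ > 0, 2 * ρ ≤ r1 ∧ ρ < r2 ∧ 4 * ρ ≤ R ∧ ρ ≤ r := by
    refine ⟨min (min (r1 / 2) (r2 / 2)) (min (R / 4) r), by positivity, ?_, ?_, ?_, ?_⟩
    · linarith [min_le_left (min (r1 / 2) (r2 / 2)) (min (R / 4) r), min_le_left (r1 / 2) (r2 / 2)]
    · linarith [min_le_left (min (r1 / 2) (r2 / 2)) (min (R / 4) r), min_le_right (r1 / 2) (r2 / 2)]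
    · linarith [min_le_right (min (r1 / 2) (r2 / 2)) (min (R / 4) r), min_le_left (R / 4) r]
    · linarith [min_le_right (min (r1 / 2) (r2 / 2)) (min (R / 4) r), min_le_right (R / 4) r]
  have ht' := @ht ρ (by rw [Real.dist_eq, sub_zero, abs_of_pos hρ]; exact h2)
  have hb : ∀ x ∈ ball p (2 * ρ), _ := fun x hx => @hball x (lt_of_lt_of_le hx h1)
  have SB : StrainedBall κ η R a b p (2 * ρ) η := ⟨hG, hη, by linarith, hη.le,
    fun x hx i => ⟨(ht' i).1.le.trans (mul_le_mul_of_nonneg_left ((hb x hx).2 i).2.1.le hη.le),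
      (ht' i).2.le.trans (mul_le_mul_of_nonneg_left ((hb x hx).2 i).2.2.le hη.le)⟩,
    fun x hx i => ⟨((hb x hx).2 i).1.1.le, ((hb x hx).2 i).1.2.le⟩,
    fun x hx => (hb x hx).1⟩
  exact ⟨a, b, ρ, h4, SB.chart hX hρ h3 (by rw [← hηε]; linarith) hε1,
    fun i => ⟨(hab i).1.trans (min_le_left _ _), (hab i).2.trans (min_le_left _ _)⟩⟩

end ChartExistence

section Dimension

variable {X : Type*} [MetricSpace X] {κ : ℝ} {k : ℕ}

lemma lipschitzWith_dist_coords (a : Fin k → X) :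
    LipschitzWith 1 fun x i => dist x (a i) :=
  LipschitzWith.of_dist_le_mul fun x y => by
    rw [NNReal.coe_one, one_mul, dist_pi_le_iff dist_nonneg]
    exact fun i => abs_dist_sub_le _ _ _

/-- If every coordinate of `dist · (a i)` can be adjusted almost independently inside a closed set
`A`, then `A` has dimension at least `k`. -/
lemma le_dimH_of_move [CompleteSpace X] {A : Set X} (hA : IsClosed A) {z : X} (hz : z ∈ A)
    (a : Fin k → X) {ρ c : ℝ} (hρ : 0 < ρ) (hc : c * k ≤ 1 / 2)
    (hm : ∀ y ∈ A ∩ ball z ρ, ∀ i, ∀ s, |s| ≤ ρ → ∃ u ∈ A, dist y u ≤ 2 * |s| ∧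
      ∀ j, |dist u (a j) - dist y (a j) - (if j = i then s else 0)| ≤ c * |s|) :
    (k : ℝ≥0∞) ≤ dimH A := by
  rcases Nat.eq_zero_or_pos k with rfl | hk
  · simp
  have hk' : (0 : ℝ) < k := Nat.cast_pos.2 hk
  have hk1 : (1 : ℝ) ≤ k := Nat.one_le_cast.2 hk
  obtain ⟨l, hl⟩ : ∃ l : ℝ, l = 1 - 1 / (2 * k) := ⟨_, rfl⟩
  have hl2 : 1 / (2 * (k : ℝ)) ≤ 1 / 2 := by
    rw [div_le_div_iff₀ (by positivity) (by norm_num)]; linarith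
  have hl0 : 0 < l := by linarith
  have hl1 : l < 1 := by
    have : (0 : ℝ) < 1 / (2 * k) := by positivity
    linarith
  have hkl : 4 * k * (1 - l) = 2 := by rw [hl]; field_simp; norm_num
  have step : ∀ v : Fin k → ℝ, ∀ y ∈ A ∩ ball z ρ, ∑ j, |v j - dist y (a j)| ≤ ρ →
      ∃ u ∈ A, dist y u ≤ 2 * ∑ j, |v j - dist y (a j)| ∧
        ∑ j, |v j - dist u (a j)| ≤ l * ∑ j, |v j - dist y (a j)| := by
    intro v y hy hv
    have : Nonempty (Fin k) := ⟨⟨0, hk⟩⟩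
    obtain ⟨i, hi⟩ := Finite.exists_max fun j => |v j - dist y (a j)|
    set S := ∑ j, |v j - dist y (a j)| with hS
    set s := v i - dist y (a i) with hs
    have h1 : S ≤ k * |s| := by
      have := Finset.sum_le_sum (s := Finset.univ) fun j _ => hi j
      simpa using this
    have h2 : |s| ≤ S := Finset.single_le_sum (f := fun j => |v j - dist y (a j)|)
      (fun j _ => abs_nonneg _) (Finset.mem_univ i)
    obtain ⟨u, hu, hyu, hF⟩ := hm y hy i s (h2.trans hv)
    refine ⟨u, hu, hyu.trans (by linarith), ?_⟩
    have h3 : ∀ j, |v j - dist u (a j)| ≤ |v j - dist y (a j)| - (if j = i then |s| else 0) +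
        c * |s| := by
      intro j
      have := hF j
      split_ifs at this ⊢ with hji
      · subst hji
        rw [show v j - dist u (a j) = -(dist u (a j) - dist y (a j) - s) by rw [hs]; ring, abs_neg]
        linarith
      · rw [show v j - dist u (a j) = (v j - dist y (a j)) - (dist u (a j) - dist y (a j) - 0) by
          ring]
        exact (abs_sub _ _).trans (by linarith)
    have h4 := Finset.sum_le_sum (s := Finset.univ) fun j _ => h3 j
    rw [Finset.sum_add_distrib, Finset.sum_sub_distrib, Finset.sum_ite_eq' Finset.univ i,
      if_pos (Finset.mem_univ i), Finset.sum_const, Finset.card_univ, Fintype.card_fin,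
      nsmul_eq_mul, ← hS] at h4
    have h5 := mul_le_mul_of_nonneg_right hc (abs_nonneg s)
    have h6 : S / (2 * k) ≤ |s| / 2 := by
      rw [div_le_div_iff₀ (by positivity) (by norm_num)]; linarith
    have h7 : l * S = S - S / (2 * k) := by rw [hl]; ring
    linarith
  have hopen : {v : Fin k → ℝ | ∑ j, |v j - dist z (a j)| < ρ / (8 * k)} ⊆
      (fun x i => dist x (a i)) '' A := by
    intro v hv
    rw [mem_ofPred_eq] at hv
    set e := ∑ j, |v j - dist z (a j)| with he
    have he0 : 0 ≤ e := Finset.sum_nonneg fun j _ => abs_nonneg _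
    have hev : 8 * k * e < ρ := by
      rw [lt_div_iff₀ (by positivity)] at hv; linarith
    have heρ : e ≤ ρ := by nlinarith
    have step' : ∀ (n : ℕ) (y : X), (y ∈ A ∧ ∑ j, |v j - dist y (a j)| ≤ l ^ n * e ∧
        dist z y ≤ 4 * k * (1 - l ^ n) * e) → ∃ u, (u ∈ A ∧
        ∑ j, |v j - dist u (a j)| ≤ l ^ (n + 1) * e ∧
        dist z u ≤ 4 * k * (1 - l ^ (n + 1)) * e) ∧ dist y u ≤ 2 * e * l ^ n := by
      rintro n y ⟨hy, h1, h2⟩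
      have p0 : 0 ≤ l ^ n := by positivity
      have p1 : l ^ n ≤ 1 := pow_le_one₀ hl0.le hl1.le
      have p2 : l ^ n * e ≤ e := by nlinarith
      have hyb : y ∈ ball z ρ := by
        rw [mem_ball, dist_comm]
        have : 4 * k * (1 - l ^ n) * e ≤ 4 * k * 1 * e := by gcongr; linarith
        have := mul_nonneg hk'.le he0
        nlinarith
      obtain ⟨u, hu, h3, h4⟩ := step v y ⟨hy, hyb⟩ (h1.trans (p2.trans heρ))
      refine ⟨u, ⟨hu, ?_, ?_⟩, by linarith⟩
      · rw [pow_succ]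
        have := mul_le_mul_of_nonneg_left h1 hl0.le
        linarith
      · have := dist_triangle z y u
        have e1 : 4 * k * (1 - l ^ (n + 1)) * e = 4 * k * (1 - l ^ n) * e +
          (4 * k * (1 - l)) * (l ^ n * e) := by ring
        rw [e1, hkl]
        linarith
    choose! g hg hg' using step'
    let Y : ℕ → X := fun n => Nat.rec z (fun n y => g n y) n
    have hY : ∀ n, Y n ∈ A ∧ ∑ j, |v j - dist (Y n) (a j)| ≤ l ^ n * e ∧
        dist z (Y n) ≤ 4 * k * (1 - l ^ n) * e := by
      intro n
      induction n with
      | zero => exact ⟨hz, by simp [Y, he], by simp [Y]⟩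
      | succ n ih => exact hg n (Y n) ih
    have hcau : CauchySeq Y := cauchySeq_of_le_geometric l (2 * e) hl1 fun n => hg' n (Y n) (hY n)
    obtain ⟨y, hy⟩ := cauchySeq_tendsto_of_complete hcau
    refine ⟨y, hA.mem_of_tendsto hy (Filter.Eventually.of_forall fun n => (hY n).1), ?_⟩
    have hlim : Filter.Tendsto (fun n => ∑ j, |v j - dist (Y n) (a j)|) Filter.atTop
        (nhds (∑ j, |v j - dist y (a j)|)) := by
      have hcont : Continuous fun x => ∑ j, |v j - dist x (a j)| := by fun_prop
      exact (hcont.tendsto y).comp hy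
    have hzero : Filter.Tendsto (fun n => l ^ n * e) Filter.atTop (nhds 0) := by
      have := (tendsto_pow_atTop_nhds_zero_of_lt_one hl0.le hl1).mul_const e
      rwa [zero_mul] at this
    have hle := le_of_tendsto_of_tendsto' hlim hzero fun n => (hY n).2.1
    have h0 := (Finset.sum_eq_zero_iff_of_nonneg fun j _ => abs_nonneg _).1
      (le_antisymm hle (Finset.sum_nonneg fun j _ => abs_nonneg _))
    funext j
    have := abs_eq_zero.1 (h0 j (Finset.mem_univ j))
    dsimp only
    linarith
  have hint : (interior ((fun x i => dist x (a i)) '' A)).Nonempty := by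
    refine ⟨fun i => dist z (a i), mem_interior.2 ⟨_, hopen, ?_, ?_⟩⟩
    · exact isOpen_lt (by fun_prop) continuous_const
    · simp only [mem_ofPred_eq, sub_self, abs_zero, Finset.sum_const_zero]
      positivity
  have := Real.dimH_of_nonempty_interior hint
  rw [Module.finrank_fin_fun] at this
  rw [← this]
  exact (lipschitzWith_dist_coords a).dimH_image_le A

/-- `u` is a nearest point of `E` to `w`, and it is critical for `dist w` unless `u = w`. -/
def IsFoot (κ : ℝ) (E : Set X) (w u : X) : Prop :=
  u ∈ E ∧ (∀ y ∈ E, dist w u ≤ dist w y) ∧ (w = u ∨ IsCriticalPt κ w u)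

lemma IsExtremal.isFoot {E : Set X} (hE : IsExtremal κ E) {w u : X} (hu : u ∈ E)
    (h : ∀ y ∈ E, dist w u ≤ dist w y) : IsFoot κ E w u := by
  refine ⟨hu, h, ?_⟩
  by_cases hw : w ∈ E
  · left
    have := h w hw
    rw [dist_self] at this
    exact dist_le_zero.1 this
  · right
    refine hE.2 w hw u hu ?_
    exact Filter.eventually_of_mem self_mem_nhdsWithin h

lemma Chart.le_dimH (hX : IsAlexandrov X κ) {a b : Fin k → X} {p : X} {ρ ε : ℝ}
    (h : Chart κ a b p ρ ε) (hε : ε * k ≤ 1 / 4) {E : Set X} (hE : IsClosed E) (hp : p ∈ E)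
    (hfoot : ∀ w ∈ ball p ρ, ∃ u, IsFoot κ E w u) : (k : ℝ≥0∞) ≤ dimH E := by
  have := hX.1
  have hρ := h.pos
  refine le_dimH_of_move hE hp a (ρ := ρ / 4) (c := 2 * ε) (by linarith) (by linarith) ?_
  rintro y ⟨hyE, hy⟩ i s hs
  rw [mem_ball] at hy
  obtain ⟨w, h1, h2, -⟩ := h.move y (by rw [mem_ball]; linarith) i s (by linarith)
  have hw : w ∈ ball p ρ := by
    have := dist_triangle_left w p y
    rw [mem_ball]; linarith
  obtain ⟨u, hu, hwu, hc⟩ := hfoot w hw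
  have h3 := hwu y hyE
  rw [dist_comm w y, h1] at h3
  have hyu : dist y u ≤ 2 * |s| := (dist_triangle y w u).trans (by linarith)
  refine ⟨u, hu, hyu, fun j => ?_⟩
  have hε0 : 0 ≤ ε * |s| := (abs_nonneg _).trans (h2 j)
  have h4 : |dist u (a j) - dist w (a j)| ≤ ε * |s| := by
    rcases hc with rfl | hc
    · simpa using hε0
    · have hu : u ∈ ball p ρ := by
        have := dist_triangle_left u p y
        rw [mem_ball]; linarith
      refine (h.crit w hw u hu hc j).trans ?_
      rcases eq_or_lt_of_le (abs_nonneg s) with h0 | h0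
      · rw [← h0] at h3
        rw [le_antisymm h3 dist_nonneg, ← h0]
      · exact mul_le_mul_of_nonneg_left h3 (nonneg_of_mul_nonneg_left hε0 h0)
  have := h2 j
  rw [show dist u (a j) - dist y (a j) - (if j = i then s else 0) =
    (dist u (a j) - dist w (a j)) + (dist w (a j) - dist y (a j) -
      (if j = i then s else 0)) by ring]
  exact (abs_add_le _ _).trans (by linarith)

lemma isFoot_univ (w : X) : IsFoot κ (univ : Set X) w w :=
  ⟨mem_univ _, fun y _ => by rw [dist_self]; exact dist_nonneg, Or.inl rfl⟩

end Dimension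

section Maximal

variable {X : Type*} [MetricSpace X] {κ η R : ℝ} {k : ℕ}

lemma IsStrainer.mono {a b : Fin k → X} {p : X} {δ δ' : ℝ} (h : IsStrainer κ a b p δ)
    (hle : δ ≤ δ') : IsStrainer κ a b p δ' :=
  ⟨fun i => lt_of_le_of_lt (by linarith) (h.1 i), fun i j hij =>
    ⟨lt_of_le_of_lt (by linarith) (h.2 i j hij).1,
      lt_of_le_of_lt (by linarith) (h.2 i j hij).2.1,
      lt_of_le_of_lt (by linarith) (h.2 i j hij).2.2⟩⟩

lemma IsStrainer.cons {a b : Fin k → X} {z x y : X} {δ : ℝ} (h : IsStrainer κ a b z δ)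
    (hxy : π - δ < cangle κ x z y)
    (hxa : ∀ j, π / 2 - δ < cangle κ x z (a j)) (hxb : ∀ j, π / 2 - δ < cangle κ x z (b j))
    (hya : ∀ j, π / 2 - δ < cangle κ y z (a j)) (hyb : ∀ j, π / 2 - δ < cangle κ y z (b j)) :
    IsStrainer κ (Fin.cons x a : Fin (k + 1) → X) (Fin.cons y b : Fin (k + 1) → X) z δ := by
  refine ⟨fun i => ?_, fun i j hij => ?_⟩
  · induction i using Fin.cases with
    | zero => simpa using hxy
    | succ i => simpa using h.1 i
  · induction i using Fin.cases with
    | zero =>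
      induction j using Fin.cases with
      | zero => exact absurd rfl hij
      | succ j => simpa using ⟨hxa j, hxb j, hyb j⟩
    | succ i =>
      induction j using Fin.cases with
      | zero =>
        simp only [Fin.cons_zero, Fin.cons_succ]
        rw [cangle_comm κ (a i), cangle_comm κ (a i), cangle_comm κ (b i)]
        exact ⟨hxa i, hya i, hyb i⟩
      | succ j =>
        simpa using h.2 i j fun hh => hij (congrArg Fin.succ hh)

/-- A strainer at a good scale can be pulled towards the strained point. -/
lemma IsStrainer.locStrained (hX : IsAlexandrov X κ) {a b : Fin k → X} {p : X} {δ : ℝ}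
    (h : IsStrainer κ a b p δ) (hne : ∀ i, a i ≠ p ∧ b i ≠ p)
    (hκ : 0 < κ → ∀ i, √κ * dist p (a i) < π ∧ √κ * dist p (b i) < π) : LocStrained κ k δ p := by
  intro r hr
  obtain ⟨t, ht, htr, htκ⟩ : ∃ t > 0, t < r ∧ (0 < κ → ∀ i,
      √κ * (t + dist p (a i)) < π ∧ √κ * (t + dist p (b i)) < π) := by
    have lim : ∀ c : X, √κ * dist p c < π →
        ∀ᶠ t in nhdsWithin (0 : ℝ) (Ioi 0), √κ * (t + dist p c) < π := fun c hc => by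
      have : Continuous fun t : ℝ => √κ * (t + dist p c) := by fun_prop
      exact nhdsWithin_le_nhds (this.continuousAt.eventually_lt_const (by simpa using hc))
    have e1 : ∀ᶠ t in nhdsWithin (0 : ℝ) (Ioi 0), 0 < κ → ∀ i,
        √κ * (t + dist p (a i)) < π ∧ √κ * (t + dist p (b i)) < π := by
      by_cases hk : 0 < κ
      · exact (Filter.eventually_all.2 fun i =>
          (lim _ (hκ hk i).1).and (lim _ (hκ hk i).2)).mono fun t ht _ => ht
      · exact Filter.Eventually.of_forall fun t h0 => absurd h0 hk
    have e2 : ∀ᶠ t in nhdsWithin (0 : ℝ) (Ioi 0), 0 < t := self_mem_nhdsWithin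
    have e3 : ∀ᶠ t in nhdsWithin (0 : ℝ) (Ioi 0), t < r :=
      nhdsWithin_le_nhds (eventually_lt_nhds hr)
    exact (e2.and (e3.and e1)).exists
  have pull : ∀ c : X, c ≠ p → ∃ c', dist p c' + dist c' c = dist p c ∧ c' ≠ p ∧ dist p c' ≤ t := by
    intro c hc
    have p1 := dist_pos.2 hc.symm
    obtain ⟨z, h1, h2⟩ := hX.exists_between p c (le_min (le_of_lt ht) p1.le) (min_le_right _ _)
    refine ⟨z, by rw [h1, h2]; ring, fun hz => ?_, h1.le.trans (min_le_left _ _)⟩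
    rw [hz, dist_self] at h1
    exact (lt_min ht p1).ne h1
  choose a' ha ha' har using fun i => pull (a i) (hne i).1
  choose b' hb hb' hbr using fun i => pull (b i) (hne i).2
  have q := Real.sqrt_nonneg κ
  have mono2 : ∀ c d c' d' : X, c' ≠ p → d' ≠ p → dist p c' + dist c' c = dist p c →
      dist p d' + dist d' d = dist p d → dist p c' ≤ t →
      (0 < κ → √κ * dist p c < π ∧ √κ * dist p d < π ∧ √κ * (t + dist p d) < π) →
      cangle κ c p d ≤ cangle κ c' p d' := fun c d c' d' hc hd h1 h2 h3 h4 =>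
    hX.cangle_le_of_between₂ h1 h2 hc hd fun hk => ⟨(h4 hk).1, (h4 hk).2.1,
      lt_of_le_of_lt (mul_le_mul_of_nonneg_left (by linarith) q) (h4 hk).2.2⟩
  refine ⟨a', b', fun i => ⟨(har i).trans htr.le, (hbr i).trans htr.le⟩, fun i =>
    (h.1 i).trans_le (mono2 _ _ _ _ (ha' i) (hb' i) (ha i) (hb i) (har i) fun hk =>
      ⟨(hκ hk i).1, (hκ hk i).2, (htκ hk i).2⟩), fun i j hij => ⟨?_, ?_, ?_⟩⟩
  · exact (h.2 i j hij).1.trans_le (mono2 _ _ _ _ (ha' i) (ha' j) (ha i) (ha j) (har i) fun hk =>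
      ⟨(hκ hk i).1, (hκ hk j).1, (htκ hk j).1⟩)
  · exact (h.2 i j hij).2.1.trans_le (mono2 _ _ _ _ (ha' i) (hb' j) (ha i) (hb j) (har i) fun hk =>
      ⟨(hκ hk i).1, (hκ hk j).2, (htκ hk j).2⟩)
  · exact (h.2 i j hij).2.2.trans_le (mono2 _ _ _ _ (hb' i) (hb' j) (hb i) (hb j) (hbr i) fun hk =>
      ⟨(hκ hk i).2, (hκ hk j).2, (htκ hk j).2⟩)

lemma GoodScale.locStrained (hX : IsAlexandrov X κ) (hG : GoodScale κ η R) {a b : Fin k → X}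
    {p : X} {δ : ℝ} (h : IsStrainer κ a b p δ) (hne : ∀ i, a i ≠ p ∧ b i ≠ p)
    (hR : ∀ i, dist p (a i) ≤ R ∧ dist p (b i) ≤ R) : LocStrained κ k δ p :=
  h.locStrained hX hne fun hk i => ⟨hG.sqrt_lt (by linarith [hG.pos, (hR i).1]) hk,
    hG.sqrt_lt (by linarith [hG.pos, (hR i).2]) hk⟩

lemma pi_div_two_sub_lt_arccos {u δ : ℝ} (hδ : 0 < δ) (hδ2 : δ ≤ π / 2) (hu : u < Real.sin δ) :
    π / 2 - δ < arccos u := by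
  have h1 : π / 2 - δ = arccos (Real.sin δ) := by
    rw [← Real.cos_pi_div_two_sub, Real.arccos_cos (by linarith) (by linarith)]
  rw [h1]
  rcases le_or_gt (-1) u with h | h
  · exact Real.strictAntiOn_arccos ⟨h, hu.le.trans (Real.sin_le_one _)⟩
      ⟨by linarith [Real.sin_nonneg_of_nonneg_of_le_pi hδ.le (by linarith [Real.pi_pos])],
        Real.sin_le_one _⟩ hu
  · rw [(arccos_eq_pi (x := u)).2 h.le, ← h1]
    linarith [Real.pi_pos]

/-- If no points near `q` are `(k + 1)`-strained then the `k`-chart is bi-Lipschitz. -/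
lemma Chart.exists_coord (hX : IsAlexandrov X κ) {a b : Fin k → X} {q : X} {ρ ε δ c : ℝ}
    (h : Chart κ a b q ρ ε) (hδ : 0 < δ) (hδ2 : δ ≤ π / 2) (hεδ : ε ≤ δ)
    (hc : c + 6 * ε < Real.sin δ) (hno : ∀ z ∈ ball q ρ, ¬ LocStrained κ (k + 1) δ z)
    {x y : X} (hx : x ∈ ball q (ρ / 2)) (hy : y ∈ ball q (ρ / 2)) (hxy : x ≠ y) :
    ∃ j, c * dist x y ≤ |dist x (a j) - dist y (a j)| := by
  by_contra! hcon
  have hρ := h.pos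
  obtain ⟨R, hG, hρR, hR⟩ := h.good
  obtain ⟨z, hz1, hz2⟩ := hX.2.1 x y
  have pd := dist_pos.2 hxy
  have hd : dist x y < ρ := by
    have := dist_triangle_right x y q
    rw [mem_ball] at hx hy
    linarith
  have sub : ball q (ρ / 2) ⊆ ball q ρ := ball_subset_ball (by linarith)
  have hzq : z ∈ ball q ρ := by
    have := dist_triangle_left z q x
    rw [mem_ball] at hx ⊢
    linarith
  have hzx : z ≠ x := by rintro rfl; rw [dist_self] at hz1; linarith
  have hzy : z ≠ y := by rintro rfl; rw [dist_self] at hz2; linarith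
  obtain ⟨d, hdd⟩ : ∃ d, d = dist x y / 2 := ⟨_, rfl⟩
  have pd' : 0 < d := by linarith
  have hε0 : 0 ≤ ε := by
    have := hG.one_add R R R hG.pos le_rfl hG.pos le_rfl (by simp [hG.pos.le])
      (by linarith [hG.pos])
    have h0 := (abs_nonneg _).trans this
    have e : 1 + crK 0 R R R = 3 / 2 := by
      rw [crK_zero]; have := hG.pos.ne'; field_simp; norm_num
    rw [e] at h0
    linarith
  have first : ∀ u v : X, u ∈ ball q (ρ / 2) → v ∈ ball q (ρ / 2) → dist u v = 2 * d →
      dist u z = d → dist z v = d → (∀ j, |dist u (a j) - dist v (a j)| ≤ 2 * c * d) → ∀ j,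
      dist u (a j) - dist z (a j) ≤ (c + 2 * ε) * d ∧
        dist u (b j) - dist z (b j) ≤ (c + 3 * ε) * d := by
    intro u v hu hv huv huz hzv hF j
    have nzu : z ≠ u := by rintro rfl; rw [dist_self] at huz; linarith
    have nvu : v ≠ u := by rintro rfl; rw [dist_self] at huv; linarith
    have hb : dist u z + dist z v = dist u v := by rw [huv, huz, hzv]; ring
    have m1 := hX.cr_mono hG hb nzu (h.ne u (sub hu) j).1 (by rw [huv]; linarith)
      (hR u (sub hu) j).1
    have m2 := hX.cr_mono hG hb nzu (h.ne u (sub hu) j).2 (by rw [huv]; linarith)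
      (hR u (sub hu) j).2
    have c1 := abs_le.1 (h.conv_a u (sub hu) z hzq nzu j)
    have c2 := abs_le.1 (h.conv_b u (sub hu) z hzq nzu j)
    have c3 := abs_le.1 (h.conv_a u (sub hu) v (sub hv) nvu j)
    have c4 := abs_le.1 (h.conv_b u (sub hu) v (sub hv) nvu j)
    have s := abs_le.1 (h.sum_le u (sub hu) v (sub hv) j)
    have f := abs_le.1 (hF j)
    rw [huz] at c1 c2
    rw [huv] at c3 c4 s
    have g3 : (dist u (a j) - dist v (a j)) / (2 * d) ≤ c := by
      rw [div_le_iff₀ (by linarith)]; linarith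
    have g4 : (dist u (b j) - dist v (b j)) / (2 * d) ≤ c + ε := by
      rw [div_le_iff₀ (by linarith)]; linarith
    constructor
    · rw [← div_le_iff₀ pd']; linarith
    · rw [← div_le_iff₀ pd']; linarith
  have second : ∀ u v : X, u ∈ ball q (ρ / 2) → v ∈ ball q (ρ / 2) → dist u v = 2 * d →
      dist u z = d → dist z v = d → (∀ j, |dist u (a j) - dist v (a j)| ≤ 2 * c * d) → ∀ j,
      π / 2 - δ < cangle κ u z (a j) ∧ π / 2 - δ < cangle κ u z (b j) := by
    intro u v hu hv huv huz hzv hF j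
    have nuz : u ≠ z := by rintro rfl; rw [dist_self] at huz; linarith
    have f := first u v hu hv huv huz hzv hF j
    have s := abs_le.1 (h.sum_le u (sub hu) z hzq j)
    rw [huz] at s
    have c1 := abs_le.1 (h.conv_a z hzq u (sub hu) nuz j)
    have c2 := abs_le.1 (h.conv_b z hzq u (sub hu) nuz j)
    rw [dist_comm z u, huz] at c1 c2
    have g1 : (dist z (a j) - dist u (a j)) / d ≤ c + 4 * ε := by
      rw [div_le_iff₀ pd']; linarith
    have g2 : (dist z (b j) - dist u (b j)) / d ≤ c + 3 * ε := by
      rw [div_le_iff₀ pd']; linarith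
    rw [cangle_eq, cangle_eq]
    exact ⟨pi_div_two_sub_lt_arccos hδ hδ2 (by linarith),
      pi_div_two_sub_lt_arccos hδ hδ2 (by linarith)⟩
  have fx := second x y hx hy (by linarith) (by linarith) (by linarith)
    fun j => (hcon j).le.trans (by rw [hdd]; linarith)
  have fy := second y x hy hx (by rw [dist_comm]; linarith) (by rw [dist_comm]; linarith)
    (by rw [dist_comm]; linarith) fun j => by
      rw [abs_sub_comm]; exact (hcon j).le.trans (by rw [hdd]; linarith)
  have hst := ((h.str z hzq).mono hεδ).cons (x := x) (y := y)
    (by rw [hG.cangle_eq_pi (by rw [hz1, hz2]; ring) hzx.symm hzy.symm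
          (by rw [dist_comm]; linarith) (by linarith)]; linarith)
    (fun j => (fx j).1) (fun j => (fx j).2) (fun j => (fy j).1) (fun j => (fy j).2)
  refine hno z hzq (hG.locStrained hX hst (fun i => ?_) fun i => ?_)
  · induction i using Fin.cases with
    | zero => simpa using ⟨hzx.symm, hzy.symm⟩
    | succ i => simpa using h.ne z hzq i
  · induction i using Fin.cases with
    | zero =>
      simp only [Fin.cons_zero]
      exact ⟨by rw [dist_comm]; linarith, by linarith⟩
    | succ i => simpa using hR z hzq i

/-- The geodesic homothety with centre `q` does not contract much more than its ratio. -/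
lemma IsAlexandrov.homothety (hX : IsAlexandrov X κ) (hG : GoodScale κ (1 / 3) R)
    {q x₁ x₂ y₁ y₂ : X} {l : ℝ} (hl : 0 < l) (h₁ : dist q y₁ = l * dist q x₁)
    (h₂ : dist q y₂ = l * dist q x₂) (h₁' : dist q y₁ + dist y₁ x₁ = dist q x₁)
    (h₂' : dist q y₂ + dist y₂ x₂ = dist q x₂) (hR₁ : dist q x₁ ≤ R) (hR₂ : dist q x₂ ≤ R) :
    l ^ 2 * dist x₁ x₂ ^ 2 ≤ 2 * dist y₁ y₂ ^ 2 := by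
  have zero : ∀ x y : X, dist q y = l * dist q x → x = q → y = q := by
    rintro x y h rfl
    rw [dist_self, mul_zero] at h
    exact (dist_le_zero.1 h.le).symm
  rcases eq_or_ne x₁ q with hx | hx₁
  · rw [hx, zero x₁ y₁ h₁ hx, h₂]
    nlinarith [sq_nonneg (l * dist q x₂)]
  rcases eq_or_ne x₂ q with hx | hx₂
  · rw [hx, zero x₂ y₂ h₂ hx, dist_comm x₁, dist_comm y₁, h₁]
    nlinarith [sq_nonneg (l * dist q x₁)]
  have p₁ := dist_pos.2 hx₁.symm
  have p₂ := dist_pos.2 hx₂.symm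
  have q₁ : 0 < dist q y₁ := by rw [h₁]; positivity
  have q₂ : 0 < dist q y₂ := by rw [h₂]; positivity
  have hy₁ : y₁ ≠ q := (dist_pos.1 q₁).symm
  have hy₂ : y₂ ≠ q := (dist_pos.1 q₂).symm
  have n₁ : 0 ≤ dist y₁ x₁ := dist_nonneg
  have n₂ : 0 ≤ dist y₂ x₂ := dist_nonneg
  have m1 := hX.cr_mono hG h₁' hy₁ hx₂ hR₁ hR₂
  have m2 := hX.cr_mono hG h₂' hy₂ hy₁ hR₂ (by linarith)
  rw [cr_comm κ x₂, cr_comm κ y₂] at m2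
  have tri : ∀ u v : X, |dist q u - dist q v| ≤ dist u v ∧ dist u v ≤ dist q u + dist q v :=
    fun u v => ⟨abs_dist_sub_le' _ _ _, by rw [dist_comm q u]; exact dist_triangle _ _ _⟩
  have o1 := hG.one_sub _ _ _ p₁ hR₁ p₂ hR₂ (tri _ _).1 (tri _ _).2
  have o2 := hG.one_sub _ _ _ q₁ (by linarith) q₂ (by linarith) (tri _ _).1 (tri _ _).2
  change |(1 - cr κ x₁ q x₂) - (1 - cr 0 x₁ q x₂)| ≤ 1 / 3 * (1 - cr 0 x₁ q x₂) at o1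
  change |(1 - cr κ y₁ q y₂) - (1 - cr 0 y₁ q y₂)| ≤ 1 / 3 * (1 - cr 0 y₁ q y₂) at o2
  have o1' := abs_le.1 o1
  have o2' := abs_le.1 o2
  have key : 1 - cr 0 x₁ q x₂ ≤ 2 * (1 - cr 0 y₁ q y₂) := by linarith
  rw [dist_sq_eq hx₁ hx₂, dist_sq_eq hy₁ hy₂, h₁, h₂]
  have e1 := mul_le_mul_of_nonneg_left key (show 0 ≤ 2 * (l ^ 2 * (dist q x₁ * dist q x₂)) by
    positivity)
  nlinarith [sq_nonneg (l * (dist q x₁ - dist q x₂))]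

end Maximal

section Packing

variable {X : Type*} [MetricSpace X] {κ : ℝ} {k : ℕ}

lemma card_le_of_coords {α : Type*} (T : Finset α) (F : α → Fin k → ℝ) (v : Fin k → ℝ) {t σ : ℝ}
    (hσ : 0 < σ) (ht : ∀ x ∈ T, ∀ j, |F x j - v j| ≤ t)
    (hsep : ∀ x ∈ T, ∀ y ∈ T, x ≠ y → ∃ j, σ ≤ |F x j - F y j|) :
    T.card ≤ (⌊2 * t / σ⌋₊ + 1) ^ k := by
  have := Finset.card_le_card_of_injOn (s := T)
    (t := Fintype.piFinset fun _ : Fin k => Finset.range (⌊2 * t / σ⌋₊ + 1))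
    (fun x j => ⌊(F x j - v j + t) / σ⌋₊) (fun x hx => ?_) fun x hx y hy hxy => ?_
  · simpa using this
  · simp only [Fintype.coe_piFinset, Set.mem_pi, Finset.coe_range, mem_univ, mem_Iio, forall_const]
    intro j
    have := abs_le.1 (ht x hx j)
    exact Nat.lt_succ_of_le (Nat.floor_le_floor (by gcongr; linarith))
  · by_contra hne
    obtain ⟨j, hj⟩ := hsep x hx y hy hne
    have e := congrFun hxy j
    dsimp only at e
    have h1 := abs_le.1 (ht x hx j)
    have h2 := abs_le.1 (ht y hy j)
    have n1 : 0 ≤ (F x j - v j + t) / σ := div_nonneg (by linarith) hσ.le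
    have n2 : 0 ≤ (F y j - v j + t) / σ := div_nonneg (by linarith) hσ.le
    have f1 := Nat.floor_le n1
    have f2 := Nat.floor_le n2
    have g1 := Nat.lt_floor_add_one ((F x j - v j + t) / σ)
    have g2 := Nat.lt_floor_add_one ((F y j - v j + t) / σ)
    rw [e] at f1 g1
    have : |(F x j - v j + t) / σ - (F y j - v j + t) / σ| < 1 := by
      rw [abs_lt]; constructor <;> linarith
    rw [← sub_div, abs_div, abs_of_pos hσ, div_lt_one hσ] at this
    rw [show F x j - v j + t - (F y j - v j + t) = F x j - F y j by ring] at this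
    linarith

lemma LocStrained.mono {δ δ' : ℝ} {p : X} (h : LocStrained κ k δ p) (hle : δ ≤ δ') :
    LocStrained κ k δ' p := fun r hr => by
  obtain ⟨a, b, h1, h2⟩ := h r hr
  exact ⟨a, b, h1, h2.mono hle⟩

/-- The maximal strainer number near a point of a finite-dimensional space. -/
lemma IsAlexandrov.exists_strainer_number (hX : IsAlexandrov X κ) {n : ℕ}
    (hdim : dimH (Set.univ : Set X) = n) (p : X) :
    ∃ (K : ℕ) (δ r : ℝ), 0 < δ ∧ δ ≤ π / 2 ∧ 0 < r ∧
      (∀ δ' > 0, ∀ r' > 0, ∃ z ∈ ball p r', LocStrained κ K δ' z) ∧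
      ∀ z ∈ ball p r, ¬ LocStrained κ (K + 1) δ z := by
  have bound : ∀ k : ℕ, (∀ δ' > (0 : ℝ), ∀ r' > (0 : ℝ), ∃ z ∈ ball p r', LocStrained κ k δ' z) →
      k ≤ n := by
    intro k hk
    have p1 : (0 : ℝ) < 1 / (4 * (k + 1)) := by positivity
    have p2 : 1 / (4 * ((k : ℝ) + 1)) ≤ 1 := by
      rw [div_le_one (by positivity)]
      have : (0 : ℝ) ≤ k := Nat.cast_nonneg k
      linarith
    obtain ⟨δ, hδ, H⟩ := exists_chart hX k p1 p2
    obtain ⟨z, -, hz⟩ := hk δ hδ 1 one_pos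
    obtain ⟨a, b, ρ, -, hch, -⟩ := H z hz 1 one_pos
    have := hch.le_dimH hX (by
      rw [div_mul_eq_mul_div, div_le_div_iff₀ (by positivity) (by norm_num)]; linarith)
      isClosed_univ (mem_univ z) fun w _ => ⟨w, isFoot_univ w⟩
    rw [hdim] at this
    exact_mod_cast this
  by_contra! hcon
  have all : ∀ k : ℕ, ∀ δ' > (0 : ℝ), ∀ r' > (0 : ℝ), ∃ z ∈ ball p r', LocStrained κ k δ' z := by
    intro k
    induction k with
    | zero =>
      intro δ' _ r' hr'
      exact ⟨p, mem_ball_self hr', fun r _ => ⟨Fin.elim0, Fin.elim0, fun i => i.elim0,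
        fun i => i.elim0, fun i => i.elim0⟩⟩
    | succ k ih =>
      intro δ' hδ' r' hr'
      obtain ⟨z, hz, hs⟩ := hcon k (min δ' (π / 2)) r' (lt_min hδ' (by positivity))
        (min_le_right _ _) hr' ih
      exact ⟨z, hz, hs.mono (min_le_left _ _)⟩
  exact absurd (bound (n + 1) (all _)) (by omega)

/-- Uniform packing bounds at all small scales around a point. -/
lemma IsAlexandrov.exists_packing (hX : IsAlexandrov X κ) {n : ℕ}
    (hdim : dimH (Set.univ : Set X) = n) (p : X) :
    ∃ ρ₀ > 0, ∀ c > 0, ∃ N : ℕ, ∀ ρ, 0 < ρ → ρ ≤ ρ₀ → ∀ T : Finset X, (∀ x ∈ T, dist p x ≤ ρ) →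
      (∀ x ∈ T, ∀ y ∈ T, x ≠ y → c * ρ ≤ dist x y) → T.card ≤ N := by
  obtain ⟨K, δ, r, hδ, hδ2, hr, hK, hno⟩ := hX.exists_strainer_number hdim p
  obtain ⟨R, hG⟩ := exists_goodScale κ (η := 1 / 3) (by norm_num)
  have hR := hG.pos
  have hs : 0 < Real.sin δ := Real.sin_pos_of_pos_of_lt_pi hδ (by linarith [Real.pi_pos])
  have hs1 := Real.sin_le_one δ
  obtain ⟨ε, hε⟩ : ∃ ε, ε = min δ (Real.sin δ / 10) := ⟨_, rfl⟩
  have hε0 : 0 < ε := by rw [hε]; exact lt_min hδ (by positivity)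
  have hε1 : ε ≤ δ := hε.le.trans (min_le_left _ _)
  have hε2 : ε ≤ Real.sin δ / 10 := hε.le.trans (min_le_right _ _)
  obtain ⟨δ', hδ', H⟩ := exists_chart hX K hε0 (by linarith)
  obtain ⟨c₀, hc₀⟩ : ∃ c₀, c₀ = Real.sin δ / 4 := ⟨_, rfl⟩
  have pc₀ : 0 < c₀ := by rw [hc₀]; positivity
  refine ⟨R / 4, by positivity, fun c hc => ⟨(⌊8 / (c₀ * c)⌋₊ + 1) ^ K, ?_⟩⟩
  intro ρ hρ hρR T hT hsep
  obtain ⟨q, hq, hqs⟩ := hK δ' hδ' (min (r / 2) ρ) (lt_min (by positivity) hρ)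
  rw [mem_ball, lt_min_iff] at hq
  obtain ⟨a, b, ρq, hρq, hch, -⟩ := H q hqs (r / 2) (by positivity)
  have pρq := hch.pos
  have hTq : ∀ x ∈ T, dist q x ≤ 2 * ρ := fun x hx => by
    have := hT x hx
    have := dist_triangle q p x
    linarith
  obtain ⟨l, hl⟩ : ∃ l, l = min 1 (ρq / (8 * ρ)) := ⟨_, rfl⟩
  have hl0 : 0 < l := by rw [hl]; exact lt_min one_pos (by positivity)
  have hl1 : l ≤ 1 := hl.le.trans (min_le_left _ _)
  have hl2 : l * ρ ≤ ρq / 8 := by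
    have : l ≤ ρq / (8 * ρ) := hl.le.trans (min_le_right _ _)
    rw [le_div_iff₀ (by positivity)] at this
    linarith
  have hpt : ∀ x : X, ∃ y, dist q y = l * dist q x ∧ dist q y + dist y x = dist q x := by
    intro x
    have h0 : 0 ≤ dist q x := dist_nonneg
    obtain ⟨y, h1, h2⟩ := hX.exists_between q x (mul_nonneg hl0.le h0)
      (mul_le_of_le_one_left h0 hl1)
    exact ⟨y, h1, by rw [h1, h2]; ring⟩
  choose Y hY1 hY2 using hpt
  have hYd : ∀ x ∈ T, dist q (Y x) ≤ 2 * (l * ρ) := fun x hx => by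
    rw [hY1]
    have := mul_le_mul_of_nonneg_left (hTq x hx) hl0.le
    linarith
  have hYb : ∀ x ∈ T, Y x ∈ ball q (ρq / 2) := fun x hx => by
    have := hYd x hx
    rw [mem_ball, dist_comm]; linarith
  have plc : 0 < l * c * ρ := by positivity
  have hYs : ∀ x ∈ T, ∀ y ∈ T, x ≠ y → l * c * ρ / 2 ≤ dist (Y x) (Y y) := by
    intro x hx y hy hxy
    have h1 := hX.homothety hG hl0 (hY1 x) (hY1 y) (hY2 x) (hY2 y)
      ((hTq x hx).trans (by linarith)) ((hTq y hy).trans (by linarith))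
    have h2 := mul_le_mul_of_nonneg_left (hsep x hx y hy hxy) hl0.le
    have h3 : 0 ≤ dist (Y x) (Y y) := dist_nonneg
    by_contra! hlt
    nlinarith
  have hcard := card_le_of_coords T (fun x j => dist (Y x) (a j)) (fun j => dist q (a j))
    (t := 2 * (l * ρ)) (σ := c₀ * (l * c * ρ / 2)) (by positivity) (fun x hx j => by
      rw [abs_sub_comm]; exact (abs_dist_sub_le _ _ _).trans (hYd x hx))
    fun x hx y hy hxy => by
      have hs := hYs x hx y hy hxy
      have hne : Y x ≠ Y y := fun h => by rw [h, dist_self] at hs; linarith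
      obtain ⟨j, hj⟩ := hch.exists_coord hX hδ hδ2 hε1 (c := c₀) (by linarith)
        (fun z hz => hno z (by
          rw [mem_ball] at hz ⊢
          have := dist_triangle z q p
          linarith)) (hYb x hx) (hYb y hy) hne
      exact ⟨j, (mul_le_mul_of_nonneg_left hs pc₀.le).trans hj⟩
  have e : 2 * (2 * (l * ρ)) / (c₀ * (l * c * ρ / 2)) = 8 / (c₀ * c) := by
    field_simp; norm_num
  rwa [e] at hcard

lemma isCompact_closedBall_of_packing [CompleteSpace X] {p : X} {ρ : ℝ} (hρ : 0 < ρ)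
    (h : ∀ c > 0, ∃ N : ℕ, ∀ T : Finset X, (∀ x ∈ T, dist p x ≤ ρ) →
      (∀ x ∈ T, ∀ y ∈ T, x ≠ y → c * ρ ≤ dist x y) → T.card ≤ N) :
    IsCompact (closedBall p ρ) := by
  refine isCompact_iff_totallyBounded_isComplete.2 ⟨?_, isClosed_closedBall.isComplete⟩
  rw [Metric.totallyBounded_iff]
  intro ε hε
  by_contra! hcon
  obtain ⟨N, hN⟩ := h (ε / ρ) (by positivity)
  rw [div_mul_cancel₀ _ hρ.ne'] at hN
  have all : ∀ n : ℕ, ∃ T : Finset X, T.card = n ∧ (∀ x ∈ T, dist p x ≤ ρ) ∧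
      ∀ x ∈ T, ∀ y ∈ T, x ≠ y → ε ≤ dist x y := by
    classical
    intro n
    induction n with
    | zero => exact ⟨∅, by simp⟩
    | succ n ih =>
      obtain ⟨T, h1, h2, h3⟩ := ih
      obtain ⟨x, hx, hxT⟩ := Set.not_subset.1 (hcon T T.finite_toSet)
      simp only [mem_iUnion, not_exists, mem_ball, not_lt, Finset.mem_coe] at hxT
      refine ⟨insert x T, ?_, ?_, ?_⟩
      · rw [Finset.card_insert_of_notMem, h1]
        intro hm
        have := hxT x hm
        rw [dist_self] at this
        linarith
      · intro y hy
        rcases Finset.mem_insert.1 hy with rfl | hy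
        · rw [dist_comm]; exact hx
        · exact h2 y hy
      · intro y hy z hz hyz
        rcases Finset.mem_insert.1 hy with rfl | hyT <;>
          rcases Finset.mem_insert.1 hz with rfl | hzT
        · exact absurd rfl hyz
        · exact hxT z hzT
        · rw [dist_comm]; exact hxT y hyT
        · exact h3 y hyT z hzT hyz
  obtain ⟨T, h1, h2, h3⟩ := all (N + 1)
  have := hN T h2 h3
  omega

lemma IsExtremal.exists_isFoot {E : Set X} (hE : IsExtremal κ E) {p : X} (hp : p ∈ E) {ρ : ℝ}
    (hc : IsCompact (closedBall p ρ)) {w : X} (hw : w ∈ ball p (ρ / 2)) : ∃ u, IsFoot κ E w u := by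
  rw [mem_ball] at hw
  have pρ : 0 ≤ dist w p := dist_nonneg
  have hpm : p ∈ closedBall p ρ ∩ E := ⟨mem_closedBall_self (by linarith), hp⟩
  obtain ⟨u, hu, hmin⟩ := (hc.inter_right hE.1).exists_isMinOn ⟨p, hpm⟩
    (f := fun x => dist w x) (by fun_prop)
  refine ⟨u, hE.isFoot hu.2 fun y hy => ?_⟩
  by_cases hyb : y ∈ closedBall p ρ
  · exact hmin ⟨hyb, hy⟩
  · have h1 : dist w u ≤ dist w p := hmin hpm
    rw [mem_closedBall, not_le] at hyb
    have := dist_triangle_left y p w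
    linarith

end Packing

section MoveExtremal

variable {X : Type*} [MetricSpace X] {κ : ℝ} {k : ℕ} {a b : Fin k → X} {p : X} {ρ ε : ℝ}
  {E : Set X}

lemma abs_defect_sub_le_dist (a : Fin k → X) (x q z : X) :
    |defect a x z - defect a x q| ≤ (k + 1) * (dist q z * (dist x q + dist x z)) := by
  have key : ∀ u v : ℝ, |u| ≤ dist x q → |v| ≤ dist x z → |u - v| ≤ dist q z →
      |u ^ 2 - v ^ 2| ≤ dist q z * (dist x q + dist x z) := by
    intro u v hu hv huv
    rw [sq_sub_sq, mul_comm, abs_mul]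
    exact mul_le_mul huv ((abs_add_le _ _).trans (add_le_add hu hv)) (abs_nonneg _) dist_nonneg
  have h1 : |dist x q ^ 2 - dist x z ^ 2| ≤ dist q z * (dist x q + dist x z) :=
    key _ _ (abs_of_nonneg dist_nonneg).le (abs_of_nonneg dist_nonneg).le (abs_dist_sub_le' _ _ _)
  have h2 : |∑ i, ((dist x (a i) - dist q (a i)) ^ 2 - (dist x (a i) - dist z (a i)) ^ 2)| ≤
      k * (dist q z * (dist x q + dist x z)) := by
    refine (Finset.abs_sum_le_sum_abs _ _).trans ?_
    have := Finset.sum_le_sum (s := Finset.univ) fun i (_ : i ∈ Finset.univ) =>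
      key (dist x (a i) - dist q (a i)) (dist x (a i) - dist z (a i)) (abs_dist_sub_le _ _ _)
        (abs_dist_sub_le _ _ _) (by
          rw [sub_sub_sub_cancel_left, dist_comm q z]; exact abs_dist_sub_le _ _ _)
    simpa using this
  rw [Finset.sum_sub_distrib] at h2
  rw [abs_le] at h1 h2 ⊢
  unfold defect
  constructor <;> linarith [h1.1, h1.2, h2.1, h2.2]

lemma Chart.nonneg (h : Chart κ a b p ρ ε) : 0 ≤ ε := by
  obtain ⟨R, hG, -, -⟩ := h.good
  have := hG.one_add R R R hG.pos le_rfl hG.pos le_rfl (by simp [hG.pos.le]) (by linarith [hG.pos])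
  have h0 := (abs_nonneg _).trans this
  have e : 1 + crK 0 R R R = 3 / 2 := by
    rw [crK_zero]; have := hG.pos.ne'; field_simp; norm_num
  rw [e] at h0
  linarith

/-- Moving a point in a coordinate direction hardly increases its distance to an extremal set. -/
lemma Chart.foot_step (h : Chart κ a b p ρ ε) (hε1 : ε ≤ 1)
    (hfoot : ∀ w ∈ ball p ρ, ∃ u, IsFoot κ E w u) {q z q' : X} {σ : ℝ} (i : Fin k)
    (hqz : IsFoot κ E q z) (hq : dist p q + |σ| < ρ) (hz : dist p z + 2 * |σ| < ρ)
    (hd : dist q q' = |σ|)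
    (hF : ∀ j, |dist q' (a j) - dist q (a j) - (if j = i then σ else 0)| ≤ ε * |σ|)
    (hQ : ∀ w ∈ ball p ρ, |defect a w q' - defect a w q| ≤ ε * (|σ| * (dist w q + |σ|))) :
    ∃ z', IsFoot κ E q' z' ∧ dist q' z' ^ 2 ≤ dist q z ^ 2 + (7 + 25 * k) * |σ| ^ 2 +
      (3 + 10 * k) * (ε * (|σ| * dist q z)) := by
  have hε0 := h.nonneg
  have hρ := h.pos
  have hσ := abs_nonneg σ
  have hq' : q' ∈ ball p ρ := by
    have := dist_triangle p q q'
    rw [mem_ball, dist_comm]; linarith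
  have hqb : q ∈ ball p ρ := by rw [mem_ball, dist_comm]; linarith
  have hzb : z ∈ ball p ρ := by rw [mem_ball, dist_comm]; linarith
  obtain ⟨z', hz'⟩ := hfoot q' hq'
  have p0 : 0 ≤ dist p z := dist_nonneg
  obtain ⟨w, w1, w2, -⟩ := h.move z hzb i σ (by linarith)
  have hwb : w ∈ ball p ρ := by
    have := dist_triangle p z w
    rw [mem_ball, dist_comm]; linarith
  obtain ⟨u, hu⟩ := hfoot w hwb
  have wu : dist w u ≤ |σ| := by
    have := hu.2.1 z hqz.1
    rwa [dist_comm w z, w1] at this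
  have zu : dist z u ≤ 2 * |σ| := (dist_triangle z w u).trans (by linarith)
  have hub : u ∈ ball p ρ := by
    have := dist_triangle p z u
    rw [mem_ball, dist_comm]; linarith
  refine ⟨z', hz', (pow_le_pow_left₀ dist_nonneg (hz'.2.1 u hu.1) 2).trans ?_⟩
  have d0 : 0 ≤ dist q z := dist_nonneg
  have d1 : 0 ≤ dist z u := dist_nonneg
  have hqu : dist q u ^ 2 ≤ dist q z ^ 2 + 4 * |σ| ^ 2 + 2 * (ε * (|σ| * dist q z)) := by
    have m1 : dist z u ^ 2 ≤ 4 * |σ| ^ 2 := by nlinarith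
    rcases hqz.2.2 with rfl | hc
    · rw [dist_self]; linarith
    · have m2 : ε * (dist q z * dist z u) ≤ 2 * (ε * (|σ| * dist q z)) := by
        have := mul_le_mul_of_nonneg_left zu (mul_nonneg hε0 d0)
        linarith
      linarith [h.hinge q hqb z hzb u hub hc]
  have hFqz : ∀ j, |dist q (a j) - dist z (a j)| ≤ ε * dist q z := by
    intro j
    rcases hqz.2.2 with rfl | hc
    · simp
    · rw [abs_sub_comm]; exact h.crit q hqb z hzb hc j
  have hFwu : ∀ j, |dist u (a j) - dist w (a j)| ≤ ε * |σ| := by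
    intro j
    rcases hu.2.2 with hwu | hc
    · rw [hwu, sub_self, abs_zero]; positivity
    · exact (h.crit w hwb u hub hc j).trans (mul_le_mul_of_nonneg_left wu hε0)
  have hsq : ∀ j, (dist q' (a j) - dist u (a j)) ^ 2 - (dist q (a j) - dist u (a j)) ^ 2 ≤
      10 * (ε * (|σ| * dist q z)) + 25 * |σ| ^ 2 := by
    intro j
    obtain ⟨β, hβ⟩ : ∃ β, β = dist q' (a j) - dist u (a j) := ⟨_, rfl⟩
    obtain ⟨α, hα⟩ : ∃ α, α = dist q (a j) - dist u (a j) := ⟨_, rfl⟩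
    obtain ⟨g, hg⟩ : ∃ g, g = dist q (a j) - dist z (a j) := ⟨_, rfl⟩
    have e1 := abs_le.1 (hF j)
    have e2 := abs_le.1 (w2 j)
    have e3 := abs_le.1 (hFwu j)
    have e4 : |g| ≤ ε * dist q z := by rw [hg]; exact hFqz j
    have e5 := abs_le.1 ((abs_dist_sub_le z u (a j)).trans zu)
    have εσ : ε * |σ| ≤ |σ| := mul_le_of_le_one_left hσ hε1
    have b1 : |β - g| ≤ 3 * |σ| := by
      rw [abs_le, hβ, hg]
      constructor <;> linarith [e1.1, e1.2, e2.1, e2.2, e3.1, e3.2]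
    have b2 : |α - g| ≤ 2 * |σ| := by
      rw [abs_le, hα, hg]
      constructor <;> linarith [e5.1, e5.2]
    have b3 : |β - α| ≤ 5 * |σ| := by
      rw [show β - α = (β - g) - (α - g) by ring]
      exact (abs_sub _ _).trans (by linarith)
    have b4 : |β + α| ≤ 2 * (ε * dist q z) + 5 * |σ| := by
      rw [show β + α = (β - g) + (α - g) + 2 * g by ring]
      refine (abs_add_three _ _ _).trans ?_
      rw [abs_mul, abs_two]
      linarith
    rw [← hβ, ← hα, sq_sub_sq, mul_comm]
    refine (le_abs_self _).trans ?_
    rw [abs_mul]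
    refine (mul_le_mul b3 b4 (abs_nonneg _) (by positivity)).trans ?_
    apply le_of_eq; ring
  have hsum : ∑ j, (dist q' (a j) - dist u (a j)) ^ 2 - ∑ j, (dist q (a j) - dist u (a j)) ^ 2 ≤
      k * (10 * (ε * (|σ| * dist q z)) + 25 * |σ| ^ 2) := by
    rw [← Finset.sum_sub_distrib]
    have := Finset.sum_le_sum (s := Finset.univ) fun j (_ : j ∈ Finset.univ) => hsq j
    rwa [Finset.sum_const, Finset.card_univ, Fintype.card_fin, nsmul_eq_mul] at this
  have hQu := (abs_le.1 (hQ u hub)).2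
  rw [defect_comm a u q', defect_comm a u q] at hQu
  have huq : ε * (|σ| * (dist u q + |σ|)) ≤ ε * (|σ| * dist q z) + 3 * |σ| ^ 2 := by
    have := dist_triangle u z q
    rw [dist_comm u z, dist_comm z q] at this
    have h1 : ε * (|σ| * (dist u q + |σ|)) ≤ ε * (|σ| * (dist q z + 3 * |σ|)) :=
      mul_le_mul_of_nonneg_left (mul_le_mul_of_nonneg_left (by linarith) hσ) hε0
    have h2 : ε * (3 * |σ| ^ 2) ≤ 3 * |σ| ^ 2 := mul_le_of_le_one_left (by positivity) hε1
    linarith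
  unfold defect at hQu
  linarith

lemma Chart.foot_steps (h : Chart κ a b p ρ ε) (hε1 : ε ≤ 1)
    (hfoot : ∀ w ∈ ball p ρ, ∃ u, IsFoot κ E w u) {y : X} (hyE : y ∈ E) (hy : y ∈ ball p (ρ / 4))
    (i : Fin k) {σ : ℝ} {N : ℕ} (hN : N * |σ| ≤ ρ / 8) (n : ℕ) (hn : n ≤ N) :
    ∃ q z, IsFoot κ E q z ∧ dist y q ≤ n * |σ| ∧
      (∀ j, |dist q (a j) - dist y (a j) - (if j = i then n * σ else 0)| ≤ n * (ε * |σ|)) ∧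
      (∀ w ∈ ball p ρ, |defect a w q - defect a w y| ≤
        ε * (n * |σ| * (dist w y + n * |σ|))) ∧
      dist q z ^ 2 ≤ n * ((7 + 25 * k) * |σ| ^ 2 + (3 + 10 * k) * (ε * (|σ| * (N * |σ|)))) := by
  have hε0 := h.nonneg
  have hρ := h.pos
  have hσ := abs_nonneg σ
  induction n with
  | zero => exact ⟨y, y, ⟨hyE, fun y' _ => by rw [dist_self]; exact dist_nonneg, Or.inl rfl⟩,
      by simp⟩
  | succ n ih =>
    obtain ⟨q, z, hqz, h1, h2, h3, h4⟩ := ih (by omega)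
    have nN : ((n + 1 : ℕ) : ℝ) * |σ| ≤ N * |σ| := by gcongr
    push_cast at nN ⊢
    have nσ : 0 ≤ n * |σ| := by positivity
    rw [mem_ball, dist_comm] at hy
    have pq : dist p q ≤ dist p y + n * |σ| := (dist_triangle p y q).trans (by linarith)
    have qz : dist q z ≤ n * |σ| := (hqz.2.1 y hyE).trans (by rwa [dist_comm])
    have pz := dist_triangle p q z
    have hqb : q ∈ ball p ρ := by rw [mem_ball, dist_comm]; linarith
    obtain ⟨q', q1, q2, q3⟩ := h.move q hqb i σ (by linarith)
    obtain ⟨z', hz', hd⟩ := h.foot_step hε1 hfoot i hqz (by linarith) (by linarith) q1 q2 q3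
    refine ⟨q', z', hz', ?_, fun j => ?_, fun w hw => ?_, ?_⟩
    · linarith [dist_triangle y q q']
    · have e : dist q' (a j) - dist y (a j) - (if j = i then ((n : ℝ) + 1) * σ else 0) =
        (dist q' (a j) - dist q (a j) - (if j = i then σ else 0)) +
        (dist q (a j) - dist y (a j) - (if j = i then n * σ else 0)) := by
        split_ifs <;> ring
      rw [e]
      exact (abs_add_le _ _).trans (by linarith [q2 j, h2 j])
    · have e : defect a w q' - defect a w y =
        (defect a w q' - defect a w q) + (defect a w q - defect a w y) := by ring
      rw [e]
      refine (abs_add_le _ _).trans ((add_le_add (q3 w hw) (h3 w hw)).trans ?_)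
      have wq : dist w q ≤ dist w y + n * |σ| := (dist_triangle w y q).trans (by linarith)
      have m1 : ε * (|σ| * (dist w q + |σ|)) ≤ ε * (|σ| * (dist w y + n * |σ| + |σ|)) := by
        gcongr
      have m2 : ε * (n * |σ| * (dist w y + n * |σ|)) ≤
          ε * (n * |σ| * (dist w y + n * |σ| + |σ|)) :=
        mul_le_mul_of_nonneg_left (mul_le_mul_of_nonneg_left (by linarith) nσ) hε0
      linarith
    · have m : (3 + 10 * k) * (ε * (|σ| * dist q z)) ≤
          (3 + 10 * k) * (ε * (|σ| * (N * |σ|))) := by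
        gcongr; linarith
      linarith

/-- Points of an extremal set can be moved inside the set along the coordinates. -/
lemma Chart.move_extremal (h : Chart κ a b p ρ ε) (hε : 0 < ε) (hε1 : ε ≤ 1) {τ : ℝ} (hτ : 0 < τ)
    (hτ1 : τ ≤ 1)
    (hετ : 36 * (k + 1) ^ 2 * ((4 + 10 * k) * ε) ≤ (τ / 2) ^ 2)
    (hfoot : ∀ w ∈ ball p ρ, ∃ u, IsFoot κ E w u) {y : X} (hyE : y ∈ E) (hy : y ∈ ball p (ρ / 4))
    (i : Fin k) {s : ℝ} (hs : |s| ≤ ρ / 8) :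
    ∃ z ∈ E, dist y z ≤ 2 * |s| ∧
      (∀ j, |dist z (a j) - dist y (a j) - (if j = i then s else 0)| ≤ τ * |s|) ∧
      ∀ w ∈ ball p ρ, |defect a w z - defect a w y| ≤ τ * (|s| * (dist w y + |s|)) := by
  have hs0 := abs_nonneg s
  obtain ⟨N, hN⟩ := exists_nat_gt ((7 + 25 * k) / ε)
  have hN0 : (0 : ℝ) < N := lt_trans (by positivity) hN
  rw [div_lt_iff₀ hε] at hN
  have hNs : (N : ℝ) * |s / N| = |s| := by
    rw [abs_div, abs_of_pos hN0]; field_simp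
  obtain ⟨q, z, hqz, h1, h2, h3, h4⟩ := h.foot_steps hε1 hfoot hyE hy i (σ := s / N) (N := N)
    (by rw [hNs]; exact hs) N le_rfl
  rw [hNs] at h1 h3 h4
  rw [show (N : ℝ) * (s / N) = s by field_simp] at h2
  have d0 : 0 ≤ dist q z := dist_nonneg
  have k0 : (0 : ℝ) ≤ k := Nat.cast_nonneg k
  have hqz2 : dist q z ^ 2 ≤ (4 + 10 * k) * ε * |s| ^ 2 := by
    refine h4.trans ?_
    have e1 : (N : ℝ) * ((7 + 25 * k) * |s / N| ^ 2 + (3 + 10 * k) * (ε * (|s / N| * |s|))) =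
        (7 + 25 * k) / N * |s| ^ 2 + (3 + 10 * k) * ε * |s| ^ 2 := by
      rw [abs_div, abs_of_pos hN0]; field_simp
    have e2 : (7 + 25 * k) / N ≤ ε := by rw [div_le_iff₀ hN0]; linarith
    have e3 := mul_le_mul_of_nonneg_right e2 (sq_nonneg |s|)
    rw [e1]
    linarith
  have hd : 6 * (k + 1) * dist q z ≤ τ / 2 * |s| := by
    refine le_of_sq_le_sq ?_ (by positivity)
    have := mul_le_mul_of_nonneg_right hετ (sq_nonneg |s|)
    have m := mul_le_mul_of_nonneg_left hqz2 (show 0 ≤ 36 * ((k : ℝ) + 1) ^ 2 by positivity)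
    calc (6 * (k + 1) * dist q z) ^ 2 = 36 * ((k : ℝ) + 1) ^ 2 * dist q z ^ 2 := by ring
      _ ≤ _ := m
      _ = 36 * (k + 1) ^ 2 * ((4 + 10 * k) * ε) * |s| ^ 2 := by ring
      _ ≤ _ := this
      _ = _ := by ring
  have kd : 0 ≤ k * dist q z := by positivity
  have hετ' : ε ≤ τ / 2 := by
    have : 144 * ε ≤ 36 * (k + 1) ^ 2 * ((4 + 10 * k) * ε) := by
      have : (1 : ℝ) * 4 ≤ (k + 1) ^ 2 * (4 + 10 * k) := by
        gcongr
        · nlinarith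
        · linarith
      have := mul_le_mul_of_nonneg_right this (show 0 ≤ 36 * ε by linarith)
      linarith
    nlinarith
  have τs : 0 ≤ τ * |s| := by positivity
  have εs := mul_le_mul_of_nonneg_right hετ' hs0
  have yz : dist y z ≤ 2 * |s| := by
    have := hqz.2.1 y hyE
    rw [dist_comm q y] at this
    linarith [dist_triangle y q z]
  refine ⟨z, hqz.1, yz, fun j => ?_, fun w hw => ?_⟩
  · rw [show dist z (a j) - dist y (a j) - (if j = i then s else 0) =
      (dist z (a j) - dist q (a j)) + (dist q (a j) - dist y (a j) - (if j = i then s else 0)) by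
        ring]
    refine (abs_add_le _ _).trans ?_
    have f1 := abs_dist_sub_le z q (a j)
    rw [dist_comm z q] at f1
    have f2 := h2 j
    rw [show (N : ℝ) * (ε * |s / N|) = ε * (N * |s / N|) by ring, hNs] at f2
    linarith
  · rw [show defect a w z - defect a w y =
      (defect a w z - defect a w q) + (defect a w q - defect a w y) by ring]
    refine (abs_add_le _ _).trans ?_
    have f1 := abs_defect_sub_le_dist a w q z
    have f2 := h3 w hw
    have wq := dist_triangle w y q
    have wz := dist_triangle w y z
    have w0 : 0 ≤ dist w y := dist_nonneg
    have f3 : (k + 1) * (dist q z * (dist w q + dist w z)) ≤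
        (k + 1) * (dist q z * (6 * (dist w y + |s|))) := by
      gcongr; linarith
    have f4 := mul_le_mul_of_nonneg_right hd (show 0 ≤ dist w y + |s| by positivity)
    have f5 := mul_le_mul_of_nonneg_right hετ' (show 0 ≤ |s| * (dist w y + |s|) by positivity)
    linarith

/-- Simultaneous adjustment of all coordinates inside an extremal set. -/
lemma move_all_of_move {τ : ℝ} (hτ : 0 ≤ τ)
    (hmove : ∀ y ∈ E, y ∈ ball p (ρ / 4) → ∀ i : Fin k, ∀ s : ℝ, |s| ≤ ρ / 8 →
      ∃ z ∈ E, dist y z ≤ 2 * |s| ∧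
      (∀ j, |dist z (a j) - dist y (a j) - (if j = i then s else 0)| ≤ τ * |s|) ∧
      ∀ w ∈ ball p ρ, |defect a w z - defect a w y| ≤ τ * (|s| * (dist w y + |s|)))
    {y : X} (hyE : y ∈ E) {t : ℝ} (ht : 0 ≤ t) (hy : dist p y + 2 * k * t < ρ / 4)
    (htρ : t ≤ ρ / 8) (v : Fin k → ℝ) (hv : ∀ i, |v i| ≤ t) :
    ∃ z ∈ E, dist y z ≤ 2 * k * t ∧
      (∀ j, |dist z (a j) - dist y (a j) - v j| ≤ τ * k * t) ∧
      ∀ w ∈ ball p ρ, |defect a w z - defect a w y| ≤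
        τ * k * (t * (dist w y + (2 * k + 1) * t)) := by
  have key : ∀ S : Finset (Fin k), ∃ z ∈ E, dist y z ≤ 2 * S.card * t ∧
      (∀ j, |dist z (a j) - dist y (a j) - (if j ∈ S then v j else 0)| ≤ τ * S.card * t) ∧
      ∀ w ∈ ball p ρ, |defect a w z - defect a w y| ≤
        τ * S.card * (t * (dist w y + (2 * k + 1) * t)) := by
    intro S
    induction S using Finset.induction_on with
    | empty => exact ⟨y, hyE, by simp⟩
    | insert i S hi ih =>
      obtain ⟨z, hz, h1, h2, h3⟩ := ih
      have hcard : S.card ≤ k := by simpa using Finset.card_le_univ S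
      have hcard' : (S.card : ℝ) ≤ k := Nat.cast_le.2 hcard
      have h1' : dist y z ≤ 2 * k * t := h1.trans (by gcongr)
      have hzb : z ∈ ball p (ρ / 4) := by
        rw [mem_ball, dist_comm]
        linarith [dist_triangle p y z]
      obtain ⟨u, hu, g1, g2, g3⟩ := hmove z hz hzb i (v i) ((hv i).trans htρ)
      rw [Finset.card_insert_of_notMem hi]
      push_cast
      refine ⟨u, hu, ?_, fun j => ?_, fun w hw => ?_⟩
      · linarith [dist_triangle y z u, hv i]
      · have e : dist u (a j) - dist y (a j) - (if j ∈ insert i S then v j else 0) =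
          (dist u (a j) - dist z (a j) - (if j = i then v i else 0)) +
          (dist z (a j) - dist y (a j) - (if j ∈ S then v j else 0)) := by
          by_cases hji : j = i
          · subst hji; simp [hi]; ring
          · simp [hji]; ring
        rw [e]
        have := mul_le_mul_of_nonneg_left (hv i) hτ
        exact (abs_add_le _ _).trans (by linarith [g2 j, h2 j])
      · rw [show defect a w u - defect a w y =
          (defect a w u - defect a w z) + (defect a w z - defect a w y) by ring]
        refine (abs_add_le _ _).trans ((add_le_add (g3 w hw) (h3 w hw)).trans ?_)
        have wz := dist_triangle w y z
        have := hv i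
        have m : τ * (|v i| * (dist w z + |v i|)) ≤ τ * (t * (dist w y + (2 * k + 1) * t)) :=
          mul_le_mul_of_nonneg_left (mul_le_mul (hv i) (by linarith)
            (add_nonneg dist_nonneg (abs_nonneg _)) ht) hτ
        linarith
  obtain ⟨z, hz, h1, h2, h3⟩ := key Finset.univ
  simp only [Finset.card_univ, Fintype.card_fin, Finset.mem_univ, if_true] at h1 h2 h3
  exact ⟨z, hz, h1, h2, h3⟩

end MoveExtremal

section BiLipschitz

variable {X : Type*} [MetricSpace X] {κ : ℝ} {k : ℕ}

lemma cr_zero_le_of_near {p y z : X} {θ : ℝ} (hθ : 0 ≤ θ) (hz : z ≠ p) (hy : y ≠ p)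
    (hzy : dist p z ≤ dist p y / 2) (h : 1 - θ ≤ cr 0 z p y) : cr 0 p z y ≤ -1 + 6 * θ := by
  have hs := dist_pos.2 hz.symm
  have ht := dist_pos.2 hy.symm
  have hd := dist_sq_eq hz hy
  have tri := dist_triangle p z y
  unfold cr
  rw [crK_zero, dist_comm z p]
  generalize cr 0 z p y = c at h hd
  generalize dist p z = s at *
  generalize dist p y = t at *
  generalize dist z y = d at *
  have d0 : 0 < d := by linarith
  rw [div_le_iff₀ (by positivity)]
  have hst : 0 < s * t := mul_pos hs ht
  have h1 : d ^ 2 ≤ (t - s) ^ 2 + 2 * (s * t) * θ := by nlinarith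
  have h2 : d - (t - s) ≤ t * θ := by
    by_contra! hcon
    have e1 : t * θ * t ≤ t * θ * (d + (t - s)) :=
      mul_le_mul_of_nonneg_left (by linarith) (by positivity)
    have e2 : t * θ * (d + (t - s)) < (d - (t - s)) * (d + (t - s)) :=
      mul_lt_mul_of_pos_right hcon (by linarith)
    have e3 : 2 * (s * t) * θ ≤ t * t * θ := by
      have : 2 * (s * t) ≤ t * t := by nlinarith
      exact mul_le_mul_of_nonneg_right this hθ
    nlinarith
  have h3 : t * θ ≤ 2 * (d * θ) := by nlinarith
  have h4 : d * (1 - 6 * θ) ≤ (t - s) - t * θ := by nlinarith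
  have h5 := mul_le_mul_of_nonneg_left h4 (show 0 ≤ 2 * s by linarith)
  nlinarith

lemma IsAlexandrov.exists_close_pair (hX : IsAlexandrov X κ) {n : ℕ}
    (hdim : dimH (Set.univ : Set X) = n) {p : X} {B : Set X}
    (hB : ∀ r > 0, ∃ y ∈ B, y ≠ p ∧ dist p y < r) {c r : ℝ} (hc : 0 < c) (hr : 0 < r) :
    ∃ y ∈ B, ∃ y' ∈ B, y ≠ p ∧ y' ≠ p ∧ dist p y < r ∧ dist p y' ≤ dist p y / 2 ∧
      1 - c ≤ cr κ y' p y := by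
  obtain ⟨ρ₀, hρ₀, hpack⟩ := hX.exists_packing hdim p
  obtain ⟨R, hG⟩ := exists_goodScale κ (η := c / 4) (by positivity)
  have hR := hG.pos
  obtain ⟨c', hc'⟩ : ∃ c', c' = min c 1 := ⟨_, rfl⟩
  have c'0 : 0 < c' := by rw [hc']; exact lt_min hc one_pos
  have c'1 : c' ≤ c := hc'.le.trans (min_le_left _ _)
  have c'2 : c' ≤ 1 := hc'.le.trans (min_le_right _ _)
  obtain ⟨N, hN⟩ := hpack c' c'0
  have : Nonempty X := ⟨p⟩
  choose! f hfB hfp hfr using hB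
  have hr' : 0 < min r (min ρ₀ R) := lt_min hr (lt_min hρ₀ hR)
  let Y : ℕ → X := fun n => Nat.rec (f (min r (min ρ₀ R))) (fun _ y => f (dist p y / 2)) n
  have hY : ∀ n, Y n ∈ B ∧ Y n ≠ p := by
    intro n
    induction n with
    | zero => exact ⟨hfB _ hr', hfp _ hr'⟩
    | succ n ih =>
      have : 0 < dist p (Y n) / 2 := half_pos (dist_pos.2 ih.2.symm)
      exact ⟨hfB _ this, hfp _ this⟩
  have hY1 : ∀ n, dist p (Y (n + 1)) ≤ dist p (Y n) / 2 := fun n =>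
    (hfr _ (half_pos (dist_pos.2 (hY n).2.symm))).le
  have hanti : Antitone fun n => dist p (Y n) := antitone_nat_of_succ_le fun n =>
    (hY1 n).trans (by linarith [dist_pos.2 (hY n).2.symm])
  have hY0 : dist p (Y 0) < min r (min ρ₀ R) := hfr _ hr'
  have hYlt : ∀ n, dist p (Y n) < min r (min ρ₀ R) := fun n =>
    (hanti (Nat.zero_le n)).trans_lt hY0
  have hYR : ∀ n, dist p (Y n) ≤ R := fun n =>
    ((hYlt n).trans_le ((min_le_right _ _).trans (min_le_right _ _))).le
  obtain ⟨t, ht⟩ : ∃ t, t = dist p (Y N) := ⟨_, rfl⟩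
  have t0 : 0 < t := by rw [ht]; exact dist_pos.2 (hY N).2.symm
  have hx : ∀ i : ℕ, ∃ x, i ≤ N → dist p x = t ∧ dist p x + dist x (Y i) = dist p (Y i) := by
    intro i
    by_cases hi : i ≤ N
    · obtain ⟨x, h1, h2⟩ := hX.exists_between p (Y i) t0.le (ht.le.trans (hanti hi))
      exact ⟨x, fun _ => ⟨h1, by rw [h1, h2]; ring⟩⟩
    · exact ⟨p, fun h => absurd h hi⟩
  choose x hx1 hx2 using hx
  have pair : ∃ i j, i < j ∧ j ≤ N ∧ dist (x i) (x j) < c' * t := by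
    classical
    by_contra! hcon
    have hcon' : ∀ i ≤ N, ∀ j ≤ N, i ≠ j → c' * t ≤ dist (x i) (x j) := by
      intro i hi j hj hij
      rcases lt_or_gt_of_ne hij with h | h
      · exact hcon i j h hj
      · rw [dist_comm]; exact hcon j i h hi
    have hcard := hN t t0 (ht.le.trans ((hYlt N).trans_le
      ((min_le_right _ _).trans (min_le_left _ _))).le) ((Finset.range (N + 1)).image x) ?_ ?_
    · rw [Finset.card_image_of_injOn, Finset.card_range] at hcard
      · omega
      · intro i hi j hj hij
        by_contra hne
        have := hcon' i (by simp at hi; omega) j (by simp at hj; omega) hne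
        rw [hij, dist_self] at this
        nlinarith
    · intro u hu
      obtain ⟨i, hi, rfl⟩ := Finset.mem_image.1 hu
      exact (hx1 i (by simp at hi; omega)).le
    · intro u hu v hv huv
      obtain ⟨i, hi, rfl⟩ := Finset.mem_image.1 hu
      obtain ⟨j, hj, rfl⟩ := Finset.mem_image.1 hv
      exact hcon' i (by simp at hi; omega) j (by simp at hj; omega) fun h => huv (h ▸ rfl)
  obtain ⟨i, j, hij, hj, hd⟩ := pair
  have hi : i ≤ N := by omega
  refine ⟨Y i, (hY i).1, Y j, (hY j).1, (hY i).2, (hY j).2, (hYlt i).trans_le (min_le_left _ _),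
    (hanti (Nat.succ_le_of_lt hij)).trans (hY1 i), ?_⟩
  have xi : x i ≠ p := fun h => by have := hx1 i hi; rw [h, dist_self] at this; linarith
  have xj : x j ≠ p := fun h => by have := hx1 j hj; rw [h, dist_self] at this; linarith
  have m1 := hX.cr_mono hG (hx2 j hj) xj (hY i).2 (hYR j) (hYR i)
  have m2 := hX.cr_mono hG (hx2 i hi) xi xj (hYR i) (by rw [hx1 j hj, ht]; exact hYR N)
  rw [cr_comm κ (Y i), cr_comm κ (x i)] at m2
  have a1 := abs_le.1 (hG.abs_cr_sub_le (by positivity) xj xi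
    (by rw [hx1 j hj, ht]; exact hYR N) (by rw [hx1 i hi, ht]; exact hYR N))
  have e := dist_sq_eq xj xi
  rw [hx1 j hj, hx1 i hi, dist_comm] at e
  have e2 : 1 - c / 2 ≤ cr 0 (x j) p (x i) := by
    have h0 : 0 ≤ dist (x i) (x j) := dist_nonneg
    have h1 : dist (x i) (x j) ^ 2 ≤ (c' * t) ^ 2 := by gcongr
    have h2 : c' ^ 2 ≤ c := by nlinarith
    have h3 : t ^ 2 * (1 - c / 2) ≤ t ^ 2 * cr 0 (x j) p (x i) := by
      have := mul_le_mul_of_nonneg_right h2 (sq_nonneg t)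
      nlinarith
    exact le_of_mul_le_mul_left h3 (by positivity)
  linarith

lemma pi_sub_lt_arccos {u δ : ℝ} (hδ : 0 < δ) (hδ2 : δ ≤ π) (hu : u < -Real.cos δ) :
    π - δ < arccos u := by
  have h1 : π - δ = arccos (-Real.cos δ) := by
    rw [Real.arccos_neg, Real.arccos_cos hδ.le hδ2]
  rw [h1]
  rcases le_or_gt (-1) u with h | h
  · exact Real.strictAntiOn_arccos ⟨h, hu.le.trans (by linarith [Real.neg_one_le_cos δ])⟩
      ⟨by linarith [Real.cos_le_one δ], by linarith [Real.neg_one_le_cos δ]⟩ hu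
  · rw [(arccos_eq_pi (x := u)).2 h.le, ← h1]
    linarith

/-- In an extremal set of dimension `m`, the coordinates of a fine `m`-chart at `p` detect the
distance to `p`. -/
lemma IsExtremal.exists_coord (hX : IsAlexandrov X κ) {n m : ℕ}
    (hdim : dimH (Set.univ : Set X) = n) {E : Set X} (hE : IsExtremal κ E) (hEdim : dimH E = m)
    {p : X} {ρ₀ : ℝ} (hρ₀ : 0 < ρ₀) (hfoot : ∀ w ∈ ball p ρ₀, ∃ u, IsFoot κ E w u) :
    ∃ τ > 0, ∃ ε > 0, ε ≤ 1 ∧ ∀ (a b : Fin m → X) (ρ : ℝ), Chart κ a b p ρ ε →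
      ∃ r > 0, ∀ y ∈ E, y ≠ p → dist p y < r →
        ∃ j, τ * dist p y < |dist y (a j) - dist p (a j)| := by
  have p1 : (0 : ℝ) < 1 / (4 * ((m + 1 : ℕ) : ℝ)) := by positivity
  have p2 : 1 / (4 * ((m + 1 : ℕ) : ℝ)) ≤ 1 := by
    rw [div_le_one (by positivity)]
    have : (1 : ℝ) ≤ (m + 1 : ℕ) := Nat.one_le_cast.2 (by omega)
    linarith
  obtain ⟨δ₁, hδ₁, H⟩ := exists_chart hX (m + 1) p1 p2
  obtain ⟨δ, hδ⟩ : ∃ δ, δ = min δ₁ (π / 2) := ⟨_, rfl⟩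
  have hδ0 : 0 < δ := by rw [hδ]; exact lt_min hδ₁ (by positivity)
  have hδ1 : δ ≤ δ₁ := hδ.le.trans (min_le_left _ _)
  have hδ2 : δ ≤ π / 2 := hδ.le.trans (min_le_right _ _)
  have hpi := Real.pi_pos
  have hS : 0 < Real.sin δ := Real.sin_pos_of_pos_of_lt_pi hδ0 (by linarith)
  have hS1 := Real.sin_le_one δ
  have hC : 0 < 1 - Real.cos δ := by
    have := Real.cos_lt_cos_of_nonneg_of_le_pi le_rfl (show δ ≤ π by linarith) hδ0
    rw [Real.cos_zero] at this
    linarith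
  obtain ⟨η, hη⟩ : ∃ η, η = (1 - Real.cos δ) / 40 := ⟨_, rfl⟩
  have hη0 : 0 < η := by rw [hη]; positivity
  obtain ⟨R, hG⟩ := exists_goodScale κ hη0
  have hR := hG.pos
  refine ⟨Real.sin δ / 20, by positivity, min δ (Real.sin δ / 20), lt_min hδ0 (by positivity),
    (min_le_right _ _).trans (by linarith), fun a b ρ h => ?_⟩
  obtain ⟨ε, hε⟩ : ∃ ε, ε = min δ (Real.sin δ / 20) := ⟨_, rfl⟩
  rw [← hε] at h
  have hε0 := h.nonneg
  have hε1 : ε ≤ δ := hε.le.trans (min_le_left _ _)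
  have hε2 : ε ≤ Real.sin δ / 20 := hε.le.trans (min_le_right _ _)
  have hρ := h.pos
  obtain ⟨R', hG', hρR', hR'⟩ := h.good
  by_contra! hcon
  obtain ⟨y, ⟨hyE, hyF⟩, z, ⟨hzE, hzF⟩, hyp, hzp, hyr, hzy, hcr⟩ :=
    hX.exists_close_pair hdim
      (B := {y | y ∈ E ∧ ∀ j, |dist y (a j) - dist p (a j)| ≤ Real.sin δ / 20 * dist p y})
      (p := p) (fun r hr => by
        obtain ⟨y, h1, h2, h3, h4⟩ := hcon r hr
        exact ⟨y, ⟨h1, h4⟩, h2, h3⟩) hη0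
      (lt_min (half_pos hρ) (lt_min hρ₀ (half_pos hR)) : 0 < min (ρ / 2) (min ρ₀ (R / 2)))
  rw [lt_min_iff, lt_min_iff] at hyr
  obtain ⟨hyρ, hyρ₀, hyR⟩ := hyr
  have hs := dist_pos.2 hzp.symm
  have ht := dist_pos.2 hyp.symm
  have tri := dist_triangle p z y
  have tri' := dist_triangle_left z y p
  have hd : 0 < dist z y := by linarith
  have hyz : y ≠ z := (dist_pos.1 hd).symm
  have hzb : z ∈ ball p ρ := by rw [mem_ball, dist_comm]; linarith
  have hyb : y ∈ ball p ρ := by rw [mem_ball, dist_comm]; linarith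
  have hpb : p ∈ ball p ρ := mem_ball_self hρ
  have a1 := abs_le.1 (hG.abs_cr_sub_le hη0.le hzp hyp (by linarith) (by linarith))
  have n1 := cr_zero_le_of_near (θ := 3 * η) (by positivity) hzp hyp hzy (by linarith)
  have a2 := abs_le.1 (hG.abs_cr_sub_le hη0.le (q := p) (p := z) (r := y) hzp.symm hyz
    (by rw [dist_comm]; linarith) (by linarith))
  have hpi1 : π - δ < cangle κ p z y := by
    rw [cangle_eq]
    exact pi_sub_lt_arccos hδ0 (by linarith) (by linarith)
  have perp : ∀ u ∈ ball p ρ, u ≠ z →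
      (∀ j, |dist z (a j) - dist u (a j)| ≤ Real.sin δ / 5 * dist z u) → ∀ j,
      π / 2 - δ < cangle κ u z (a j) ∧ π / 2 - δ < cangle κ u z (b j) := by
    intro u hu huz hF j
    have du := dist_pos.2 huz.symm
    have f := abs_le.1 (hF j)
    have s := abs_le.1 (h.sum_le z hzb u hu j)
    have c1 := abs_le.1 (h.conv_a z hzb u hu huz j)
    have c2 := abs_le.1 (h.conv_b z hzb u hu huz j)
    have g1 : (dist z (a j) - dist u (a j)) / dist z u ≤ Real.sin δ / 5 := by
      rw [div_le_iff₀ du]; linarith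
    have g2 : (dist z (b j) - dist u (b j)) / dist z u ≤ Real.sin δ / 5 + ε := by
      rw [div_le_iff₀ du]; linarith
    rw [cangle_eq, cangle_eq]
    exact ⟨pi_div_two_sub_lt_arccos hδ0 hδ2 (by linarith),
      pi_div_two_sub_lt_arccos hδ0 hδ2 (by linarith)⟩
  have Pp := perp p hpb hzp.symm fun j => (hzF j).trans (by
    rw [dist_comm z p]
    exact mul_le_mul_of_nonneg_right (by linarith) hs.le)
  have Py := perp y hyb hyz fun j => by
    have h1 := hzF j
    have h2 := hyF j
    rw [abs_sub_comm] at h2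
    rw [show dist z (a j) - dist y (a j) =
      (dist z (a j) - dist p (a j)) + (dist p (a j) - dist y (a j)) by ring]
    refine (abs_add_le _ _).trans ?_
    have h3 : Real.sin δ / 20 * (dist p z + dist p y) ≤ Real.sin δ / 20 * (4 * dist z y) := by
      gcongr; linarith
    linarith
  have hst := ((h.str z hzb).mono hε1).cons hpi1 (fun j => (Pp j).1) (fun j => (Pp j).2)
    (fun j => (Py j).1) (fun j => (Py j).2)
  have hloc : LocStrained κ (m + 1) δ z := by
    refine hG'.locStrained hX hst (fun i => ?_) fun i => ?_
    · induction i using Fin.cases with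
      | zero => simpa using ⟨hzp.symm, hyz⟩
      | succ i => simpa using h.ne z hzb i
    · induction i using Fin.cases with
      | zero =>
        simp only [Fin.cons_zero]
        exact ⟨by rw [dist_comm]; linarith, by linarith⟩
      | succ i => simpa using hR' z hzb i
  obtain ⟨a', b', ρ', hρ', h', -⟩ := H z (hloc.mono hδ1) (ρ₀ / 2) (by positivity)
  have := h'.le_dimH hX (by rw [div_mul_eq_mul_div,
    div_le_div_iff₀ (by positivity) (by norm_num)]; linarith)
    hE.1 hzE fun w hw => hfoot w (by
      rw [mem_ball] at hw ⊢
      have := dist_triangle_right w p z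
      linarith)
  rw [hEdim] at this
  have : m + 1 ≤ m := by exact_mod_cast this
  omega

end BiLipschitz

section Regular

variable {X : Type*} [MetricSpace X] {κ : ℝ}

lemma Chart.weaken {k : ℕ} {a b : Fin k → X} {p : X} {ρ ε ε' : ℝ} (h : Chart κ a b p ρ ε)
    (hle : ε ≤ ε') : Chart κ a b p ρ ε' where
  pos := h.pos
  move y hy i s hs := by
    obtain ⟨q, h1, h2, h3⟩ := h.move y hy i s hs
    exact ⟨q, h1, fun j => (h2 j).trans (mul_le_mul_of_nonneg_right hle (abs_nonneg s)),
      fun w hw => (h3 w hw).trans (mul_le_mul_of_nonneg_right hle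
        (mul_nonneg (abs_nonneg s) (add_nonneg dist_nonneg (abs_nonneg s))))⟩
  crit q hq z hz hc i := (h.crit q hq z hz hc i).trans
    (mul_le_mul_of_nonneg_right hle dist_nonneg)
  hinge q hq z hz u hu hc := (h.hinge q hq z hz u hu hc).trans
    (add_le_add_right (mul_le_mul_of_nonneg_right hle (mul_nonneg dist_nonneg dist_nonneg)) _)
  str x hx := (h.str x hx).mono hle
  ne := h.ne
  conv_a x hx y hy hyx i := (h.conv_a x hx y hy hyx i).trans hle
  conv_b x hx y hy hyx i := (h.conv_b x hx y hy hyx i).trans hle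
  sum_le x hx y hy i := (h.sum_le x hx y hy i).trans
    (mul_le_mul_of_nonneg_right hle dist_nonneg)
  good := by
    obtain ⟨R, hG, hR⟩ := h.good
    exact ⟨R, hG.weaken hle, hR⟩

/-- The coordinate map of a chart, centred at `p`. -/
noncomputable def coordMap {m : ℕ} (a : Fin m → X) (p x : X) : EuclideanSpace ℝ (Fin m) :=
  WithLp.toLp 2 fun j => dist x (a j) - dist p (a j)

lemma coordMap_self {m : ℕ} (a : Fin m → X) (p : X) : coordMap a p p = 0 := by
  ext j
  simp [coordMap]

lemma dist_coordMap_sq {m : ℕ} (a : Fin m → X) (p x y : X) :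
    dist (coordMap a p x) (coordMap a p y) ^ 2 = ∑ j, (dist x (a j) - dist y (a j)) ^ 2 := by
  rw [EuclideanSpace.dist_eq, Real.sq_sqrt (Finset.sum_nonneg fun j _ => sq_nonneg _)]
  refine Finset.sum_congr rfl fun j _ => ?_
  simp [coordMap, Real.dist_eq]

lemma abs_sub_le_of_abs_sq_sub_sq_le {u v e : ℝ} (hu : 0 ≤ u) (hv : 0 ≤ v) (he : 0 ≤ e)
    (h : |u ^ 2 - v ^ 2| ≤ e ^ 2) : |u - v| ≤ e := by
  refine abs_le_of_sq_le_sq ?_ he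
  refine le_trans ?_ h
  rw [sq_sub_sq, abs_mul, abs_of_nonneg (add_nonneg hu hv), ← sq_abs, sq]
  refine mul_le_mul_of_nonneg_right ?_ (abs_nonneg _)
  rw [abs_le]
  constructor <;> linarith

lemma dist_le_of_coord_le {m : ℕ} {f v : EuclideanSpace ℝ (Fin m)} {e : ℝ} (he : 0 ≤ e)
    (h : ∀ j, |f j - v j| ≤ e) : dist f v ≤ m * e := by
  rw [EuclideanSpace.dist_eq]
  refine Real.sqrt_le_iff.2 ⟨by positivity, ?_⟩
  have h1 : ∑ j, dist (f j) (v j) ^ 2 ≤ ∑ _j : Fin m, e ^ 2 := Finset.sum_le_sum fun j _ => by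
    rw [Real.dist_eq]
    exact pow_le_pow_left₀ (abs_nonneg _) (h j) 2
  refine h1.trans ?_
  rw [Finset.sum_const, Finset.card_univ, Fintype.card_fin, nsmul_eq_mul, mul_pow]
  refine mul_le_mul_of_nonneg_right ?_ (sq_nonneg e)
  exact_mod_cast Nat.le_self_pow two_ne_zero m

lemma exists_small {ε β A B : ℝ} (hε : 0 < ε) (hβ : 0 < β) (hA : 0 ≤ A) (hB : 0 ≤ B) :
    ∃ τ > 0, τ ≤ 1 ∧ τ * A ≤ ε ∧ τ * B ≤ β := by
  refine ⟨min 1 (min (ε / (A + 1)) (β / (B + 1))), by positivity, min_le_left _ _, ?_, ?_⟩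
  · have h : min 1 (min (ε / (A + 1)) (β / (B + 1))) ≤ ε / (A + 1) :=
      (min_le_right _ _).trans (min_le_left _ _)
    refine (mul_le_mul_of_nonneg_right h hA).trans ?_
    rw [div_mul_eq_mul_div, div_le_iff₀ (by positivity)]
    nlinarith
  · have h : min 1 (min (ε / (A + 1)) (β / (B + 1))) ≤ β / (B + 1) :=
      (min_le_right _ _).trans (min_le_right _ _)
    refine (mul_le_mul_of_nonneg_right h hB).trans ?_
    rw [div_mul_eq_mul_div, div_le_iff₀ (by positivity)]
    nlinarith

set_option maxHeartbeats 400000 in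
/-- An extremal set of dimension `m` is regular at its locally `(m, δ)`-strained points. -/
lemma IsExtremal.isRegularPt (hX : IsAlexandrov X κ) {n m : ℕ}
    (hdim : dimH (Set.univ : Set X) = n) {E : Set X} (hE : IsExtremal κ E) (hEdim : dimH E = m)
    {p : X} (hp : p ∈ E) (hloc : ∀ δ > 0, LocStrained κ m δ p) : IsRegularPt E m p := by
  have := hX.1
  intro ε hε
  obtain ⟨ρ₀, hρ₀, hpack⟩ := hX.exists_packing hdim p
  have hcpt : IsCompact (closedBall p ρ₀) := isCompact_closedBall_of_packing hρ₀ fun c hc => by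
    obtain ⟨N, hN⟩ := hpack c hc
    exact ⟨N, hN ρ₀ hρ₀ le_rfl⟩
  have hfoot : ∀ w ∈ ball p (ρ₀ / 2), ∃ u, IsFoot κ E w u := fun w hw =>
    hE.exists_isFoot hp hcpt hw
  obtain ⟨τ', hτ', ε₁, hε₁, hε₁1, H⟩ := hE.exists_coord hX hdim hEdim (half_pos hρ₀) hfoot
  obtain ⟨β, hβ⟩ : ∃ β, β = min 1 ε / 2 := ⟨_, rfl⟩
  have hβ0 : 0 < β := by rw [hβ]; positivity
  have hβ1 : β ≤ 1 / 2 := by rw [hβ]; linarith [min_le_left 1 ε]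
  have hβ2 : 2 * β ≤ ε := by rw [hβ]; linarith [min_le_right 1 ε]
  have hm0 : (0 : ℝ) ≤ m := Nat.cast_nonneg m
  obtain ⟨A, hA⟩ : ∃ A : ℝ, A = m * (2 * m + 3) + (m + 1) * (m / τ' * (2 * m + 3)) := ⟨_, rfl⟩
  have hA0 : 0 ≤ A := by rw [hA]; positivity
  obtain ⟨τ, hτ, hτ1, hτA, hτB⟩ := exists_small (ε := ε ^ 2) (β := β / 2) (A := 2 * A)
    (B := m * m + m * (2 * m + 1)) (by positivity) (by positivity) (by positivity) (by positivity)
  obtain ⟨ε₂, hε₂, hε₂1, hε₂A, hε₂B⟩ := exists_small (ε := ε₁) (β := (τ / 2) ^ 2) (A := 1)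
    (B := 36 * (m + 1) ^ 2 * (4 + 10 * m)) hε₁ (by positivity) zero_le_one (by positivity)
  obtain ⟨δ, hδ, Hc⟩ := exists_chart hX m hε₂ hε₂1
  obtain ⟨a, b, ρ, hρρ₀, h, -⟩ := Hc p (hloc δ hδ) (ρ₀ / 2) (half_pos hρ₀)
  have hρ := h.pos
  obtain ⟨r₁, hr₁, Hr⟩ := H a b ρ (h.weaken (by linarith))
  have hm : 36 * ((m : ℝ) + 1) ^ 2 * ((4 + 10 * m) * ε₂) ≤ (τ / 2) ^ 2 := by linarith
  have hmove : ∀ y ∈ E, y ∈ ball p (ρ / 4) → ∀ i : Fin m, ∀ s : ℝ, |s| ≤ ρ / 8 →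
      ∃ z ∈ E, dist y z ≤ 2 * |s| ∧
      (∀ j, |dist z (a j) - dist y (a j) - (if j = i then s else 0)| ≤ τ * |s|) ∧
      ∀ w ∈ ball p ρ, |defect a w z - defect a w y| ≤ τ * (|s| * (dist w y + |s|)) :=
    fun y hyE hy i s hs => h.move_extremal hε₂ hε₂1 hτ hτ1 hm
      (fun w hw => hfoot w (ball_subset_ball hρρ₀ hw)) hyE hy i hs
  refine ⟨min (ρ / 8) r₁ / (2 * m + 1), by positivity, fun r hr hr0 => ⟨coordMap a p,
    coordMap_self a p, ?_, ?_⟩⟩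
  all_goals
    rw [lt_div_iff₀ (by positivity), lt_min_iff] at hr0
    obtain ⟨hrρ, hrr⟩ := hr0
    have mr : 0 ≤ m * r := by positivity
  · have key : ∀ x ∈ E ∩ closedBall p r, ∀ y ∈ closedBall p r,
        |defect a y x - defect a y p| ≤ τ * A * r ^ 2 := by
      rintro x ⟨hxE, hx⟩ y hy
      rw [mem_closedBall, dist_comm] at hx hy
      obtain ⟨z, hzE, hz1, hz2, hz3⟩ := move_all_of_move hτ.le hmove hxE hr.le
        (by linarith) (by linarith)
        (fun j => dist p (a j) - dist x (a j)) fun j => (abs_dist_sub_le _ _ _).trans hx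
      have hz2' : ∀ j, |dist z (a j) - dist p (a j)| ≤ τ * m * r := fun j => by
        have := hz2 j
        rwa [show dist z (a j) - dist x (a j) - (dist p (a j) - dist x (a j)) =
          dist z (a j) - dist p (a j) by ring] at this
      have hpz : dist p z ≤ τ * (m / τ') * r := by
        rcases eq_or_ne z p with rfl | hzp
        · rw [dist_self]; positivity
        · obtain ⟨j, hj⟩ := Hr z hzE hzp (by linarith [dist_triangle p x z])
          have := hj.le.trans (hz2' j)
          rw [mul_comm, ← le_div_iff₀ hτ'] at this
          rwa [show τ * (m / τ') * r = τ * m * r / τ' by ring]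
      have d1 := hz3 y (by rw [mem_ball, dist_comm]; linarith)
      have d2 := abs_defect_sub_le_dist a y p z
      have yx := dist_triangle y p x
      have yz := dist_triangle y p z
      have pz := dist_triangle p x z
      rw [dist_comm y p] at yx yz d2
      have e1 : τ * m * (r * (dist y x + (2 * m + 1) * r)) ≤
          τ * m * (r * ((2 * m + 3) * r)) :=
        mul_le_mul_of_nonneg_left (mul_le_mul_of_nonneg_left (by linarith) hr.le) (by positivity)
      have e2 : (m + 1) * (dist p z * (dist p y + dist y z)) ≤
          (m + 1) * (τ * (m / τ') * r * ((2 * m + 3) * r)) :=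
        mul_le_mul_of_nonneg_left (mul_le_mul hpz (by linarith)
          (add_nonneg dist_nonneg dist_nonneg) (by positivity)) (by positivity)
      rw [show defect a y x - defect a y p =
        (defect a y z - defect a y p) - (defect a y z - defect a y x) by ring]
      refine (abs_sub _ _).trans ((add_le_add (d2.trans e2) (d1.trans e1)).trans ?_)
      apply le_of_eq
      rw [hA]
      ring
    intro x hx y hy
    have k1 := key x hx y hy.2
    have k2 := key y hy p (mem_closedBall_self hr.le)
    have hpp : defect a p p = 0 := by simp [defect]
    rw [hpp, sub_zero, defect_comm] at k2
    have k3 : |defect a y x| ≤ (ε * r) ^ 2 := by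
      have : defect a y x = (defect a y x - defect a y p) + defect a y p := by ring
      rw [this]
      refine (abs_add_le _ _).trans ((add_le_add k1 k2).trans ?_)
      have := mul_le_mul_of_nonneg_right hτA (sq_nonneg r)
      rw [mul_pow]
      linarith
    rw [abs_sub_comm]
    refine abs_sub_le_of_abs_sq_sub_sq_le dist_nonneg dist_nonneg (by positivity) ?_
    rw [dist_coordMap_sq, dist_comm x y]
    unfold defect at k3
    convert k3 using 3
    exact Finset.sum_congr rfl fun j _ => by ring
  · intro v hv
    rw [mem_closedBall, dist_zero_right] at hv
    have hvj : ∀ j, |v j| ≤ r := fun j => by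
      rw [← Real.norm_eq_abs]
      exact (PiLp.norm_apply_le v j).trans hv
    obtain ⟨z, hzE, hz1, hz2, hz3⟩ := move_all_of_move hτ.le hmove hp hr.le
      (by rw [dist_self]; linarith) (by linarith)
        (fun j => (1 - β) * v j) fun j => by
          rw [abs_mul, abs_of_nonneg (by linarith)]
          exact (mul_le_of_le_one_left (abs_nonneg _) (by linarith)).trans (hvj j)
    have hfz : dist (coordMap a p z) ((1 - β) • v) ≤ m * (τ * m * r) :=
      dist_le_of_coord_le (by positivity) fun j => by simpa [coordMap] using hz2 j
    have hτm : τ * (m * m) ≤ β / 2 := by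
      nlinarith [mul_nonneg hτ.le (mul_nonneg hm0 (by positivity : (0:ℝ) ≤ 2 * m + 1))]
    have hfz' : dist (coordMap a p z) ((1 - β) • v) ≤ β / 2 * r := by
      have := mul_le_mul_of_nonneg_right hτm hr.le
      linarith
    have hnv : ‖(1 - β) • v‖ ≤ (1 - β) * r := by
      rw [norm_smul, Real.norm_of_nonneg (by linarith)]
      exact mul_le_mul_of_nonneg_left hv (by linarith)
    have hnz : dist (coordMap a p p) (coordMap a p z) ≤ (1 - β / 2) * r := by
      rw [coordMap_self, dist_comm, dist_zero_right]
      have h2 := norm_le_norm_add_norm_sub' (coordMap a p z) ((1 - β) • v)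
      rw [← dist_eq_norm] at h2
      linarith
    refine ⟨z, ⟨hzE, ?_⟩, ?_⟩
    · rw [mem_closedBall, dist_comm]
      have d := (abs_le.1 (hz3 p (mem_ball_self hρ))).2
      rw [show defect a p p = 0 by simp [defect], sub_zero, dist_self, zero_add] at d
      have e := dist_coordMap_sq a p p z
      have e' := pow_le_pow_left₀ dist_nonneg hnz 2
      have hτm' : τ * (m * (2 * m + 1)) ≤ β / 2 := by
        nlinarith [mul_nonneg hτ.le (mul_nonneg hm0 hm0)]
      have e2 := mul_le_mul_of_nonneg_right hτm' (sq_nonneg r)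
      unfold defect at d
      refine le_of_sq_le_sq ?_ hr.le
      have e3 : ((1 - β / 2) * r) ^ 2 ≤ (1 - β / 2) * r ^ 2 := by
        rw [mul_pow, sq (1 - β / 2)]
        exact mul_le_mul_of_nonneg_right (mul_le_of_le_one_left (by linarith) (by linarith))
          (sq_nonneg r)
      clear Hr H Hc hz2 hz3 hmove hpack hfoot hloc hτA hτB hε₂A hε₂B hm hA hA0
      linarith
    · have e1 : dist ((1 - β) • v) v ≤ β * r := by
        rw [dist_eq_norm, show (1 - β) • v - v = -(β • v) by module, norm_neg, norm_smul,
          Real.norm_of_nonneg hβ0.le]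
        exact mul_le_mul_of_nonneg_left hv hβ0.le
      have e2 := mul_le_mul_of_nonneg_right hβ2 hr.le
      have e3 : 0 ≤ β * r := by positivity
      linarith [dist_triangle (coordMap a p z) ((1 - β) • v) v]

end Regular

section Localization

variable {X : Type*} [MetricSpace X] {κ : ℝ}

lemma snK_ne_zero_of_cangle_ne {q p r : X} (h : cangle κ q p r ≠ π / 2) :
    snK κ (dist p q) ≠ 0 ∧ snK κ (dist p r) ≠ 0 := by
  rw [cangle_eq] at h
  unfold cr crK at h
  unfold snK
  constructor <;> intro h0 <;> apply h <;> split_ifs at h0 ⊢ <;> simp [h0]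

lemma ne_of_snK_ne_zero {p q : X} (h : snK κ (dist p q) ≠ 0) : q ≠ p := by
  rintro rfl
  rw [dist_self, snK_zero] at h
  exact h rfl

/-- Two geodesics which share an initial piece make the angle zero at its end. -/
lemma IsAlexandrov.cangle_eq_zero_of_between (hX : IsAlexandrov X κ) {q u a b : X}
    (ha : dist q u + dist u a = dist q a) (hb : dist q u + dist u b = dist q b)
    (hq0 : snK κ (dist u q) ≠ 0) (ha0 : snK κ (dist u a) ≠ 0) (hb0 : snK κ (dist u b) ≠ 0) :
    cangle κ a u b = 0 := by
  have h := hX.2.2 u q a b (ne_of_snK_ne_zero hq0) (ne_of_snK_ne_zero ha0) (ne_of_snK_ne_zero hb0)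
  have h1 : cangle κ q u a = π := by
    rw [cangle_eq, cr_eq_neg_one ha hq0 ha0, Real.arccos_neg_one]
  have h2 : cangle κ b u q = π := by
    rw [cangle_comm, cangle_eq, cr_eq_neg_one hb hq0 hb0, Real.arccos_neg_one]
  have h3 : 0 ≤ cangle κ a u b := by rw [cangle_eq]; exact Real.arccos_nonneg _
  linarith

lemma IsAlexandrov.dist_eq_of_between (hX : IsAlexandrov X κ) {q u a b : X} (hqu : q ≠ u)
    (ha : dist q u + dist u a = dist q a) (hb : dist q u + dist u b = dist q b)
    (hκ : 0 < κ → √κ * dist u q < π ∧ √κ * dist u a < π ∧ √κ * dist u b < π) :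
    dist a b = |dist u a - dist u b| := by
  rcases eq_or_ne a u with rfl | hau
  · rw [dist_self, zero_sub, abs_neg, abs_of_nonneg dist_nonneg]
  rcases eq_or_ne b u with rfl | hbu
  · rw [dist_self, sub_zero, abs_of_nonneg dist_nonneg, dist_comm]
  have sa := snK_pos (dist_pos.2 hau.symm) fun hk => (hκ hk).2.1
  have sb := snK_pos (dist_pos.2 hbu.symm) fun hk => (hκ hk).2.2
  have h0 := hX.cangle_eq_zero_of_between ha hb (snK_dist_ne hqu fun hk => (hκ hk).1) sa.ne' sb.ne'
  rw [cangle_eq, Real.arccos_eq_zero] at h0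
  refine le_antisymm ?_ (abs_dist_sub_le' u a b)
  by_contra! hlt
  obtain ⟨l1, l2⟩ := abs_lt.1 hlt
  have tri := dist_triangle_left a b u
  have q := Real.sqrt_nonneg κ
  have p1 := snK_pos (κ := κ) (x := (dist a b + dist u a - dist u b) / 2) (by linarith) fun hk =>
    lt_of_le_of_lt (mul_le_mul_of_nonneg_left (by linarith) q) (hκ hk).2.1
  have p2 := snK_pos (κ := κ) (x := (dist a b - dist u a + dist u b) / 2) (by linarith) fun hk =>
    lt_of_le_of_lt (mul_le_mul_of_nonneg_left (by linarith) q) (hκ hk).2.2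
  have e := one_sub_crK (dist a b) sa.ne' sb.ne'
  have : 0 < 2 * snK κ ((dist a b + dist u a - dist u b) / 2) *
    snK κ ((dist a b - dist u a + dist u b) / 2) / (snK κ (dist u a) * snK κ (dist u b)) := by
    positivity
  unfold cr at h0
  linarith

lemma eq_or_eq_of_cos_add_cos_ge {A B L S : ℝ} (hL : π / 2 < L) (hL2 : L ≤ 5 * π / 8)
    (hS2 : S ≤ π / 8) (hA : |A - L| ≤ S) (hB : |B - L| ≤ S) (hAB : 2 * L ≤ A + B)
    (h : 2 * Real.cos L * Real.cos S ≤ Real.cos A + Real.cos B) :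
    (A = L + S ∧ B = L - S) ∨ (A = L - S ∧ B = L + S) := by
  have hpi := Real.pi_pos
  obtain ⟨a1, a2⟩ := abs_le.1 hA
  obtain ⟨b1, b2⟩ := abs_le.1 hB
  have hcL : Real.cos L < 0 :=
    Real.cos_neg_of_pi_div_two_lt_of_lt hL (by linarith)
  have hS : |(A - B) / 2| ≤ S := abs_le.2 ⟨by linarith, by linarith⟩
  have hC : Real.cos S ≤ Real.cos ((A - B) / 2) := by
    rw [← Real.cos_abs ((A - B) / 2)]
    exact Real.cos_le_cos_of_nonneg_of_le_pi (abs_nonneg _) (by linarith) hS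
  have hCS : 0 < Real.cos S := Real.cos_pos_of_mem_Ioo ⟨by linarith, by linarith⟩
  rw [Real.cos_add_cos] at h
  have hAB' : A + B = 2 * L := by
    refine le_antisymm ?_ hAB
    by_contra! hlt
    have := Real.cos_lt_cos_of_nonneg_of_le_pi (x := L) (y := (A + B) / 2) (by linarith)
      (by linarith) (by linarith)
    nlinarith
  rw [show (A + B) / 2 = L by linarith] at h
  have hC' : Real.cos ((A - B) / 2) ≤ Real.cos S := by nlinarith
  have hS' : S ≤ |(A - B) / 2| := by
    by_contra! hlt
    have := Real.cos_lt_cos_of_nonneg_of_le_pi (abs_nonneg _) (by linarith) hlt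
    rw [Real.cos_abs] at this
    linarith
  rcases le_abs.1 hS' with h1 | h1
  · exact Or.inl ⟨by linarith, by linarith⟩
  · exact Or.inr ⟨by linarith, by linarith⟩

/-- Near the midpoint of a geodesic longer than `π / √κ` the space is one-dimensional. -/
lemma IsAlexandrov.dist_eq_of_long (hX : IsAlexandrov X κ) (hκ : 0 < κ) {p y z w : X}
    (hz : dist z p = dist p y / 2) (hz' : dist z y = dist p y / 2) (hl : π < √κ * dist p y)
    (hl2 : √κ * dist p y ≤ 5 * π / 4) (hw : √κ * dist z w ≤ π / 8) :
    dist p w = dist z p + dist z w ∨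
      dist p w = dist z p - dist z w ∧ dist y w = dist z y + dist z w := by
  rcases eq_or_ne w z with rfl | hwz
  · left; rw [dist_self, dist_comm, add_zero]
  have hpi := Real.pi_pos
  have hq : 0 < √κ := Real.sqrt_pos.2 hκ
  have hl0 : 0 < dist p y := by
    by_contra! h0
    nlinarith
  have hzp : p ≠ z := fun h => by rw [h, dist_self] at hz; linarith [h ▸ hl0]
  have hzy : y ≠ z := fun h => by rw [h, dist_self] at hz'; linarith [h ▸ hl0]
  have hzp' : √κ * dist z p < π := by rw [hz]; linarith
  have hzy' : √κ * dist z y < π := by rw [hz']; linarith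
  have hw' : √κ * dist z w < π := by linarith
  have a1 := abs_le.1 (abs_dist_sub_le' w p z)
  have a2 := abs_le.1 (abs_dist_sub_le' w y z)
  have a3 := dist_triangle p z w
  have a4 := dist_triangle y z w
  have a5 := dist_triangle_right p y w
  have a6 := dist_triangle_left z p w
  have a7 := dist_triangle_left z y w
  rw [dist_comm p z] at a1 a3
  rw [dist_comm y z] at a2 a4
  rw [dist_comm w p, dist_comm w z] at a1 a6
  rw [dist_comm w y, dist_comm w z] at a2 a7
  have s1 := snK_pos (dist_pos.2 hzp.symm) fun _ => hzp'
  have s2 := snK_pos (dist_pos.2 hzy.symm) fun _ => hzy'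
  have s3 := snK_pos (dist_pos.2 hwz.symm) fun _ => hw'
  have h := hX.2.2 z p y w hzp hzy hwz
  have h1 : cangle κ p z y = π := by
    rw [cangle_eq, cr_eq_neg_one (by rw [dist_comm p z]; linarith) s1.ne' s2.ne',
      Real.arccos_neg_one]
  rw [h1, cangle_comm κ w, cangle_eq, cangle_eq] at h
  have per : ∀ c, √κ * dist z c = √κ * dist p y / 2 → dist c w ≤ dist z c + dist z w →
      √κ * (dist z c + dist z w + dist c w) ≤ 2 * π := by
    intro c h1 h2
    have := mul_le_mul_of_nonneg_left h2 hq.le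
    rw [mul_add] at this
    rw [mul_add, mul_add]
    linarith
  have h2 := neg_le_add_of_arccos_add_le le_rfl
    (u := cr κ y z w) (v := cr κ p z w)
    ⟨neg_one_le_crK (dist_pos.2 hzy.symm) (dist_pos.2 hwz.symm) dist_nonneg a4
      fun _ => ⟨hzy', hw', per y (by rw [hz']; ring) a4⟩,
      crK_le_one (dist_pos.2 hzy.symm) (dist_pos.2 hwz.symm) (abs_dist_sub_le' z y w) a4
      fun _ => ⟨hzy', hw'⟩⟩
    ⟨neg_one_le_crK (dist_pos.2 hzp.symm) (dist_pos.2 hwz.symm) dist_nonneg a3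
      fun _ => ⟨hzp', hw', per p (by rw [hz]; ring) a3⟩,
      crK_le_one (dist_pos.2 hzp.symm) (dist_pos.2 hwz.symm) (abs_dist_sub_le' z p w) a3
      fun _ => ⟨hzp', hw'⟩⟩ (by linarith)
  unfold cr crK at h2
  unfold snK at s1 s2 s3
  rw [if_pos hκ] at s1 s2 s3
  rw [if_pos hκ, if_pos hκ, hz, hz', neg_zero, ← add_div] at h2
  rw [hz] at s1
  have h3 := (div_nonneg_iff.1 h2).resolve_right fun h => by
    have := mul_pos s1 s3
    linarith [h.2]
  have key := eq_or_eq_of_cos_add_cos_ge (A := √κ * dist p w) (B := √κ * dist y w)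
    (L := √κ * (dist p y / 2)) (S := √κ * dist z w) (by linarith) (by linarith) hw
    (by
      rw [← mul_sub, abs_mul, abs_of_pos hq]
      exact mul_le_mul_of_nonneg_left (abs_le.2 ⟨by linarith, by linarith⟩) hq.le)
    (by
      rw [← mul_sub, abs_mul, abs_of_pos hq]
      exact mul_le_mul_of_nonneg_left (abs_le.2 ⟨by linarith, by linarith⟩) hq.le)
    (by
      have := mul_le_mul_of_nonneg_left a5 hq.le
      rw [mul_add] at this
      linarith) (by linarith [h3.1])
  rw [hz, hz']
  rw [← mul_add, ← mul_sub] at key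
  rcases key with ⟨h4, -⟩ | ⟨h4, h5⟩
  · exact Or.inl (mul_left_cancel₀ hq.ne' h4)
  · exact Or.inr ⟨mul_left_cancel₀ hq.ne' h4, mul_left_cancel₀ hq.ne' h5⟩

/-- A space with a pair of points further apart than `π / √κ` is locally a piece of a line. -/
lemma IsAlexandrov.exists_isometric_coord (hX : IsAlexandrov X κ) (hκ : 0 < κ) {p c : X}
    (hc : π < √κ * dist p c) :
    ∃ (o : X) (σ : ℝ), 0 < σ ∧ ∀ x ∈ ball p σ, ∀ y ∈ ball p σ,
      dist x y = |dist o x - dist o y| := by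
  have hpi := Real.pi_pos
  have hq : 0 < √κ := Real.sqrt_pos.2 hκ
  obtain ⟨l, hl⟩ : ∃ l, l = min (dist p c) (5 * π / 4 / √κ) := ⟨_, rfl⟩
  have hl1 : π < √κ * l := by
    rw [hl, mul_min_of_nonneg _ _ hq.le, mul_div_cancel₀ _ hq.ne']
    exact lt_min hc (by linarith)
  have hl2 : √κ * l ≤ 5 * π / 4 := by
    rw [hl, mul_min_of_nonneg _ _ hq.le, mul_div_cancel₀ _ hq.ne']
    exact min_le_right _ _
  have hl0 : 0 < l := by
    by_contra! h0
    nlinarith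
  obtain ⟨σ, hσ⟩ : ∃ σ, σ = π / 16 / √κ := ⟨_, rfl⟩
  have hσ0 : 0 < σ := by rw [hσ]; positivity
  have hqσ : √κ * σ = π / 16 := by rw [hσ, mul_div_cancel₀ _ hq.ne']
  have hσl : 8 * σ < l := by
    by_contra! h0
    nlinarith
  obtain ⟨y, hy, -⟩ := hX.exists_between p c hl0.le (hl.le.trans (min_le_left _ _))
  obtain ⟨z, hz1, hz2⟩ := hX.2.1 p y
  rw [dist_comm] at hz1
  obtain ⟨o, ho1, ho2⟩ := hX.exists_between z p hσ0.le (by linarith)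
  have far : ∀ w, dist z w = σ → dist p w < dist z p + σ → dist y w = dist z y + σ := by
    intro w hw hw'
    have := hX.dist_eq_of_long hκ hz1 hz2 (by rwa [hy]) (by rwa [hy])
      (w := w) (by rw [hw]; linarith)
    rw [hw] at this
    rcases this with h | h
    · linarith
    · exact h.2
  have hyo := far o ho1 (by rw [dist_comm p o]; linarith)
  have hzy : y ≠ z := fun h => by rw [h, dist_self] at hz2; linarith [h ▸ hy]
  have hzo : z ≠ o := fun h => by rw [h, dist_self] at ho1; linarith
  have thru : ∀ x ∈ ball p σ, dist z o + dist o x = dist z x := by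
    intro x hx
    rw [mem_ball, dist_comm] at hx
    have t1 := dist_triangle z x p
    have t2 := dist_triangle z p x
    rw [dist_comm x p] at t1
    obtain ⟨w, hw1, hw2⟩ := hX.exists_between z x hσ0.le (by linarith)
    have t3 := dist_triangle p x w
    rw [dist_comm x w] at t3
    have hyw := far w hw1 (by linarith)
    have hwo := hX.dist_eq_of_between hzy (a := w) (b := o) (u := z)
      (by rw [hyw, hw1, dist_comm]) (by rw [hyo, ho1, dist_comm])
      fun _ => ⟨by rw [hz2, hy]; linarith, by rw [hw1]; linarith, by rw [ho1]; linarith⟩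
    rw [hw1, ho1, sub_self, abs_zero] at hwo
    rw [← dist_eq_zero.1 hwo]
    linarith
  have small : ∀ x ∈ ball p σ, √κ * dist o x < π := by
    intro x hx
    have h1 := thru x hx
    rw [mem_ball, dist_comm] at hx
    have t2 := dist_triangle z p x
    have : √κ * dist o x ≤ √κ * (l / 2) := mul_le_mul_of_nonneg_left (by linarith) hq.le
    linarith
  exact ⟨o, σ, hσ0, fun x hx x' hx' => hX.dist_eq_of_between hzo (thru x hx) (thru x' hx')
    fun _ => ⟨by rw [dist_comm, ho1]; linarith, small x hx, small x' hx'⟩⟩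

lemma continuous_snK : Continuous (snK κ) := by
  unfold snK
  split_ifs <;> fun_prop

lemma eventually_snK_ne_zero {p a : X} (ha : snK κ (dist p a) ≠ 0) :
    ∀ᶠ x in nhds p, snK κ (dist x a) ≠ 0 :=
  (continuous_snK.comp (continuous_id.dist continuous_const)).continuousAt.eventually_ne ha

/-- Geodesics making a positive angle have different initial pieces. -/
lemma IsAlexandrov.eventually_not_between (hX : IsAlexandrov X κ) {p a b : X}
    (ha : snK κ (dist p a) ≠ 0) (hb : snK κ (dist p b) ≠ 0) (h : 0 < cangle κ a p b) :
    ∀ᶠ t in nhdsWithin (0 : ℝ) (Ioi 0), ∀ u, dist p u = t → dist u a = dist p a - t →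
      dist u b ≠ dist p b - t := by
  have h1 := (eventually_snK_ne_zero ha).and ((eventually_snK_ne_zero hb).and
    ((continuousAt_cangle ha hb).eventually_const_lt h))
  obtain ⟨r, hr, H⟩ := Metric.eventually_nhds_iff.1 h1
  have h2 : ∀ᶠ t in nhds (0 : ℝ), t < r ∧ √κ * t < π := by
    refine (eventually_lt_nhds hr).and ?_
    have : Continuous fun t : ℝ => √κ * t := by fun_prop
    exact this.continuousAt.eventually_lt_const (by simpa using Real.pi_pos)
  filter_upwards [nhdsWithin_le_nhds h2, self_mem_nhdsWithin] with t ⟨htr, htκ⟩ ht u hu hua hub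
  have ht0 : 0 < t := ht
  obtain ⟨H1, H2, H3⟩ := H (y := u) (by rwa [dist_comm, hu])
  refine H3.ne' (hX.cangle_eq_zero_of_between (q := p) (by linarith) (by linarith) ?_ H1 H2)
  rw [dist_comm, hu]
  exact (snK_pos ht0 fun _ => htκ).ne'

lemma exists_eq_of_two_values {α : Type*} {x y u v w : α} (hu : u = x ∨ u = y)
    (hv : v = x ∨ v = y) (hw : w = x ∨ w = y) : u = v ∨ u = w ∨ w = v := by
  rcases hu with rfl | rfl <;> rcases hv with rfl | rfl <;> rcases hw with rfl | rfl <;> simp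

lemma IsStrainer.locStrained_of_far (hX : IsAlexandrov X κ) (hκ : 0 < κ) {k : ℕ} {a b : Fin k → X}
    {p c : X} {δ : ℝ} (h : IsStrainer κ a b p δ) (hδ : 0 < δ) (hδ2 : δ ≤ π / 2)
    (hc : π < √κ * dist p c) : LocStrained κ k δ p := by
  have hpi := Real.pi_pos
  obtain ⟨o, σ, hσ, hiso⟩ := hX.exists_isometric_coord hκ hc
  have hne : ∀ i, snK κ (dist p (a i)) ≠ 0 ∧ snK κ (dist p (b i)) ≠ 0 := fun i =>
    snK_ne_zero_of_cangle_ne (by linarith [h.1 i])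
  have coord : ∀ t, t < σ → ∀ u, dist p u = t →
      dist o u = dist o p + t ∨ dist o u = dist o p - t := by
    intro t ht u hu
    have h1 := hiso u (by rw [mem_ball, dist_comm, hu]; exact ht) p (mem_ball_self hσ)
    rw [dist_comm, hu] at h1
    rcases abs_choice (dist o u - dist o p) with h2 | h2
    · left; linarith
    · right; linarith
  have eq_of : ∀ t, t < σ → ∀ u v, dist p u = t → dist p v = t → dist o u = dist o v → u = v := by
    intro t ht u v hu hv huv
    have h1 := hiso u (by rw [mem_ball, dist_comm, hu]; exact ht) v
      (by rw [mem_ball, dist_comm, hv]; exact ht)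
    rw [huv, sub_self, abs_zero] at h1
    exact dist_eq_zero.1 h1
  have evpos : ∀ᶠ t in nhdsWithin (0 : ℝ) (Ioi 0), 0 < t := self_mem_nhdsWithin
  have evs : ∀ᶠ t in nhdsWithin (0 : ℝ) (Ioi 0), t < σ :=
    nhdsWithin_le_nhds (eventually_lt_nhds hσ)
  have evd : ∀ q, snK κ (dist p q) ≠ 0 → ∀ᶠ t in nhdsWithin (0 : ℝ) (Ioi 0), t < dist p q :=
    fun q hq => nhdsWithin_le_nhds (eventually_lt_nhds
      (dist_pos.2 (ne_of_snK_ne_zero hq).symm))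
  have hsub : ∀ i j : Fin k, i = j := by
    intro i j
    by_contra hij
    obtain ⟨t, ht0, ht1, ht2, ht3, ht4, e1, e2, e3⟩ := (evpos.and
      (evs.and ((evd _ (hne i).1).and ((evd _ (hne i).2).and ((evd _ (hne j).1).and
      ((hX.eventually_not_between (hne i).1 (hne i).2 (by linarith [h.1 i])).and
      ((hX.eventually_not_between (hne i).1 (hne j).1 (by linarith [(h.2 i j hij).1])).and
      (hX.eventually_not_between (hne j).1 (hne i).2
        (by linarith [(h.2 j i (Ne.symm hij)).2.1]))))))))).exists
    obtain ⟨u, u1, u2⟩ := hX.exists_between p (a i) ht0.le ht2.le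
    obtain ⟨v, v1, v2⟩ := hX.exists_between p (b i) ht0.le ht3.le
    obtain ⟨w, w1, w2⟩ := hX.exists_between p (a j) ht0.le ht4.le
    have huv : dist o u ≠ dist o v := fun hh => e1 u u1 u2 (eq_of t ht1 u v u1 v1 hh ▸ v2)
    have huw : dist o u ≠ dist o w := fun hh => e2 u u1 u2 (eq_of t ht1 u w u1 w1 hh ▸ w2)
    have hwv : dist o w ≠ dist o v := fun hh => e3 w w1 w2 (eq_of t ht1 w v w1 v1 hh ▸ v2)
    rcases exists_eq_of_two_values (coord t ht1 u u1) (coord t ht1 v v1) (coord t ht1 w w1) with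
      h1 | h1 | h1
    exacts [huv h1, huw h1, hwv h1]
  intro r hr
  have evr : ∀ᶠ t in nhdsWithin (0 : ℝ) (Ioi 0), t < r ∧ √κ * t < π := by
    refine nhdsWithin_le_nhds ((eventually_lt_nhds hr).and ?_)
    have : Continuous fun t : ℝ => √κ * t := by fun_prop
    exact this.continuousAt.eventually_lt_const (by simpa using hpi)
  have evi : ∀ᶠ t in nhdsWithin (0 : ℝ) (Ioi 0), ∀ i, t < dist p (a i) ∧ t < dist p (b i) ∧
      ∀ u, dist p u = t → dist u (a i) = dist p (a i) - t → dist u (b i) ≠ dist p (b i) - t :=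
    Filter.eventually_all.2 fun i => (evd _ (hne i).1).and ((evd _ (hne i).2).and
      (hX.eventually_not_between (hne i).1 (hne i).2 (by linarith [h.1 i])))
  obtain ⟨t, ht0, ht1, ⟨htr, htκ⟩, hti⟩ := (evpos.and (evs.and (evr.and evi))).exists
  choose u u1 u2 using fun i => hX.exists_between p (a i) ht0.le (hti i).1.le
  choose v v1 v2 using fun i => hX.exists_between p (b i) ht0.le (hti i).2.1.le
  refine ⟨u, v, fun i => ⟨(u1 i).le.trans htr.le, (v1 i).le.trans htr.le⟩, fun i => ?_,
    fun i j hij => absurd (hsub i j) hij⟩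
  have hg : dist o (u i) ≠ dist o (v i) := fun hh =>
    (hti i).2.2 _ (u1 i) (u2 i) (eq_of t ht1 _ _ (u1 i) (v1 i) hh ▸ v2 i)
  have huv := hiso (u i) (by rw [mem_ball, dist_comm, u1]; exact ht1) (v i)
    (by rw [mem_ball, dist_comm, v1]; exact ht1)
  have h2t : dist (u i) (v i) = t + t := by
    rw [huv]
    rcases coord t ht1 _ (u1 i) with hu | hu <;> rcases coord t ht1 _ (v1 i) with hv | hv
    · exact absurd (hu.trans hv.symm) hg
    · rw [hu, hv, show dist o p + t - (dist o p - t) = t + t by ring, abs_of_pos (by linarith)]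
    · rw [hu, hv, show dist o p - t - (dist o p + t) = -(t + t) by ring, abs_neg,
        abs_of_pos (by linarith)]
    · exact absurd (hu.trans hv.symm) hg
  have st := (snK_pos ht0 fun _ => htκ).ne'
  rw [cangle_eq, cr_eq_neg_one (by rw [h2t, dist_comm, u1, v1]) (by rwa [u1]) (by rwa [v1]),
    Real.arccos_neg_one]
  linarith

/-- Strainers can be found at all small scales. -/
lemma IsAlexandrov.locStrained (hX : IsAlexandrov X κ) {k : ℕ} {p : X}
    (h : ∀ δ > 0, IsStrainedPt κ k δ p) {δ : ℝ} (hδ : 0 < δ) : LocStrained κ k δ p := by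
  have hpi := Real.pi_pos
  have hδ1 : min δ (π / 2) ≤ π / 2 := min_le_right _ _
  have hδ0 : 0 < min δ (π / 2) := lt_min hδ (by positivity)
  obtain ⟨a, b, hs⟩ := h _ hδ0
  refine LocStrained.mono ?_ (min_le_left δ (π / 2))
  have hne : ∀ i, snK κ (dist p (a i)) ≠ 0 ∧ snK κ (dist p (b i)) ≠ 0 := fun i =>
    snK_ne_zero_of_cangle_ne (by linarith [hs.1 i])
  by_cases hfar : 0 < κ ∧ ∃ c, π < √κ * dist p c
  · obtain ⟨hκ, c, hc⟩ := hfar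
    exact hs.locStrained_of_far hX hκ hδ0 hδ1 hc
  · have near : ∀ c, snK κ (dist p c) ≠ 0 → 0 < κ → √κ * dist p c < π := fun c hc hκ => by
      refine lt_of_le_of_ne (not_lt.1 fun hlt => hfar ⟨hκ, c, hlt⟩) fun he => hc ?_
      unfold snK
      rw [if_pos hκ, he, Real.sin_pi]
    exact hs.locStrained hX
      (fun i => ⟨ne_of_snK_ne_zero (hne i).1, ne_of_snK_ne_zero (hne i).2⟩)
      fun hκ i => ⟨near _ (hne i).1 hκ, near _ (hne i).2 hκ⟩

end Localization

section Regular

variable {X : Type*} [MetricSpace X] {κ : ℝ}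

lemma cr_zero_le {x p y : X} {r ε c D : ℝ} (hr : 0 < r) (hε : 0 < ε) (hε1 : ε ≤ 1 / 4)
    (hc : c ≤ 0) (hD0 : 0 ≤ D) (hD : D ≤ 2 * r) (hDc : D ^ 2 = (2 - 2 * c) * r ^ 2)
    (hx : (1 - 2 * ε) * r ≤ dist p x) (hx' : dist p x ≤ r)
    (hy : (1 - 2 * ε) * r ≤ dist p y) (hy' : dist p y ≤ r)
    (hd : D - 3 * ε * r ≤ dist x y) : cr 0 x p y ≤ c + 24 * ε := by
  have h0 : 1 / 2 * r ≤ (1 - 2 * ε) * r := mul_le_mul_of_nonneg_right (by linarith) hr.le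
  have hs : 0 < dist p x := by linarith
  have ht : 0 < dist p y := by linarith
  have hd0 : 0 ≤ dist x y := dist_nonneg
  unfold cr
  rw [crK_zero, div_le_iff₀ (by positivity)]
  generalize dist p x = s at *
  generalize dist p y = t at *
  generalize dist x y = d at *
  have hεr : 0 < ε * r := mul_pos hε hr
  have h1 : D ^ 2 - 12 * ε * r ^ 2 ≤ d ^ 2 := by
    have h2 : D ^ 2 - 12 * ε * r ^ 2 ≤ D ^ 2 - 6 * (ε * r) * D := by nlinarith
    refine h2.trans ?_
    rcases le_total 0 (D - 3 * ε * r) with h | h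
    · nlinarith [pow_le_pow_left₀ h hd 2]
    · nlinarith
  have h2 : s ^ 2 ≤ r ^ 2 := pow_le_pow_left₀ hs.le hx' 2
  have h3 : t ^ 2 ≤ r ^ 2 := pow_le_pow_left₀ ht.le hy' 2
  have h4 : s * t ≤ r ^ 2 := by rw [sq]; exact mul_le_mul hx' hy' ht.le hr.le
  have h5 : r ^ 2 / 4 ≤ s * t := by
    have : (1 / 2 * r) * (1 / 2 * r) ≤ s * t :=
      mul_le_mul (by linarith) (by linarith) (by linarith) hs.le
    linarith
  have h6 := mul_le_mul_of_nonpos_left h4 hc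
  have h7 := mul_le_mul_of_nonneg_left h5 hε.le
  linarith

lemma dist_sq_single_single {m : ℕ} {i j : Fin m} (hij : i ≠ j) (s t : ℝ) :
    dist (EuclideanSpace.single i s) (EuclideanSpace.single j t) ^ 2 = s ^ 2 + t ^ 2 := by
  rw [dist_eq_norm, @norm_sub_sq ℝ, EuclideanSpace.inner_single_left]
  simp [hij, sq_abs]

/-- A regular point admits arbitrarily fine strainers. -/
lemma IsRegularPt.isStrainedPt {E : Set X} {m : ℕ} {p : X} (h : IsRegularPt E m p) (hp : p ∈ E)
    {δ : ℝ} (hδ : 0 < δ) : IsStrainedPt κ m δ p := by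
  have hpi := Real.pi_pos
  suffices H : ∀ δ, 0 < δ → δ ≤ π / 2 → IsStrainedPt κ m δ p by
    obtain ⟨a, b, hs⟩ := H (min δ (π / 2)) (lt_min hδ (by positivity)) (min_le_right _ _)
    exact ⟨a, b, hs.mono (min_le_left _ _)⟩
  clear hδ δ
  intro δ hδ hδ2
  have hsin : 0 < Real.sin δ := Real.sin_pos_of_pos_of_lt_pi hδ (by linarith)
  have hcos : 0 < 1 - Real.cos δ := by
    have := Real.cos_lt_cos_of_nonneg_of_le_pi le_rfl (by linarith : δ ≤ π) hδ
    rw [Real.cos_zero] at this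
    linarith
  obtain ⟨e, he, he1, he2, he3⟩ : ∃ e > 0, e ≤ 1 / 4 ∧ 26 * e < Real.sin δ ∧
      26 * e < 1 - Real.cos δ := by
    have : 0 < min (min (Real.sin δ) (1 - Real.cos δ)) 1 := lt_min (lt_min hsin hcos) one_pos
    have h1 := min_le_left (min (Real.sin δ) (1 - Real.cos δ)) 1
    have h2 := min_le_left (Real.sin δ) (1 - Real.cos δ)
    have h3 := min_le_right (Real.sin δ) (1 - Real.cos δ)
    have h4 := min_le_right (min (Real.sin δ) (1 - Real.cos δ)) 1
    refine ⟨min (min (Real.sin δ) (1 - Real.cos δ)) 1 / 27, ?_, ?_, ?_, ?_⟩ <;> linarith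
  obtain ⟨R, hG⟩ := exists_goodScale κ he
  obtain ⟨r₀, hr₀, H⟩ := h e he
  obtain ⟨r, hr, hrr, hrR⟩ : ∃ r > 0, r < r₀ ∧ r ≤ R :=
    ⟨min (r₀ / 2) R, lt_min (half_pos hr₀) hG.pos,
      lt_of_le_of_lt (min_le_left _ _) (half_lt_self hr₀), min_le_right _ _⟩
  obtain ⟨f, f0, f1, f2⟩ := H r hr hrr
  have hpr : p ∈ E ∩ closedBall p r := ⟨hp, mem_closedBall_self hr.le⟩
  have key : ∀ v w : EuclideanSpace ℝ (Fin m), ∀ x y c, ‖v‖ = r → ‖w‖ = r → c ≤ 0 →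
      dist v w ^ 2 = (2 - 2 * c) * r ^ 2 →
      x ∈ E ∩ closedBall p r ∧ dist (f x) v ≤ e * r →
      y ∈ E ∩ closedBall p r ∧ dist (f y) w ≤ e * r → cr κ x p y ≤ c + 26 * e := by
    intro v w x y c hv hw hc hvw hx hy
    have near : ∀ v x, ‖v‖ = r → x ∈ E ∩ closedBall p r ∧ dist (f x) v ≤ e * r →
        (1 - 2 * e) * r ≤ dist p x ∧ dist p x ≤ r := by
      intro v x hv hx
      have h1 := (abs_le.1 (f1 x hx.1 p hpr)).2
      have h2 := dist_triangle v (f x) 0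
      rw [dist_zero_right, hv, dist_comm v] at h2
      rw [f0, dist_comm x] at h1
      have h3 := hx.1.2
      rw [mem_closedBall, dist_comm] at h3
      exact ⟨by linarith [hx.2], h3⟩
    have hD : dist v w ≤ 2 * r := by
      rw [dist_eq_norm]
      linarith [norm_sub_le v w]
    have hd : dist v w - 3 * e * r ≤ dist x y := by
      have h1 := (abs_le.1 (f1 x hx.1 y hy.1)).2
      have h2 := dist_triangle4 v (f x) (f y) w
      rw [dist_comm v (f x)] at h2
      linarith [hx.2, hy.2]
    obtain ⟨x1, x2⟩ := near v x hv hx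
    obtain ⟨y1, y2⟩ := near w y hw hy
    have h0 := cr_zero_le hr he he1 hc dist_nonneg hD hvw x1 x2 y1 y2 hd
    have hpos : 0 < (1 - 2 * e) * r := mul_pos (by linarith) hr
    have h1 := hG.abs_cr_sub_le he.le (dist_pos.1 (hpos.trans_le x1)).symm
      (dist_pos.1 (hpos.trans_le y1)).symm (x2.trans hrR) (y2.trans hrR)
    linarith [(abs_le.1 h1).2]
  have nrm : ∀ i : Fin m, ‖EuclideanSpace.single i r‖ = r ∧ ‖EuclideanSpace.single i (-r)‖ = r :=
    fun i => ⟨by simp [abs_of_pos hr], by simp [abs_of_pos hr]⟩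
  choose a ha using fun i : Fin m => f2 (EuclideanSpace.single i r)
    (by rw [mem_closedBall_zero_iff, (nrm i).1])
  choose b hb using fun i : Fin m => f2 (EuclideanSpace.single i (-r))
    (by rw [mem_closedBall_zero_iff, (nrm i).2])
  refine ⟨a, b, fun i => ?_, fun i j hij => ?_⟩
  · rw [cangle_eq]
    refine pi_sub_lt_arccos hδ (by linarith) ?_
    have := key _ _ _ _ (-1) (nrm i).1 (nrm i).2 (by norm_num)
      (by rw [PiLp.dist_single_same, Real.dist_eq, sq_abs]; ring) (ha i) (hb i)
    linarith
  · rw [cangle_eq, cangle_eq, cangle_eq]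
    have perp : ∀ s t : ℝ, s ^ 2 = r ^ 2 → t ^ 2 = r ^ 2 →
        dist (EuclideanSpace.single i s) (EuclideanSpace.single j t) ^ 2 =
          (2 - 2 * 0) * r ^ 2 := fun s t hs ht => by
      rw [dist_sq_single_single hij, hs, ht]; ring
    refine ⟨pi_div_two_sub_lt_arccos hδ hδ2 ?_, pi_div_two_sub_lt_arccos hδ hδ2 ?_,
      pi_div_two_sub_lt_arccos hδ hδ2 ?_⟩
    · linarith [key _ _ _ _ 0 (nrm i).1 (nrm j).1 le_rfl (perp _ _ rfl rfl) (ha i) (ha j)]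
    · linarith [key _ _ _ _ 0 (nrm i).1 (nrm j).2 le_rfl (perp _ _ rfl (neg_sq r)) (ha i) (hb j)]
    · linarith [key _ _ _ _ 0 (nrm i).2 (nrm j).2 le_rfl (perp _ _ (neg_sq r) (neg_sq r)) (hb i)
        (hb j)]

end Regular


/-- a point of an `m`-dimensional primitive extremal subset is regular
iff it is `(m,δ)`-strained for every `δ > 0`. -/
theorem stmt4 {X : Type*} [MetricSpace X] (κ : ℝ) (hX : IsAlexandrov X κ)
    (n : ℕ) (hdim : dimH (Set.univ : Set X) = n)
    (E : Set X) (m : ℕ) (hE : IsPrimitiveExtremal κ E) (hEdim : dimH E = m)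
    (p : X) (hp : p ∈ E) :
    IsRegularPt E m p ↔ ∀ δ > (0:ℝ), IsStrainedPt κ m δ p :=
  ⟨fun h _ hδ => h.isStrainedPt hp hδ,
    fun h => hE.1.isRegularPt hX hdim hEdim hp fun _ hδ => hX.locStrained h hδ⟩
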